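/- Let N = p₁^m p₂^n, where m, n ≥ 1 and p₁, p₂ are primes with p₁ ≡ 1 (mod 4) and p₂ ≡ 3 (mod 4). Let p be a prime with ord_{p₁^m}(p) = φ(p₁^m), ord_{p₂^n}(p) = φ(p₂^n), and f := ord_N(p) = φ(N)/2. Let q = p^f, let γ be a primitive element of F_q, let C_i = γ^i⟨γ^N⟩ be the cyclotomic classes of order N, and let D = ⋃_{i=0}^{p₁^{m−1}−1} ⋃_{j=0}^{p₂^{n−1}−1} C_{p₂^n i + p₁^m j}. Let h be the class number of Q(√(−p₁p₂)), and suppose h is even and there exist b, c ∈ {1, −1} with 4p^h = b² + p₁p₂c², b·p^{(f−h)/2} ≡ 2 (mod p₁p₂), p₁ = 2p^{h/2} + b, and p₂ = 2p^{h/2} − b. Then 0 ∉ D, −D = D, and the Cayley graph Cay(F_q, D) is a strongly regular graph. -/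

import Mathlib

open scoped Classical Pointwise

/-- The cyclotomic class `C_i = γ^i ⟨γ^N⟩ = {γ^{i+Nk} : k ∈ ℤ}` of order `N` of a finite
field, with respect to the primitive element `γ`. -/
def cycClass {F : Type*} [Field F] (γ : Fˣ) (N i : ℕ) : Set F :=
  {x : F | ∃ k : ℤ, x = ((γ ^ ((i : ℤ) + (N : ℤ) * k) : Fˣ) : F)}

/-- The Cayley graph on the additive group `G` with connection set `D`. -/
def cayley {G : Type*} [AddGroup G] (D : Set G) : SimpleGraph G :=
  SimpleGraph.fromRel fun x y => x - y ∈ D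


section NF
open NumberField



lemma quad_repr {K : Type*} [Field K] [NumberField K] (α : K) (d : ℕ)
    (hα : α ^ 2 = -(d : K)) (hKα : Algebra.adjoin ℚ {α} = ⊤) (x : K) :
    ∃ u v : ℚ, x = u + v * α := by
  have hx : x ∈ Algebra.adjoin ℚ {α} := by rw [hKα]; trivial
  induction hx using Algebra.adjoin_induction with
  | mem y hy => 
    rw [Set.mem_singleton_iff] at hy
    exact ⟨0, 1, by simp [hy]⟩
  | algebraMap r => exact ⟨r, 0, by simp⟩
  | add y z _ _ hy hz =>
    obtain ⟨u, v, rfl⟩ := hy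
    obtain ⟨u', v', rfl⟩ := hz
    exact ⟨u + u', v + v', by push_cast; ring⟩
  | mul y z _ _ hy hz =>
    obtain ⟨u, v, rfl⟩ := hy
    obtain ⟨u', v', rfl⟩ := hz
    refine ⟨u * u' - d * v * v', u * v' + v * u', by push_cast; linear_combination (v * v' : K) * hα⟩

lemma quad_indep {K : Type*} [Field K] [NumberField K] (α : K) (d : ℕ) (hd : 0 < d)
    (hα : α ^ 2 = -(d : K)) (u v : ℚ) (h : (u : K) + v * α = 0) : u = 0 ∧ v = 0 := by
  have h1 : (u : K) ^ 2 + d * v ^ 2 = 0 := by linear_combination (u - v * α : K) * h - (- v ^ 2 : K) * hα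
  have h2 : u ^ 2 + d * v ^ 2 = 0 := by exact_mod_cast h1
  have hd' : (0 : ℚ) < d := by exact_mod_cast hd
  have h3 : v = 0 := by
    by_contra hv
    have : 0 < v ^ 2 := by positivity
    nlinarith [sq_nonneg u]
  subst h3
  simpa using h2

lemma quad_norm_trace {K : Type*} [Field K] [NumberField K] (α : K) (d : ℕ) (hd : 0 < d)
    (hα : α ^ 2 = -(d : K)) (hKα : Algebra.adjoin ℚ {α} = ⊤) (u v : ℚ) :
    Algebra.norm ℚ ((u : K) + v * α) = u ^ 2 + d * v ^ 2 ∧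
    Algebra.trace ℚ K ((u : K) + v * α) = 2 * u := by
  have li : LinearIndependent ℚ ![(1 : K), α] := by
    rw [LinearIndependent.pair_iff]
    intro s t h
    apply quad_indep α d hd hα
    simpa [Algebra.smul_def] using h
  have sp : ⊤ ≤ Submodule.span ℚ (Set.range ![(1 : K), α]) := by
    intro x _
    obtain ⟨a, c, rfl⟩ := quad_repr α d hα hKα x
    have : (a : K) + c * α = a • (1 : K) + c • α := by simp [Algebra.smul_def]
    rw [this]
    apply Submodule.add_mem
    · exact Submodule.smul_mem _ _ (Submodule.subset_span ⟨0, by simp⟩)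
    · exact Submodule.smul_mem _ _ (Submodule.subset_span ⟨1, by simp⟩)
  let B := Module.Basis.mk li sp
  have hB0 : B 0 = 1 := by simp [B]
  have hB1 : B 1 = α := by simp [B]
  have hr : ∀ a c : ℚ, ∀ y : K, y = a + c * α → B.repr y 0 = a ∧ B.repr y 1 = c := by
    intro a c y hy
    have : y = a • B 0 + c • B 1 := by rw [hB0, hB1, hy]; simp [Algebra.smul_def]
    rw [this]
    simp
  have e0 := hr u v ((u + v * α) * B 0) (by rw [hB0]; ring)
  have e1 := hr (-d * v) u ((u + v * α) * B 1) (by rw [hB1]; push_cast; linear_combination (v : K) * hα)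
  rw [Algebra.norm_eq_matrix_det B, Algebra.trace_eq_matrix_trace B, Matrix.det_fin_two,
    Matrix.trace_fin_two]
  simp only [Algebra.leftMulMatrix_eq_repr_mul]
  rw [e0.1, e0.2, e1.1, e1.2]
  constructor <;> ring

lemma int_of_sqfree (d : ℕ) (hd : Squarefree d) (w : ℚ) (k : ℤ) (h : (d : ℚ) * w ^ 2 = k) :
    ∃ z : ℤ, w = z := by
  have hden : (w.den : ℚ) ≠ 0 := by exact_mod_cast w.den_nz
  have h1 : (d : ℤ) * w.num ^ 2 = k * (w.den : ℤ) ^ 2 := by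
    have : (d : ℚ) * w.num ^ 2 = k * (w.den : ℚ) ^ 2 := by
      rw [← h, ← Rat.mul_den_eq_num w]
      ring
    exact_mod_cast this
  have h2 : ((w.den : ℤ)) ^ 2 ∣ (d : ℤ) := by
    have hc : IsCoprime ((w.den : ℤ) ^ 2) (w.num ^ 2) := by
      apply IsCoprime.pow
      rw [Int.isCoprime_iff_gcd_eq_one]
      have := w.reduced
      rw [Nat.Coprime] at this
      rw [Int.gcd_comm]
      simpa [Int.gcd] using this
    exact hc.dvd_of_dvd_mul_right ⟨k, by linarith⟩
  have h3 : w.den * w.den ∣ d := by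
    have : ((w.den * w.den : ℕ) : ℤ) ∣ (d : ℤ) := by push_cast; rw [← sq]; exact h2
    exact_mod_cast this
  have h4 := hd _ h3
  rw [Nat.isUnit_iff] at h4
  exact ⟨w.num, by conv_lhs => rw [← Rat.num_div_den w, h4]; simp⟩

/-- generators of small norm are rational integers. -/
lemma quad_small {K : Type*} [Field K] [NumberField K] (α : K) (d : ℕ) (hd : Squarefree d)
    (hα : α ^ 2 = -(d : K)) (hKα : Algebra.adjoin ℚ {α} = ⊤) (β : 𝓞 K)
    (hs : 4 * Ideal.absNorm (Ideal.span {β}) < d) : ∃ z : ℤ, β = z ∧ 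
      (Ideal.absNorm (Ideal.span {β}) : ℤ) = z ^ 2 := by
  have hd0 : 0 < d := Nat.pos_of_ne_zero hd.ne_zero
  obtain ⟨u, v, huv⟩ := quad_repr α d hα hKα (β : K)
  obtain ⟨h1, h2⟩ := quad_norm_trace α d hd0 hα hKα u v
  rw [← huv, ← Algebra.coe_norm_int] at h1
  rw [← huv, ← Algebra.coe_trace_int] at h2
  rw [Ideal.absNorm_span_singleton] at hs ⊢
  set M := Algebra.norm ℤ β
  set T := Algebra.trace ℤ (𝓞 K) β
  obtain ⟨w, hw⟩ := int_of_sqfree d hd (2 * v) (4 * M - T ^ 2) (by push_cast; rw [h1, h2]; ring)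
  have hM : 0 ≤ M := by
    have : (0 : ℚ) ≤ M := by rw [h1]; positivity
    exact_mod_cast this
  have h3 : 4 * M = T ^ 2 + d * w ^ 2 := by
    have : (4 : ℚ) * M = T ^ 2 + d * w ^ 2 := by rw [h1, h2, ← hw]; ring
    exact_mod_cast this
  have hs' : 4 * M < d := by omega
  have hw0 : w = 0 := by
    by_contra hne
    have : 0 < w ^ 2 := by positivity
    nlinarith [sq_nonneg T]
  have hv : v = 0 := by rw [hw0] at hw; simpa using hw
  subst hv
  have hβ : IsIntegral ℤ (u : K) := by
    have : IsIntegral ℤ (β : K) := RingOfIntegers.isIntegral_coe β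
    rw [huv] at this
    simpa using this
  have hu : IsIntegral ℤ u := by
    have h5 : IsIntegral ℤ (algebraMap ℚ K u) := by simpa using hβ
    exact (isIntegral_algebraMap_iff (algebraMap ℚ K).injective).1 h5
  obtain ⟨z, hz⟩ := IsIntegrallyClosed.isIntegral_iff.1 hu
  have hz' : u = z := by rw [← hz]; simp
  refine ⟨z, ?_, ?_⟩
  · apply RingOfIntegers.ext
    rw [huv, hz']; simp
  · have : (M : ℚ) = z ^ 2 := by rw [h1, hz']; simp
    have h6 : M = z ^ 2 := by exact_mod_cast this
    omega

/-- splitting of an odd prime. -/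
lemma quad_split {K : Type*} [Field K] [NumberField K] (α : K) (d : ℕ) (hd0 : 0 < d)
    (hα : α ^ 2 = -(d : K)) (hKα : Algebra.adjoin ℚ {α} = ⊤) (l : ℕ) (hl : l.Prime) (r : ℤ)
    (hr : (l : ℤ) ∣ r ^ 2 + d) (h2r : ¬ (l : ℤ) ∣ 2 * r) :
    ∃ I J : Ideal (𝓞 K), I * J = Ideal.span {(l : 𝓞 K)} ∧ Ideal.absNorm I = l ∧
      Ideal.absNorm J = l ∧ ¬ I ≤ J := by
  have hαi : IsIntegral ℤ α := by
    refine ⟨Polynomial.X ^ 2 + Polynomial.C (d : ℤ), Polynomial.monic_X_pow_add_C _ (by norm_num), ?_⟩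
    simp [hα]
  obtain ⟨a, ha⟩ : ∃ a : 𝓞 K, (a : K) = α := ⟨⟨α, hαi⟩, rfl⟩
  have ha2 : a ^ 2 = -(d : 𝓞 K) := by
    apply RingOfIntegers.ext
    have : (a : K) ^ 2 = -(d : K) := by rw [ha, hα]
    simpa using this
  obtain ⟨k, hk⟩ := hr
  have hcop : IsCoprime (l : ℤ) (2 * r) := by
    exact (Prime.coprime_iff_not_dvd (Nat.prime_iff_prime_int.1 hl)).2 h2r
  obtain ⟨x, y, hxy⟩ := hcop
  have hk' : (r : 𝓞 K) ^ 2 + d = l * k := by exact_mod_cast congrArg (Int.cast : ℤ → 𝓞 K) hk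
  have hxy' : (x : 𝓞 K) * l + y * (2 * r) = 1 := by exact_mod_cast congrArg (Int.cast : ℤ → 𝓞 K) hxy
  let I : Ideal (𝓞 K) := Ideal.span {(l : 𝓞 K), a - r}
  let J : Ideal (𝓞 K) := Ideal.span {(l : 𝓞 K), a + r}
  have hIJ : I * J = Ideal.span {(l : 𝓞 K)} := by
    apply le_antisymm
    · simp only [I, J, Ideal.span_pair_mul_span_pair]
      rw [Ideal.span_le]
      intro z hz
      simp only [Set.mem_insert_iff, Set.mem_singleton_iff] at hz
      rw [SetLike.mem_coe, Ideal.mem_span_singleton]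
      rcases hz with rfl | rfl | rfl | rfl
      · exact Dvd.intro _ rfl
      · exact Dvd.intro _ rfl
      · exact Dvd.intro_left _ rfl
      · exact ⟨-k, by linear_combination ha2 - hk'⟩
    · rw [Ideal.span_singleton_le_iff_mem]
      have l1 : (l : 𝓞 K) ∈ I := Ideal.subset_span (by simp)
      have l2 : (l : 𝓞 K) ∈ J := Ideal.subset_span (by simp)
      have l3 : a - r ∈ I := Ideal.subset_span (by simp)
      have l4 : a + r ∈ J := Ideal.subset_span (by simp)
      have : (l : 𝓞 K) = x * (l * l) + y * (l * (a + r) - (a - r) * l) := by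
        linear_combination - (l : 𝓞 K) * hxy'
      rw [this]
      exact Ideal.add_mem _ (Ideal.mul_mem_left _ _ (Ideal.mul_mem_mul l1 l2))
        (Ideal.mul_mem_left _ _ (Ideal.sub_mem _ (Ideal.mul_mem_mul l1 l4) (Ideal.mul_mem_mul l3 l2)))
  have hlne : (l : ℚ) ≠ 0 := by exact_mod_cast hl.ne_zero
  have key : ∀ s : ℤ, ¬ (l : ℤ) ∣ 2 * s → ¬ (l : 𝓞 K) ∣ a + s := by
    rintro s hs ⟨c, hc⟩
    have h1 : (α : K) + s = l * c := by
      rw [← ha]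
      have := congrArg (fun t : 𝓞 K => (t : K)) hc
      simpa using this
    have h2 := (quad_norm_trace α d hd0 hα hKα (s / l) (1 / l)).2
    have hlK : (l : K) ≠ 0 := by exact_mod_cast hl.ne_zero
    have h3 : (((s / l : ℚ) : K) + ((1 / l : ℚ) : K) * α) = c := by
      push_cast
      field_simp
      rw [← h1]; ring
    rw [h3, ← Algebra.coe_trace_int] at h2
    apply hs
    refine ⟨Algebra.trace ℤ (𝓞 K) c, ?_⟩
    have : (2 * s : ℚ) = l * (Algebra.trace ℤ (𝓞 K) c : ℤ) := by rw [h2]; field_simp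
    exact_mod_cast this
  have hnl : Ideal.absNorm (Ideal.span {(l : 𝓞 K)}) = l * l := by
    rw [Ideal.absNorm_span_singleton]
    have h2 := (quad_norm_trace α d hd0 hα hKα l 0).1
    have h4 : Algebra.norm ℤ (l : 𝓞 K) = l * l := by
      have h3 : ((Algebra.norm ℤ (l : 𝓞 K) : ℤ) : ℚ) = l * l := by
        rw [Algebra.coe_norm_int]
        have : (((l : ℚ) : K) + ((0 : ℚ) : K) * α) = ((l : 𝓞 K) : K) := by simp
        rw [← this, h2]; ring
      exact_mod_cast h3
    rw [h4]
    exact Int.natAbs_natCast (l * l)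
  have hmul : Ideal.absNorm I * Ideal.absNorm J = l * l := by rw [← map_mul, hIJ, hnl]
  have hI1 : Ideal.absNorm I ≠ 1 := by
    rw [Ne, Ideal.absNorm_eq_one_iff]
    intro h
    rw [h, Ideal.top_mul] at hIJ
    have l4 : a + r ∈ J := Ideal.subset_span (by simp)
    rw [hIJ, Ideal.mem_span_singleton] at l4
    exact key r h2r l4
  have hJ1 : Ideal.absNorm J ≠ 1 := by
    rw [Ne, Ideal.absNorm_eq_one_iff]
    intro h
    rw [h, Ideal.mul_top] at hIJ
    have l4 : a - r ∈ I := Ideal.subset_span (by simp)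
    rw [hIJ, Ideal.mem_span_singleton] at l4
    refine key (-r) (by simpa using h2r) ?_
    simpa [sub_eq_add_neg] using l4
  have hI : Ideal.absNorm I = l ∧ Ideal.absNorm J = l := by
    exact (Nat.Prime.mul_eq_prime_sq_iff hl hI1 hJ1).1 (by rw [hmul, sq])
  refine ⟨I, J, hIJ, hI.1, hI.2, fun hle => hJ1 ?_⟩
  rw [Ideal.absNorm_eq_one_iff, Ideal.eq_top_iff_one, ← hxy']
  have l2 : (l : 𝓞 K) ∈ J := Ideal.subset_span (by simp)
  have l3 : a - r ∈ J := hle (Ideal.subset_span (by simp))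
  have l4 : a + r ∈ J := Ideal.subset_span (by simp)
  refine Ideal.add_mem _ (Ideal.mul_mem_left _ _ l2) (Ideal.mul_mem_left _ _ ?_)
  have : (2 * r : 𝓞 K) = (a + r) - (a - r) := by ring
  rw [this]; exact Ideal.sub_mem _ l4 l3

lemma gen_of_card {G : Type*} [Group G] [Finite G] (g : G) (n : ℕ) (hc : Nat.card G = n)
    (hpow : ∀ k : ℕ, 0 < k → k < n → g ^ k ≠ 1) : g ^ n = 1 ∧ ∀ x : G, ∃ j < n, g ^ j = x := by
  have h1 : orderOf g ∣ n := by rw [← hc]; exact orderOf_dvd_natCard g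
  have hn : 0 < n := by rw [← hc]; exact Nat.card_pos
  have h2 := Nat.le_of_dvd hn h1
  have h3 : orderOf g = n := by
    by_contra hne
    exact hpow _ (orderOf_pos g) (by omega) (pow_orderOf_eq_one g)
  refine ⟨by rw [← h3, pow_orderOf_eq_one], fun x => ?_⟩
  have : Subgroup.zpowers g = ⊤ := by
    apply Subgroup.eq_top_of_card_eq
    rw [Nat.card_zpowers, h3, hc]
  have hx : x ∈ Subgroup.zpowers g := by rw [this]; trivial
  classical
  rw [← mem_powers_iff_mem_zpowers, (isOfFinOrder_of_finite g).mem_powers_iff_mem_range_orderOf] at hx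
  obtain ⟨j, hj, hgj⟩ := Finset.mem_image.1 hx
  rw [Finset.mem_range, h3] at hj
  exact ⟨j, hj, hgj⟩

set_option maxHeartbeats 1600000 in
lemma class_contra {K : Type*} [Field K] [NumberField K] (α : K) (d : ℕ) (hd : Squarefree d)
    (hα : α ^ 2 = -(d : K)) (hKα : Algebra.adjoin ℚ {α} = ⊤) (e : ℕ) (he : 1 ≤ e)
    (hde : d + 1 = 4 * 9 ^ e) (hcl : classNumber K = 2 * e)
    (l : ℕ) (hl : l.Prime) (hl3 : 3 < l) (hle : l < 3 ^ e) (r : ℤ)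
    (hr : (l : ℤ) ∣ r ^ 2 + d) (hld : ¬ l ∣ d) : False := by
  have hd0 : 0 < d := Nat.pos_of_ne_zero hd.ne_zero
  have h9 : (9 : ℕ) ^ e = 3 ^ e * 3 ^ e := by rw [← mul_pow]; norm_num
  have h3d : (3 : ℤ) ∣ 1 ^ 2 + d := by
    have : (1 ^ 2 + d : ℤ) = 3 * (3 * (4 * 9 ^ (e - 1))) := by
      have h1 : (9 : ℕ) ^ e = 9 * 9 ^ (e - 1) := by rw [← pow_succ', Nat.sub_add_cancel he]
      rw [h1] at hde
      zify at hde
      linarith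
    exact ⟨_, this⟩
  obtain ⟨P, Q, hPQ, hP, hQ, hnPQ⟩ := quad_split α d hd0 hα hKα 3 Nat.prime_three 1
    (by exact_mod_cast h3d) (by norm_num)
  have h2r : ¬ (l : ℤ) ∣ 2 * r := by
    intro h
    have hlp : Prime (l : ℤ) := Nat.prime_iff_prime_int.1 hl
    rcases hlp.dvd_or_dvd h with h | h
    · have := Int.le_of_dvd (by norm_num) h
      omega
    · have h1 : (l : ℤ) ∣ d := by
        have := dvd_sub hr (Dvd.dvd.pow h (two_ne_zero))
        simpa using this
      exact hld (by exact_mod_cast h1)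
  obtain ⟨I, J, hIJ, hI, hJ, -⟩ := quad_split α d hd0 hα hKα l hl r hr h2r
  have nz : ∀ {X : Ideal (𝓞 K)} {c : ℕ}, Ideal.absNorm X = c → c ≠ 0 → X ∈ nonZeroDivisors (Ideal (𝓞 K)) := by
    intro X c h hc
    rw [mem_nonZeroDivisors_iff_ne_zero]
    rintro rfl
    simp at h
    exact hc h.symm
  have hP0 := nz hP (by norm_num)
  have hQ0 := nz hQ (by norm_num)
  have hI0 := nz hI hl.ne_zero
  set g := ClassGroup.mk0 (⟨P, hP0⟩ : nonZeroDivisors (Ideal (𝓞 K))) with hg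
  have hgQ : g * ClassGroup.mk0 (⟨Q, hQ0⟩ : nonZeroDivisors (Ideal (𝓞 K))) = 1 := by
    rw [hg, ← map_mul]
    rw [MulMemClass.mk_mul_mk, ClassGroup.mk0_eq_one_iff, hPQ]
    exact ⟨⟨_, rfl⟩⟩
  have hpow : ∀ k : ℕ, 0 < k → k < 2 * e → g ^ k ≠ 1 := by
    intro k hk hk2 h
    rw [hg, ← map_pow, SubmonoidClass.mk_pow, ClassGroup.mk0_eq_one_iff] at h
    obtain ⟨⟨β, hβ⟩⟩ := h
    have hβ' : P ^ k = Ideal.span {β} := hβ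
    have hn : Ideal.absNorm (Ideal.span {β}) = 3 ^ k := by rw [← hβ', map_pow, hP]
    have h3k : 3 * 3 ^ k ≤ 9 ^ e := by
      rw [h9, ← pow_add, ← pow_succ']
      exact Nat.pow_le_pow_right (by norm_num) (by omega)
    have h3k' : 0 < 3 ^ k := by positivity
    obtain ⟨z, hz, hz2⟩ := quad_small α d hd hα hKα β (by rw [hn]; omega)
    rw [hn] at hz2
    have hz3 : (3 : ℤ) ∣ z := by
      apply Int.prime_three.dvd_of_dvd_pow (n := 2)
      rw [← hz2]
      push_cast
      exact dvd_pow_self _ hk.ne'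
    have hle1 : P ^ k ≤ Q := by
      rw [hβ', Ideal.span_singleton_le_iff_mem, hz]
      obtain ⟨w, rfl⟩ := hz3
      have h3Q : (3 : 𝓞 K) ∈ Q := by
        have : (3 : 𝓞 K) ∈ P * Q := by rw [hPQ]; exact Ideal.mem_span_singleton_self _
        exact (Ideal.mul_le_right (I := P) (J := Q)) this
      push_cast
      exact Ideal.mul_mem_right _ _ h3Q
    have hQp : Q.IsPrime := Ideal.isPrime_of_irreducible_absNorm (by rw [hQ]; exact Nat.prime_three)
    exact hnPQ (hQp.le_of_pow_le hle1)
  have hc : Nat.card (ClassGroup (𝓞 K)) = 2 * e := by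
    rw [← hcl, classNumber, Nat.card_eq_fintype_card]
  obtain ⟨hc2, hall⟩ := gen_of_card g (2 * e) hc hpow
  obtain ⟨j, hj, hgj⟩ := hall (ClassGroup.mk0 ⟨I, hI0⟩)
  -- final contradiction from a principal ideal of small norm
  have fin : ∀ (R : Ideal (𝓞 K)) (hR0 : R ∈ nonZeroDivisors (Ideal (𝓞 K))) (i : ℕ), i ≤ e →
      Ideal.absNorm R = 3 → 
      ClassGroup.mk0 (⟨I, hI0⟩ : nonZeroDivisors (Ideal (𝓞 K))) * ClassGroup.mk0 ⟨R, hR0⟩ ^ i = 1 → False := by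
    intro R hR0 i hi hR h
    rw [← map_pow, SubmonoidClass.mk_pow, ← map_mul, MulMemClass.mk_mul_mk, ClassGroup.mk0_eq_one_iff] at h
    obtain ⟨⟨β, hβ⟩⟩ := h
    have hβ' : I * R ^ i = Ideal.span {β} := hβ
    have hn : Ideal.absNorm (Ideal.span {β}) = l * 3 ^ i := by rw [← hβ', map_mul, map_pow, hR, hI]
    have hb : l * 3 ^ i < 9 ^ e := by
      rw [h9]
      have : 3 ^ i ≤ 3 ^ e := Nat.pow_le_pow_right (by norm_num) hi
      calc l * 3 ^ i ≤ l * 3 ^ e := Nat.mul_le_mul_left _ this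
        _ < 3 ^ e * 3 ^ e := Nat.mul_lt_mul_of_pos_right hle (by positivity)
    obtain ⟨z, hz, hz2⟩ := quad_small α d hd hα hKα β (by rw [hn]; omega)
    rw [hn] at hz2
    have hz3 : l * 3 ^ i = z.natAbs ^ 2 := by
      zify; rw [sq_abs]; exact_mod_cast hz2
    have hlz : l ∣ z.natAbs := hl.dvd_of_dvd_pow (n := 2) ⟨_, hz3.symm⟩
    obtain ⟨w, hw⟩ := hlz
    rw [hw] at hz3
    have h5 : 3 ^ i = l * w ^ 2 := by
      apply Nat.eq_of_mul_eq_mul_left hl.pos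
      rw [hz3]; ring
    have h6 : l ∣ 3 := hl.dvd_of_dvd_pow (n := i) ⟨_, h5⟩
    have := Nat.le_of_dvd (by norm_num) h6
    omega
  rcases le_total j e with hje | hje
  · refine fin Q hQ0 j hje hQ ?_
    rw [← hgj, ← mul_pow, hgQ, one_pow]
  · refine fin P hP0 (2 * e - j) (by omega) hP ?_
    rw [← hgj, ← hg, ← pow_add, Nat.add_sub_cancel' hj.le, hc2]

set_option maxHeartbeats 1600000 in
lemma e_le_two {K : Type*} [Field K] [NumberField K] (α : K) (p₁ p₂ : ℕ) (hp₁ : p₁.Prime)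
    (hp₂ : p₂.Prime) (hα : α ^ 2 = -((p₁ : K) * p₂)) (hKα : Algebra.adjoin ℚ {α} = ⊤) (e : ℕ)
    (he : 1 ≤ e) (h1 : p₁ + 1 = 2 * 3 ^ e) (h2 : p₂ = 2 * 3 ^ e + 1)
    (hcl : classNumber K = 2 * e) : e ≤ 2 := by
  by_contra hlt
  have he3 : 3 ≤ e := by omega
  have hne : p₁ ≠ p₂ := by omega
  have hd : Squarefree (p₁ * p₂) := by
    rw [Nat.squarefree_mul ((Nat.coprime_primes hp₁ hp₂).2 hne)]
    exact ⟨hp₁.squarefree, hp₂.squarefree⟩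
  have hde : p₁ * p₂ + 1 = 4 * 9 ^ e := by
    have h9 : (9 : ℕ) ^ e = 3 ^ e * 3 ^ e := by rw [← mul_pow]; norm_num
    rw [h9]
    have : p₁ = 2 * 3 ^ e - 1 := by omega
    have h3 : 0 < 3 ^ e := by positivity
    zify [show 1 ≤ 2 * 3 ^ e by omega] at *
    rw [this, h2]; ring
  have h27 : 27 ≤ 3 ^ e := by
    calc 27 = 3 ^ 3 := by norm_num
      _ ≤ 3 ^ e := Nat.pow_le_pow_right (by norm_num) he3
  have main : ∀ l : ℕ, l.Prime → 3 < l → l < 3 ^ e → ∀ r : ℤ, ¬ (l : ℤ) ∣ r ^ 2 + (p₁ * p₂ : ℕ) := by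
    intro l hl hl3 hle r hr
    refine class_contra α (p₁ * p₂) hd (by rw [hα]; push_cast; rfl) hKα e he hde hcl l hl hl3 hle r hr ?_
    intro h
    rcases (Nat.Prime.dvd_mul hl).1 h with h | h
    · rw [Nat.prime_dvd_prime_iff_eq hl hp₁] at h; omega
    · rw [Nat.prime_dvd_prime_iff_eq hl hp₂] at h; omega
  have main' : ∀ l M s r : ℕ, l.Prime → 3 < l → l < 3 ^ e → 9 ^ M % l = 1 → e % M = s →
      (r ^ 2 + 4 * 9 ^ s) % l = 1 → False := by
    intro l M s r hl hl3 hle hM hs hr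
    apply main l hl hl3 hle r
    have h1 : (9 : ℤ) ^ e ≡ 9 ^ s [ZMOD l] := by
      have h4 : (9 : ℤ) ^ M ≡ 1 [ZMOD l] := by
        have : 9 ^ M ≡ 1 [MOD l] := by
          rw [Nat.ModEq, hM, Nat.mod_eq_of_lt (by omega)]
        exact_mod_cast (Int.natCast_modEq_iff.2 this)
      have h5 : (9 : ℤ) ^ e = (9 ^ M) ^ (e / M) * 9 ^ s := by
        rw [← pow_mul, ← pow_add, ← hs, Nat.div_add_mod]
      rw [h5]
      simpa using (h4.pow (e / M)).mul_right (9 ^ s)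
    have h6 : (r : ℤ) ^ 2 + 4 * 9 ^ s ≡ 1 [ZMOD l] := by
      have : r ^ 2 + 4 * 9 ^ s ≡ 1 [MOD l] := by
        rw [Nat.ModEq, hr, Nat.mod_eq_of_lt (by omega)]
      exact_mod_cast (Int.natCast_modEq_iff.2 this)
    have h7 : ((p₁ * p₂ : ℕ) : ℤ) = 4 * 9 ^ e - 1 := by
      zify at hde; push_cast; linarith
    rw [h7]
    have h8 : (r : ℤ) ^ 2 + (4 * 9 ^ e - 1) ≡ r ^ 2 + (4 * 9 ^ s - 1) [ZMOD l] :=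
      ((h1.mul_left 4).sub_right 1).add_left _
    have h9 : (r : ℤ) ^ 2 + (4 * 9 ^ s - 1) ≡ 0 [ZMOD l] := by
      have := h6.sub_right 1
      simpa [add_sub_assoc] using this
    exact Int.modEq_zero_iff_dvd.1 (h8.trans h9)
  have c5_1 : e % 2 ≠ 1 := fun h => main' 5 2 1 0 (by norm_num) (by norm_num) (by omega) (by norm_num) h (by norm_num)
  have c7_0 : e % 3 ≠ 0 := fun h => main' 7 3 0 2 (by norm_num) (by norm_num) (by omega) (by norm_num) h (by norm_num)
  have c7_1 : e % 3 ≠ 1 := fun h => main' 7 3 1 0 (by norm_num) (by norm_num) (by omega) (by norm_num) h (by norm_num)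
  have c11_1 : e % 5 ≠ 1 := fun h => main' 11 5 1 3 (by norm_num) (by norm_num) (by omega) (by norm_num) h (by norm_num)
  have c11_3 : e % 5 ≠ 3 := fun h => main' 11 5 3 0 (by norm_num) (by norm_num) (by omega) (by norm_num) h (by norm_num)
  have c11_4 : e % 5 ≠ 4 := fun h => main' 11 5 4 5 (by norm_num) (by norm_num) (by omega) (by norm_num) h (by norm_num)
  have c17_1 : e % 8 ≠ 1 := fun h => main' 17 8 1 4 (by norm_num) (by norm_num) (by omega) (by norm_num) h (by norm_num)
  have c17_2 : e % 8 ≠ 2 := fun h => main' 17 8 2 0 (by norm_num) (by norm_num) (by omega) (by norm_num) h (by norm_num)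
  have c17_3 : e % 8 ≠ 3 := fun h => main' 17 8 3 3 (by norm_num) (by norm_num) (by omega) (by norm_num) h (by norm_num)
  have c17_6 : e % 8 ≠ 6 := fun h => main' 17 8 6 6 (by norm_num) (by norm_num) (by omega) (by norm_num) h (by norm_num)
  have h31 : 31 < 3 ^ e := by
    have he4 : 4 ≤ e := by omega
    calc 31 < 3 ^ 4 := by norm_num
      _ ≤ 3 ^ e := Nat.pow_le_pow_right (by norm_num) he4
  have c31_2 : e % 15 ≠ 2 := fun h => main' 31 15 2 7 (by norm_num) (by norm_num) (by omega) (by norm_num) h (by norm_num)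
  have c31_5 : e % 15 ≠ 5 := fun h => main' 31 15 5 5 (by norm_num) (by norm_num) (by omega) (by norm_num) h (by norm_num)
  omega

end NF


lemma srg_of_two_values {F : Type*} [Field F] [Fintype F] {A : Type*} [CommRing A] [IsDomain A]
    [CharZero A] (ψ : AddChar F A) (hψ : ψ.IsPrimitive) (D : Set F) (h0 : (0 : F) ∉ D) (hneg : -D = D)
    (s t : A) (hst : ∀ a : F, a ≠ 0 → ∑ x ∈ D.toFinset, ψ (a * x) = s ∨ ∑ x ∈ D.toFinset, ψ (a * x) = t) :
    ∃ k lam mu : ℕ, (cayley D).IsSRGWith (Fintype.card F) k lam mu := by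
  have hadj : ∀ v w, (cayley D).Adj v w ↔ v - w ∈ D := by
    intro v w
    rw [cayley, SimpleGraph.fromRel_adj]
    constructor
    · rintro ⟨_, h | h⟩
      · exact h
      · rw [← hneg, Set.mem_neg]; simpa using h
    · intro h
      refine ⟨?_, Or.inl h⟩
      rintro rfl
      exact h0 (by simpa using h)
  have hsymm : ∀ x, x ∈ D → -x ∈ D := by
    intro x hx
    rw [← hneg, Set.mem_neg]; simpa using hx
  set DF := D.toFinset with hDF
  let cc : F → ℕ := fun g => ((DF ×ˢ DF).filter (fun z => z.1 + z.2 = g)).card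
  let S : F → A := fun a => ∑ x ∈ DF, ψ (a * x)
  set q : A := (Fintype.card F : A) with hq
  have hq0 : q ≠ 0 := by simp [hq, Fintype.card_ne_zero]
  have horth : ∀ x : F, ∑ a, ψ (a * x) = if x = 0 then q else 0 := by
    intro x
    rw [AddChar.sum_mulShift x hψ]
    split_ifs <;> simp [hq]
  have e1 : ∀ g, q * cc g = ∑ a, S a ^ 2 * ψ (a * (-g)) := by
    intro g
    have : ∀ a, S a ^ 2 * ψ (a * (-g)) = ∑ z ∈ DF ×ˢ DF, ψ (a * (z.1 + z.2 - g)) := by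
      intro a
      rw [sq, Finset.sum_mul_sum, ← Finset.sum_product', Finset.sum_mul]
      apply Finset.sum_congr rfl
      rintro ⟨x, y⟩ -
      rw [← AddChar.map_add_eq_mul, ← AddChar.map_add_eq_mul]
      congr 1; ring
    simp_rw [this]
    rw [Finset.sum_comm]
    simp_rw [horth, sub_eq_zero]
    rw [← Finset.sum_filter, Finset.sum_const, nsmul_eq_mul, mul_comm]
  have e2 : ∀ a, a ≠ 0 → S a ^ 2 = (s + t) * S a - s * t := by
    intro a ha
    rcases hst a ha with h | h
    · have : S a = s := h
      rw [this]; ring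
    · have : S a = t := h
      rw [this]; ring
  have e3 : ∀ g, ∑ a, S a * ψ (a * (-g)) = if g ∈ D then q else 0 := by
    intro g
    have : ∀ a, S a * ψ (a * (-g)) = ∑ z ∈ DF, ψ (a * (z - g)) := by
      intro a
      rw [Finset.sum_mul]
      apply Finset.sum_congr rfl
      rintro x -
      rw [← AddChar.map_add_eq_mul]
      congr 1; ring
    simp_rw [this]
    rw [Finset.sum_comm]
    simp_rw [horth, sub_eq_zero]
    rw [Finset.sum_ite_eq']
    simp [hDF]
  set Cst : A := S 0 ^ 2 - ((s + t) * S 0 - s * t)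
  have e4 : ∀ g, g ≠ 0 → q * cc g = Cst + (s + t) * (if g ∈ D then q else 0) := by
    intro g hg
    rw [e1, ← e3 g, Finset.mul_sum]
    have h5 : ∑ a : F, s * t * ψ (a * (-g)) = 0 := by
      rw [← Finset.mul_sum, horth, if_neg (by simpa using hg), mul_zero]
    have h6 : ∑ a : F, (if a = 0 then Cst else 0) = Cst := by simp
    rw [← sub_zero (Cst + _), ← h5]
    conv_rhs => rw [← h6]
    rw [← Finset.sum_add_distrib, ← Finset.sum_sub_distrib]
    apply Finset.sum_congr rfl
    intro a _
    by_cases ha : a = 0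
    · subst ha
      simp [Cst]; ring
    · rw [e2 a ha, if_neg ha]; ring
  have e5 : ∀ g g', g ≠ 0 → g' ≠ 0 → (g ∈ D ↔ g' ∈ D) → cc g = cc g' := by
    intro g g' hg hg' h
    have h1 := e4 g hg
    have h2 := e4 g' hg'
    simp only [h] at h1
    rw [← h2] at h1
    exact_mod_cast mul_left_cancel₀ hq0 h1
  have e6 : ∀ v w, Fintype.card ((cayley D).commonNeighbors v w) = cc (v - w) := by
    intro v w
    rw [← Set.toFinset_card]
    apply Finset.card_bij' (fun z _ => (v - z, z - w)) (fun z _ => v - z.1)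
    · intro z hz
      simp only [Set.mem_toFinset, SimpleGraph.mem_commonNeighbors, hadj] at hz
      simp only [Finset.mem_filter, Finset.mem_product, hDF, Set.mem_toFinset]
      refine ⟨⟨hz.1, ?_⟩, by ring⟩
      have := hsymm _ hz.2
      simpa using this
    · rintro ⟨x, y⟩ hz
      simp only [Finset.mem_filter, Finset.mem_product, hDF, Set.mem_toFinset] at hz
      simp only [Set.mem_toFinset, SimpleGraph.mem_commonNeighbors, hadj]
      refine ⟨by simpa using hz.1.1, ?_⟩
      have h1 := hsymm _ hz.1.2
      have : w - (v - x) = - y := by linear_combination hz.2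
      rw [this]; exact h1
    · intro z hz; simp
    · rintro ⟨x, y⟩ hz
      simp only [Finset.mem_filter] at hz
      simp only [Prod.mk.injEq]
      exact ⟨by ring, by linear_combination -hz.2⟩
  refine ⟨DF.card, if h : ∃ g, g ≠ 0 ∧ g ∈ D then cc h.choose else 0,
    if h : ∃ g, g ≠ 0 ∧ g ∉ D then cc h.choose else 0, rfl, ?_, ?_, ?_⟩
  · intro v
    rw [← SimpleGraph.card_neighborFinset_eq_degree]
    apply Finset.card_bij' (fun z _ => v - z) (fun z _ => v - z)
    · intro z hz
      simpa [hDF, hadj] using hz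
    · intro z hz
      simpa [hDF, hadj] using hz
    · intro z _; simp
    · intro z _; simp
  · intro v w h
    have hh := h.ne
    rw [hadj] at h
    have hex : ∃ g, g ≠ 0 ∧ g ∈ D := ⟨v - w, sub_ne_zero.2 hh, h⟩
    rw [dif_pos hex, e6]
    exact e5 _ _ (sub_ne_zero.2 hh) hex.choose_spec.1 (by simp [h, hex.choose_spec.2])
  · intro v w hh h
    rw [hadj] at h
    have hex : ∃ g, g ≠ 0 ∧ g ∉ D := ⟨v - w, sub_ne_zero.2 hh, h⟩
    rw [dif_pos hex, e6]
    exact e5 _ _ (sub_ne_zero.2 hh) hex.choose_spec.1 (by simp [h, hex.choose_spec.2])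


theorem exists_psi (p f : ℕ) [Fact p.Prime] (F : Type*) [Field F] [Fintype F] [CharP F p]
    (hcard : Fintype.card F = p ^ f) {A : Type*} [CommRing A] [IsDomain A] (ζ : A)
    (hζ : IsPrimitiveRoot ζ p) :
    ∃ (tr : F →+ ZMod p) (ψ : AddChar F A), ψ.IsPrimitive ∧ (∀ x, ψ x = ζ ^ (tr x).val) ∧
      (∀ x, tr (x ^ p) = tr x) ∧
      (∀ x, (((tr x).val : ℕ) : F) = ∑ i ∈ Finset.range f, x ^ (p ^ i)) := by
  let _ : Algebra (ZMod p) F := ZMod.algebra F p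
  have hfin : Module.finrank (ZMod p) F = f := by
    have h1 := Module.card_eq_pow_finrank (K := ZMod p) (V := F)
    rw [ZMod.card, hcard] at h1
    exact (Nat.pow_right_injective (Fact.out : p.Prime).two_le h1).symm
  have hform : ∀ x : F, (((Algebra.trace (ZMod p) F x).val : ℕ) : F)
      = ∑ i ∈ Finset.range f, x ^ (p ^ i) := by
    intro x
    have := FiniteField.algebraMap_trace_eq_sum_pow (ZMod p) F x
    rw [hfin, Nat.card_zmod] at this
    rw [← this]
    conv_rhs => rw [← ZMod.natCast_zmod_val (Algebra.trace (ZMod p) F x)]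
    rw [map_natCast]
  refine ⟨(Algebra.trace (ZMod p) F).toAddMonoidHom,
    (AddChar.zmodChar p hζ.pow_eq_one).compAddMonoidHom (Algebra.trace (ZMod p) F).toAddMonoidHom,
    ?_, ?_, ?_, hform⟩
  · apply AddChar.IsPrimitive.of_ne_one
    intro h
    obtain ⟨x, hx⟩ := Algebra.trace_surjective (ZMod p) F 1
    have h2 := DFunLike.congr_fun h x
    have h3 : AddChar.zmodChar p hζ.pow_eq_one (Algebra.trace (ZMod p) F x) = 1 := h2
    rw [hx] at h3
    have := (AddChar.zmodChar_primitive_of_primitive_root p hζ).zmod_char_eq_one_iff p 1 |>.1 h3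
    exact one_ne_zero this
  · intro x; rfl
  · intro x
    have h := Algebra.trace_eq_of_algEquiv (FiniteField.frobeniusAlgEquivOfAlgebraic (ZMod p) F) x
    rw [FiniteField.coe_frobeniusAlgEquivOfAlgebraic, ZMod.card] at h
    exact h

/-- `ω` composed with inversion as a multiplicative character. -/
noncomputable def invChar {F A : Type*} [Field F] [CommRing A] (ω : F →* A) (h0 : ω 0 = 0) :
    MulChar F A where
  toFun x := ω x⁻¹
  map_one' := by simp
  map_mul' x y := by simp [mul_comm]
  map_nonunit' a ha := by
    have : a = 0 := by simpa using ha
    simp [this, h0]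

theorem invChar_apply {F A : Type*} [Field F] [CommRing A] (ω : F →* A) (h0 : ω 0 = 0) (x : F) :
    invChar ω h0 x = ω x⁻¹ := rfl

theorem gauss_frob (p : ℕ) [Fact p.Prime] {F : Type*} [Field F] [Fintype F] [CharP F p]
    {A : Type*} [CommRing A] (χ : MulChar F A) (ψ : AddChar F A) (hψ : ∀ x, ψ (x ^ p) = ψ x) :
    gaussSum (χ ^ p) ψ = gaussSum χ ψ := by
  unfold gaussSum
  have hp := (Fact.out : p.Prime).ne_zero
  refine Fintype.sum_bijective (fun x : F => x ^ p) (bijective_frobenius F p) _ _ ?_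
  intro x
  rw [MulChar.pow_apply' _ hp, map_pow, hψ]

/-- `G(c)` divides `g₁^n`. -/
theorem gauss_step_add {F : Type*} [Field F] [Fintype F] {A : Type*} [CommRing A] [IsDomain A]
    (χ : MulChar F A) (ψ : AddChar F A) (c n : ℕ)
    (hc : χ ^ (c + 1) ≠ 1) (h : ∃ J, gaussSum χ ψ ^ n = J * gaussSum (χ ^ c) ψ) :
    ∃ J, gaussSum χ ψ ^ (n + 1) = J * gaussSum (χ ^ (c + 1)) ψ := by
  obtain ⟨J, hJ⟩ := h
  have h1 := jacobiSum_mul_nontrivial (χ := χ ^ c) (φ := χ) (by rwa [← pow_succ]) ψ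
  refine ⟨J * jacobiSum (χ ^ c) χ, ?_⟩
  rw [pow_succ, hJ, mul_assoc, ← h1, pow_succ]
  ring

theorem gauss_step_adds {F : Type*} [Field F] [Fintype F] {A : Type*} [CommRing A] [IsDomain A]
    (χ : MulChar F A) (ψ : AddChar F A) (c n Q d : ℕ) (hQ : ∀ i, 0 < i → i < Q → χ ^ i ≠ 1)
    (hc : c + d < Q) (h : ∃ J, gaussSum χ ψ ^ n = J * gaussSum (χ ^ c) ψ) :
    ∃ J, gaussSum χ ψ ^ (n + d) = J * gaussSum (χ ^ (c + d)) ψ := by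
  induction d with
  | zero => exact h
  | succ d ih =>
    have := gauss_step_add χ ψ (c + d) (n + d) (hQ _ (by omega) (by omega)) (ih (by omega))
    simpa [add_assoc] using this

theorem stick_div (p f : ℕ) [Fact p.Prime] {F : Type*} [Field F] [Fintype F] [CharP F p]
    {A : Type*} [CommRing A] [IsDomain A] (χ : MulChar F A) (ψ : AddChar F A)
    (hψ1 : ψ ≠ 1)
    (hψ : ∀ x, ψ (x ^ p) = ψ x) (hQ : ∀ i, 0 < i → i < p ^ f - 1 → χ ^ i ≠ 1)
    (N M t : ℕ) (hN : 0 < N) (hM : 0 < M) (hNM : N * M = p ^ f - 1) (htN : t < N) (S : ℕ)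
    (hS : ∑ j ∈ Finset.range f, (p ^ j * t % N) = N * S) :
    ∃ J, gaussSum χ ψ ^ ((p - 1) * S) = J * gaussSum (χ ^ (M * t)) ψ := by
  have hp := (Fact.out : p.Prime)
  have hrec : ∀ j, p ^ (j+1) * t / N = p * (p ^ j * t / N) + p * (p ^ j * t % N) / N := by
    intro j
    have h1 : p ^ (j+1) * t = p * (p ^ j * t % N) + N * (p * (p ^ j * t / N)) := by
      have := Nat.div_add_mod (p ^ j * t) N
      calc p ^ (j+1) * t = p * (p ^ j * t) := by ring
        _ = p * (N * (p ^ j * t / N) + p ^ j * t % N) := by rw [this]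
        _ = _ := by ring
    rw [h1, Nat.add_mul_div_left _ _ hN]; ring
  have hbf : p ^ f * t / N = M * t := by
    have h1 : p ^ f = N * M + 1 := by have := Nat.pow_pos (n := f) hp.pos; omega
    rw [h1, show (N * M + 1) * t = t + N * (M * t) by ring, Nat.add_mul_div_left _ _ hN,
      Nat.div_eq_of_lt htN, zero_add]
  have hlt : ∀ j, j ≤ f → p ^ j * t / N < p ^ f - 1 := by
    intro j hj
    calc p ^ j * t / N ≤ p ^ f * t / N := 
          Nat.div_le_div_right (Nat.mul_le_mul_right _ (Nat.pow_le_pow_right hp.pos hj))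
      _ = M * t := hbf
      _ < M * N := Nat.mul_lt_mul_of_pos_left htN hM
      _ = p ^ f - 1 := by rw [← hNM, mul_comm]
  have key : ∀ j, j ≤ f → ∃ J, gaussSum χ ψ ^ (∑ i ∈ Finset.range j, p * (p ^ i * t % N) / N)
      = J * gaussSum (χ ^ (p ^ j * t / N)) ψ := by
    intro j
    induction j with
    | zero =>
      intro _
      refine ⟨-1, ?_⟩
      rw [pow_zero, one_mul, Nat.div_eq_of_lt htN, pow_zero, gaussSum_one_left hψ1]
      simp
    | succ j ih =>
      intro hj
      obtain ⟨J, hJ⟩ := ih (by omega)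
      rw [Finset.sum_range_succ, hrec]
      apply gauss_step_adds χ ψ _ _ (p ^ f - 1) _ hQ
      · rw [← hrec]; exact hlt _ hj
      · refine ⟨J, ?_⟩
        rw [hJ, mul_comm p, pow_mul, gauss_frob p _ ψ hψ]
  have hsum : N * (∑ i ∈ Finset.range f, p * (p ^ i * t % N) / N) = N * ((p - 1) * S) := by
    have h1 : ∀ j, N * (p * (p ^ j * t % N) / N) + p ^ (j + 1) * t % N = p * (p ^ j * t % N) := by
      intro j
      have := Nat.div_add_mod (p * (p ^ j * t % N)) N
      have h3 : p * (p ^ j * t % N) % N = p ^ (j+1) * t % N := by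
        rw [Nat.mul_mod_mod]; congr 1; ring
      rw [h3] at this; exact this
    have h2 : ∑ j ∈ Finset.range f, (p ^ (j+1) * t % N) = ∑ j ∈ Finset.range f, (p ^ j * t % N) := by
      have e1 := Finset.sum_range_succ (fun j => p ^ j * t % N) f
      have e2 := Finset.sum_range_succ' (fun j => p ^ j * t % N) f
      have h1 : p ^ f = N * M + 1 := by have := Nat.pow_pos (n := f) hp.pos; omega
      have e3 : p ^ f * t % N = p ^ 0 * t % N := by
        rw [h1, show (N * M + 1) * t = t + N * (M * t) by ring, Nat.add_mul_mod_self_left]; simp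
      omega
    have h3 := Finset.sum_congr (rfl : Finset.range f = Finset.range f) (fun j _ => h1 j)
    rw [Finset.sum_add_distrib, ← Finset.mul_sum, ← Finset.mul_sum, h2, hS] at h3
    obtain ⟨p', rfl⟩ : ∃ p', p = p' + 1 := ⟨p - 1, by have := hp.pos; omega⟩
    rw [Nat.add_sub_cancel]
    have : (p' + 1) * (N * S) = N * (p' * S) + N * S := by ring
    omega
  have := key f le_rfl
  rw [Nat.eq_of_mul_eq_mul_left hN hsum, hbf] at this
  exact this

theorem first_gauss (p f : ℕ) [Fact p.Prime] {F : Type*} [Field F] [Fintype F] [CharP F p]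
    (hcard : Fintype.card F = p ^ f) (hf : 0 < f)
    {A k : Type*} [CommRing A] [IsDomain A] [CommRing k] [IsDomain k]
    (red : A →+* k) (ι : F →+* k) (ω : F →* A) (ζ : A) (h0 : ω 0 = 0)
    (hred : ∀ x, red (ω x) = ι x) (hζ1 : red ζ = 1) (tr : F → ZMod p) (ψ : AddChar F A)
    (hψ : ∀ x, ψ x = ζ ^ (tr x).val)
    (htr : ∀ x, (((tr x).val : ℕ) : F) = ∑ i ∈ Finset.range f, x ^ (p ^ i))
    (hχ : invChar ω h0 ≠ 1) :
    ∃ w, gaussSum (invChar ω h0) ψ = (ζ - 1) * w ∧ red w = -1 := by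
  have hp := (Fact.out : p.Prime)
  refine ⟨∑ x, invChar ω h0 x * ∑ i ∈ Finset.range (tr x).val, ζ ^ i, ?_, ?_⟩
  · unfold gaussSum
    have h1 : ∑ x, invChar ω h0 x = 0 := MulChar.sum_eq_zero_of_ne_one hχ
    rw [← sub_zero (∑ a, (invChar ω h0) a * ψ a), ← h1, ← Finset.sum_sub_distrib, Finset.mul_sum]
    refine Finset.sum_congr rfl fun x _ => ?_
    have := mul_geom_sum ζ (tr x).val
    rw [hψ]
    linear_combination (-(invChar ω h0) x) * this
  · rw [map_sum]
    have h1 : ∀ x, red (invChar ω h0 x * ∑ i ∈ Finset.range (tr x).val, ζ ^ i) =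
        ι (x⁻¹ * ∑ i ∈ Finset.range f, x ^ (p ^ i)) := by
      intro x
      rw [map_mul, map_mul, invChar_apply, hred, ← htr, map_sum, map_natCast]
      simp [hζ1]
    rw [Finset.sum_congr rfl fun x _ => h1 x, ← map_sum]
    have h2 : ∑ x : F, x⁻¹ * ∑ i ∈ Finset.range f, x ^ (p ^ i) = -1 := by
      have h3 : ∀ x : F, x⁻¹ * ∑ i ∈ Finset.range f, x ^ (p ^ i)
          = if x = 0 then 0 else ∑ i ∈ Finset.range f, x ^ (p ^ i - 1) := by
        intro x
        split_ifs with h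
        · simp [h]
        · rw [Finset.mul_sum]
          refine Finset.sum_congr rfl fun i _ => ?_
          have : 0 < p ^ i := Nat.pow_pos hp.pos
          rw [inv_mul_eq_iff_eq_mul₀ h, ← pow_succ']
          congr 1; omega
      have h4 : ∑ x : F, x⁻¹ * ∑ i ∈ Finset.range f, x ^ (p ^ i)
          = ∑ u : Fˣ, ∑ i ∈ Finset.range f, (u : F) ^ (p ^ i - 1) := by
        rw [Finset.sum_congr rfl fun x _ => h3 x]
        have := (Fintype.sum_of_injective (fun u : Fˣ => (u : F)) Units.val_injective
          (fun u => ∑ i ∈ Finset.range f, (u : F) ^ (p ^ i - 1))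
          (fun x => if x = 0 then 0 else ∑ i ∈ Finset.range f, x ^ (p ^ i - 1)) ?_ ?_).symm
        · exact this
        · intro x hx
          rw [if_pos]
          by_contra h
          exact hx ⟨Units.mk0 x h, rfl⟩
        · intro u; simp
      rw [h4, Finset.sum_comm]
      rw [Finset.sum_congr rfl fun i _ => FiniteField.sum_pow_units F (p ^ i - 1)]
      rw [Finset.sum_eq_single 0]
      · simp
      · intro i hi hi0
        rw [if_neg]
        intro hd
        rw [hcard] at hd
        have h5 : 1 < p ^ i := Nat.one_lt_pow hi0 hp.one_lt
        have h6 : p ^ i < p ^ f := Nat.pow_lt_pow_right hp.one_lt (Finset.mem_range.1 hi)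
        have := Nat.le_of_dvd (by omega) hd
        omega
      · simp [hf.ne']
    rw [h2]; simp

theorem first_gauss_pow (p : ℕ) [Fact p.Prime] (hp23 : p = 2 ∨ p = 3)
    {A k : Type*} [CommRing A] [IsDomain A] [CommRing k] [IsDomain k]
    (red : A →+* k) (ζ g w : A) (hζ1 : red ζ = 1) (hζ : IsPrimitiveRoot ζ p)
    (hg : g = (ζ - 1) * w) (hw : red w = -1) :
    ∃ w', g ^ (p - 1) = p * w' ∧ red w' ≠ 0 := by
  rcases hp23 with rfl | rfl
  · have : ζ = -1 := hζ.eq_neg_one_of_two_right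
    refine ⟨-w, ?_, ?_⟩
    · rw [hg, this]; push_cast; ring
    · simp [hw]
  · have h1 : 1 + ζ + ζ ^ 2 = 0 := by
      have := hζ.geom_sum_eq_zero (by norm_num)
      simpa [Finset.sum_range_succ] using this
    refine ⟨-ζ * w ^ 2, ?_, ?_⟩
    · rw [hg]; push_cast
      linear_combination w^2 * h1
    · simp [hw, hζ1]

section periods
variable {G : Type*} [CommGroup G] [Fintype G]

/-- The set of `M`-th roots of unity in a finite group. -/
noncomputable def rootSet (G : Type*) [CommGroup G] [Fintype G] (M : ℕ) : Finset G :=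
  Finset.univ.filter (fun y : G => y ^ M = 1)

theorem mem_rootSet {M : ℕ} {y : G} : y ∈ rootSet G M ↔ y ^ M = 1 := by simp [rootSet]

theorem mem_root_iff (γ : G) (hγ : ∀ x : G, x ∈ Subgroup.zpowers γ) (N M : ℕ) (hM : 0 < M)
    (hNM : Fintype.card G = N * M) (j : ℤ) : (γ ^ j) ^ M = 1 ↔ (N : ℤ) ∣ j := by
  have ho : orderOf γ = N * M := by
    rw [← hNM, ← Nat.card_eq_fintype_card]; exact orderOf_eq_card_of_forall_mem_zpowers hγ
  rw [← zpow_natCast, ← zpow_mul, ← orderOf_dvd_iff_zpow_eq_one, ho]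
  push_cast
  exact mul_dvd_mul_iff_right (by exact_mod_cast hM.ne')

theorem sum_decomp (γ : G) (hγ : ∀ x : G, x ∈ Subgroup.zpowers γ) (N M : ℕ) (hN : 0 < N)
    (hM : 0 < M)
    (hNM : Fintype.card G = N * M) {A : Type*} [AddCommMonoid A] (g : G → A) :
    ∑ u, g u = ∑ a ∈ Finset.range N, ∑ y ∈ rootSet G M,
      g (γ ^ (a : ℤ) * y) := by
  rw [Finset.sum_sigma']
  symm
  refine Finset.sum_nbij (fun z => γ ^ (z.1 : ℤ) * z.2) (fun _ _ => Finset.mem_univ _) ?_ ?_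
    (fun _ _ => rfl)
  · rintro ⟨a, y⟩ h1 ⟨a', y'⟩ h2 h
    simp only [Finset.coe_sigma, Set.mem_sigma_iff, Finset.coe_range, Set.mem_Iio,
      Finset.mem_coe, mem_rootSet] at h1 h2
    simp only at h
    have h3 : (γ ^ ((a : ℤ) - a')) ^ M = 1 := by
      have : γ ^ ((a : ℤ) - a') = y' * y⁻¹ := by
        rw [zpow_sub, ← div_eq_mul_inv, ← div_eq_mul_inv, div_eq_div_iff_mul_eq_mul, h, mul_comm]
      rw [this, mul_pow, inv_pow, h1.2, h2.2]; simp
    rw [mem_root_iff γ hγ N M hM hNM] at h3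
    have h4 : a = a' := by
      have h5 := Int.eq_zero_of_abs_lt_dvd h3 (by rw [abs_lt]; omega)
      omega
    subst h4
    simp at h
    simp [h]
  · intro u _
    obtain ⟨j, hj⟩ := hγ u
    have hN' : (0 : ℤ) < N := by exact_mod_cast hN
    have e1 := Int.emod_nonneg j hN'.ne'
    have e2 := Int.emod_lt_of_pos j hN'
    refine ⟨⟨(j % N).toNat, γ ^ (N * (j / N))⟩, ?_, ?_⟩
    · simp only [Finset.coe_sigma, Set.mem_sigma_iff, Finset.coe_range, Set.mem_Iio,
        Finset.mem_coe, mem_rootSet]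
      refine ⟨by omega, ?_⟩
      rw [mem_root_iff γ hγ N M hM hNM]
      exact dvd_mul_right _ _
    · simp only
      rw [← zpow_add, ← hj, Int.toNat_of_nonneg e1]
      simp only
      rw [Int.emod_add_mul_ediv]

theorem sum_root_mul (M : ℕ) {A : Type*} [AddCommMonoid A] (g : G → A) (z : G) (hz : z ^ M = 1) :
    ∑ y ∈ rootSet G M, g (z * y)
      = ∑ y ∈ rootSet G M, g y := by
  refine Finset.sum_nbij (fun y => z * y) ?_ ?_ ?_ (fun _ _ => rfl)
  · intro y hy
    rw [mem_rootSet] at hy ⊢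
    rw [mul_pow, hz, hy, one_mul]
  · intro y _ y' _ h
    exact mul_left_cancel h
  · intro y hy
    simp only [Finset.mem_coe, mem_rootSet] at hy
    refine ⟨z⁻¹ * y, ?_, by simp⟩
    simp [mem_rootSet, mul_pow, hz, hy]

theorem sum_root_pow (M p : ℕ) {A : Type*} [AddCommMonoid A] (g : G → A)
    (hp : Function.Injective (fun y : G => y ^ p)) :
    ∑ y ∈ rootSet G M, g (y ^ p)
      = ∑ y ∈ rootSet G M, g y := by
  have hs := Finite.injective_iff_surjective.1 hp
  refine Finset.sum_nbij (fun y => y ^ p) ?_ ?_ ?_ (fun _ _ => rfl)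
  · intro y hy
    rw [mem_rootSet] at hy ⊢
    rw [← pow_mul, mul_comm, pow_mul, hy, one_pow]
  · intro y _ y' _ h
    exact hp h
  · intro y hy
    simp only [Finset.mem_coe, mem_rootSet] at hy
    obtain ⟨x, hx⟩ := hs y
    refine ⟨x, ?_, hx⟩
    simp only [Finset.mem_coe, mem_rootSet]
    apply hp
    simp only at hx ⊢
    rw [← pow_mul, mul_comm, pow_mul, hx, hy, one_pow]
end periods

/-- Auxiliary integer function. -/
def phi3 (c : ZMod 3) : ℤ := if c.val = 0 then 1 else if c.val = 1 then -1 else 0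

theorem odd_three {A : Type*} [CommRing A] (ζ : A) (h1 : 1 + ζ + ζ ^ 2 = 0) (c : ZMod 3) :
    (ζ ^ (-c).val - (phi3 (-c) : A)) = -(ζ ^ c.val - (phi3 c : A)) := by
  have e1 : (-2 : ZMod 3).val = 1 := by decide
  have e2 : (-1 : ZMod 3).val = 2 := by decide
  have e3 : (2 : ZMod 3).val = 2 := rfl
  have e4 : (1 : ZMod 3).val = 1 := rfl
  have hc : c = 0 ∨ c = 1 ∨ c = 2 := by revert c; decide
  rcases hc with rfl | rfl | rfl
  · simp [phi3]
  · simp only [phi3, e2, e4]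
    norm_num
    linear_combination h1
  · simp only [phi3, e1, e3]
    norm_num
    linear_combination h1

theorem period_int (p : ℕ) [Fact p.Prime] (hp23 : p = 2 ∨ p = 3) {F : Type*} [Field F] [Fintype F]
    [CharP F p] (M : ℕ) (hM : p = 3 → Even M)
    {A : Type*} [CommRing A] [IsDomain A] [CharZero A] (ζ : A) (hζ : IsPrimitiveRoot ζ p)
    (tr : F →+ ZMod p) (ψ : AddChar F A)
    (hψ : ∀ x, ψ x = ζ ^ (tr x).val) (u : Fˣ) :
    ∃ z : ℤ, ∑ y ∈ rootSet Fˣ M, ψ ((u * y : Fˣ) : F) = (z : A) := by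
  rcases hp23 with rfl | rfl
  · have : ζ = -1 := hζ.eq_neg_one_of_two_right
    refine ⟨∑ y ∈ rootSet Fˣ M, (-1) ^ (tr ((u * y : Fˣ) : F)).val, ?_⟩
    push_cast
    simp only [hψ, this]
  · have h1 : 1 + ζ + ζ ^ 2 = 0 := by
      have := hζ.geom_sum_eq_zero (by norm_num)
      simpa [Finset.sum_range_succ] using this
    have hodd := odd_three ζ h1
    refine ⟨∑ y ∈ rootSet Fˣ M, phi3 (tr ((u * y : Fˣ) : F)), ?_⟩
    push_cast
    rw [← sub_eq_zero, ← Finset.sum_sub_distrib]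
    set S := ∑ y ∈ rootSet Fˣ M,
      (ψ ((u * y : Fˣ) : F) - (phi3 (tr ((u * y : Fˣ) : F)) : A)) with hS
    have h2 := sum_root_mul M (fun y : Fˣ => ψ ((u * y : Fˣ) : F) - (phi3 (tr ((u * y : Fˣ) : F)) : A))
      (-1) (by rw [(hM rfl).neg_one_pow])
    have h3 : S = -S := by
      conv_lhs => rw [hS, ← h2]
      rw [hS, ← Finset.sum_neg_distrib]
      refine Finset.sum_congr rfl fun y _ => ?_
      rw [hψ, hψ]
      have : ((u * (-1 * y) : Fˣ) : F) = - ((u * y : Fˣ) : F) := by simp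
      rw [this, map_neg]
      exact hodd _
    exact self_eq_neg.1 h3
theorem wittCharZero (p : ℕ) [Fact p.Prime] (F : Type*) [Field F] [CharP F p] :
    CharZero (WittVector p F) := by
  obtain ⟨l, hl⟩ := CharP.exists (WittVector p F)
  rcases CharP.char_is_prime_or_zero (WittVector p F) l with h | h
  · exfalso
    have h0 : ((l : ℕ) : WittVector p F) = 0 := CharP.cast_eq_zero _ _
    have h1 : ((l : ℕ) : F) = 0 := by
      have := congrArg (WittVector.constantCoeff (p := p) (R := F)) h0
      rwa [map_natCast, map_zero] at this
    rw [CharP.cast_eq_zero_iff F p] at h1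
    have : p = l := (Nat.prime_dvd_prime_iff_eq (Fact.out) h).1 h1
    subst this
    exact WittVector.p_nonzero p F h0
  · subst h
    exact CharP.charP_to_charZero _

theorem ring_setup.{u} (p : ℕ) [Fact p.Prime] (F : Type u) [Field F] [CharP F p] :
    ∃ (A k : Type u) (_ : CommRing A) (_ : IsDomain A) (_ : CharZero A) (_ : CommRing k)
      (_ : IsDomain k) (red : A →+* k) (ι : F →+* k) (ω : F →* A) (ζ : A),
      ω 0 = 0 ∧ (∀ x, red (ω x) = ι x) ∧ IsPrimitiveRoot ζ p ∧ red ζ = 1 := by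
  have := wittCharZero p F
  let W := WittVector p F
  let L := AlgebraicClosure (FractionRing W)
  have : CharZero (FractionRing W) := 
    charZero_of_injective_algebraMap (IsFractionRing.injective W (FractionRing W))
  have : CharZero L := charZero_of_injective_algebraMap (algebraMap (FractionRing W) L).injective
  let A := integralClosure W L
  have hWL : Function.Injective (algebraMap W L) := by
    rw [IsScalarTower.algebraMap_eq W (FractionRing W) L]
    exact (algebraMap (FractionRing W) L).injective.comp (IsFractionRing.injective W (FractionRing W))
  have hWA : Function.Injective (algebraMap W A) := by
    intro x y h
    apply hWL
    have := congrArg (algebraMap A L) h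
    simpa [← IsScalarTower.algebraMap_apply] using this
  let P := RingHom.ker (WittVector.constantCoeff (p := p) (R := F))
  have : P.IsPrime := RingHom.ker_isPrime _
  have : Algebra.IsIntegral W A := inferInstance
  obtain ⟨Q, hQ, hQ1, hQ2⟩ := Ideal.exists_ideal_over_prime_of_isIntegral P (⊥ : Ideal A) (by
    intro x hx
    rw [Ideal.mem_comap, Ideal.mem_bot] at hx
    have : x = 0 := hWA (by rw [hx, map_zero])
    rw [this]; exact P.zero_mem)
  let red : A →+* A ⧸ Q := Ideal.Quotient.mk Q
  have hsurj := WittVector.constantCoeff_surjective (p := p) (R := F)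
  let ι : F →+* A ⧸ Q := RingHom.liftOfSurjective (WittVector.constantCoeff (p := p) (R := F)) hsurj
    ⟨red.comp (algebraMap W A), by
      intro x hx
      rw [RingHom.mem_ker, RingHom.comp_apply]
      apply Ideal.Quotient.eq_zero_iff_mem.2
      have : x ∈ Q.comap (algebraMap W A) := by rw [hQ2]; exact hx
      exact this⟩
  have hι : ∀ w : W, ι (WittVector.constantCoeff w) = red (algebraMap W A w) := by
    intro w
    exact RingHom.liftOfRightInverse_comp_apply _ _ _ _ _
  obtain ⟨ζ', hζ'⟩ := HasEnoughRootsOfUnity.exists_primitiveRoot L p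
  have hp0 : 0 < p := (Fact.out : p.Prime).pos
  have hInt : IsIntegral W ζ' := by
    refine ⟨Polynomial.X ^ p - 1, Polynomial.monic_X_pow_sub_C 1 hp0.ne', ?_⟩
    simp [hζ'.pow_eq_one]
  let ζ : A := ⟨ζ', hInt⟩
  have hζ : IsPrimitiveRoot ζ p := by
    apply IsPrimitiveRoot.of_map_of_injective (f := algebraMap A L) (h := ?_) (hf := ?_)
    · exact hζ'
    · exact Subtype.val_injective
  refine ⟨A, A ⧸ Q, inferInstance, inferInstance, ?_, inferInstance, inferInstance, red, ι,
    (algebraMap W A : W →* A).comp (WittVector.teichmuller p), ζ, ?_, ?_, hζ, ?_⟩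
  · exact charZero_of_injective_algebraMap hWA
  · rw [MonoidHom.comp_apply, WittVector.teichmuller_zero]
    exact map_zero (algebraMap W A)
  · intro x
    have := hι (WittVector.teichmuller p x)
    rw [MonoidHom.comp_apply]
    refine Eq.trans this.symm ?_
    congr 1
  · have hpk : (p : A ⧸ Q) = 0 := by
      have : ((p : ℕ) : F) = 0 := CharP.cast_eq_zero F p
      have := congrArg ι this
      rwa [map_natCast, map_zero] at this
    have : CharP (A ⧸ Q) p := by
      refine (CharP.charP_iff_prime_eq_zero Fact.out).2 hpk
    have h1 : red ζ ^ p = 1 := by rw [← map_pow, hζ.pow_eq_one, map_one]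
    have : (red ζ - 1) ^ p = 0 := by
      rw [sub_pow_char, h1, one_pow, sub_self]
    exact sub_eq_zero.1 (pow_eq_zero_iff hp0.ne' |>.1 this)

theorem gauss_data.{u} (p f : ℕ) [Fact p.Prime] (hp23 : p = 2 ∨ p = 3) (F : Type u) [Field F]
    [Fintype F] (hcard : Fintype.card F = p ^ f) (hf : 2 ≤ f) (γ : Fˣ)
    (hγ : ∀ x : Fˣ, x ∈ Subgroup.zpowers γ) (N M : ℕ) (hN1 : 1 < N) (hNodd : Odd N)
    (hNM : p ^ f - 1 = N * M) :
    ∃ (A k : Type u) (_ : CommRing A) (_ : IsDomain A) (_ : CharZero A) (_ : CommRing k)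
      (_ : IsDomain k) (_ : CharP k p) (red : A →+* k) (ψ : AddChar F A) (ξ w : A) (η : ℤ → ℤ),
      ψ.IsPrimitive ∧ IsPrimitiveRoot ξ N ∧ red w ≠ 0 ∧
      (∀ a : ℤ, ∑ y ∈ rootSet Fˣ M, ψ ((γ ^ a * y : Fˣ) : F) = (η a : A)) ∧
      (∀ a, η (a + N) = η a) ∧ (∀ a, η (p * a) = η a) ∧
      (∑ a ∈ Finset.range N, η (a : ℤ) = -1) ∧
      (∀ t t' : ℕ, ¬ N ∣ t → N ∣ t + t' →
        (∑ a ∈ Finset.range N, (η (a : ℤ) : A) * ξ ^ (t * a)) *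
        (∑ a ∈ Finset.range N, (η (a : ℤ) : A) * ξ ^ (t' * a)) = (p : A) ^ f) ∧
      (∀ t S : ℕ, 0 < t → t < N → ∑ j ∈ Finset.range f, (p ^ j * t % N) = N * S →
        ∃ J, (p : A) ^ S * w ^ S = J * ∑ a ∈ Finset.range N, (η (a : ℤ) : A) * ξ ^ (t * a)) := by
  have hp := (Fact.out : p.Prime)
  have hq1 : 1 < p ^ f - 1 := by
    have : 2 ^ 2 ≤ p ^ f := (Nat.pow_le_pow_left hp.two_le 2).trans (Nat.pow_le_pow_right hp.pos hf)
    omega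
  have hMpos : 0 < M := by
    rcases Nat.eq_zero_or_pos M with h | h
    · subst h; simp at hNM; omega
    · exact h
  have hchar : CharP F p := by
    have : ((p : ℕ) : F) = 0 := by
      have h1 : ((p ^ f : ℕ) : F) = 0 := by rw [← hcard]; exact FiniteField.cast_card_eq_zero F
      push_cast at h1
      exact eq_zero_of_pow_eq_zero h1
    exact (CharP.charP_iff_prime_eq_zero hp).2 this
  obtain ⟨A, k, _, _, _, _, _, red, ι, ω, ζ, h0, hred, hζ, hζ1⟩ := ring_setup p F
  have hkchar : CharP k p := by
    have : ((p : ℕ) : k) = 0 := by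
      rw [← map_natCast ι, CharP.cast_eq_zero, map_zero]
    exact (CharP.charP_iff_prime_eq_zero hp).2 this
  obtain ⟨tr, ψ, hψp, hψ, htrp, htr⟩ := exists_psi p f F hcard ζ hζ
  have hψfrob : ∀ x, ψ (x ^ p) = ψ x := fun x => by rw [hψ, hψ, htrp]
  have hψ1 : ψ ≠ 1 := by
    intro h
    apply hψp (one_ne_zero : (1 : F) ≠ 0)
    rw [AddChar.mulShift_one, h]
  have hcardU : Fintype.card Fˣ = N * M := by
    rw [Fintype.card_units, hcard, hNM]
  have hoγ : orderOf γ = N * M := by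
    rw [← hcardU, ← Nat.card_eq_fintype_card]; exact orderOf_eq_card_of_forall_mem_zpowers hγ
  set χ := invChar ω h0 with hχdef
  have hχred : ∀ x, red (χ x) = ι x⁻¹ := fun x => by rw [hχdef, invChar_apply, hred]
  have hχpow : ∀ i, (χ (γ : F)) ^ i = 1 ↔ N * M ∣ i := by
    intro i
    rw [← hoγ, orderOf_dvd_iff_pow_eq_one]
    constructor
    · intro h
      have h2 := congrArg red h
      rw [map_pow, hχred, map_one, ← map_pow] at h2
      have h3 := ι.injective (h2.trans (map_one ι).symm)
      rw [inv_pow, inv_eq_one] at h3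
      exact Units.ext (by simpa using h3)
    · intro h
      rw [← map_pow, ← Units.val_pow_eq_pow_val, h, Units.val_one, map_one]
  have hχne : ∀ i, ¬ (N * M ∣ i) → χ ^ i ≠ 1 := by
    intro i hi h
    apply hi
    rw [← hχpow, ← MulChar.pow_apply_coe, h, MulChar.one_apply_coe]
  have hQ : ∀ i, 0 < i → i < p ^ f - 1 → χ ^ i ≠ 1 := by
    intro i hi hi2
    apply hχne
    intro h
    have := Nat.le_of_dvd hi h
    omega
  have hχ1 : χ ≠ 1 := by
    have := hQ 1 one_pos hq1
    rwa [pow_one] at this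
  obtain ⟨w', hw'1, hw'2⟩ := first_gauss p f hcard (by omega) red ι ω ζ h0 hred hζ1 tr ψ hψ htr hχ1
  obtain ⟨w, hw1, hw2⟩ := first_gauss_pow p hp23 red ζ _ w' hζ1 hζ hw'1 hw'2
  have hM3 : p = 3 → Even M := by
    intro h3
    have h4 : Even (N * M) := by
      rw [← hNM]
      have : Odd (p ^ f) := by rw [h3]; exact Odd.pow (by decide)
      rcases this with ⟨c, hc⟩
      exact ⟨c, by omega⟩
    rcases Nat.even_mul.1 h4 with h5 | h5
    · exact absurd h5 (Nat.not_even_iff_odd.2 hNodd)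
    · exact h5
  have hInt := fun a : ℤ => period_int p hp23 (F := F) M hM3 ζ hζ tr ψ hψ (γ ^ a)
  choose η hη using hInt
  -- Gauss sums as Fourier transforms
  have hgs : ∀ t : ℕ, gaussSum (χ ^ (M * t)) ψ
      = ∑ a ∈ Finset.range N, (η (a : ℤ) : A) * (χ (γ : F) ^ M) ^ (t * a) := by
    intro t
    have h1 : gaussSum (χ ^ (M * t)) ψ = ∑ u : Fˣ, (χ ^ (M * t)) (u : F) * ψ u := by
      unfold gaussSum
      refine (Fintype.sum_of_injective (fun u : Fˣ => (u : F)) Units.val_injective _ _ ?_ ?_).symm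
      · intro x hx
        rw [MulChar.map_nonunit, zero_mul]
        rintro ⟨u, hu⟩
        exact hx ⟨u, hu⟩
      · intro u; rfl
    rw [h1, sum_decomp γ hγ N M (by omega) hMpos hcardU]
    refine Finset.sum_congr rfl fun a _ => ?_
    rw [← hη, Finset.sum_mul]
    refine Finset.sum_congr rfl fun y hy => ?_
    rw [mem_rootSet] at hy
    rw [mul_comm]
    congr 1
    rw [MulChar.pow_apply_coe, Units.val_mul, map_mul, mul_pow, zpow_natCast,
      Units.val_pow_eq_pow_val, map_pow]
    have h2 : χ (y : F) ^ M = 1 := by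
      rw [← map_pow, ← Units.val_pow_eq_pow_val, hy, Units.val_one, map_one]
    rw [pow_mul (χ (y : F)), h2, one_pow, mul_one, ← pow_mul, ← pow_mul]
    congr 1; ring
  have hξ : IsPrimitiveRoot (χ (γ : F) ^ M) N := by
    constructor
    · rw [← pow_mul, hχpow, mul_comm]
    · intro l hl
      rw [← pow_mul, hχpow, mul_comm M] at hl
      exact Nat.dvd_of_mul_dvd_mul_right hMpos hl
  have hprod : ∀ t t' : ℕ, ¬ N ∣ t → N ∣ t + t' →
      gaussSum (χ ^ (M * t)) ψ * gaussSum (χ ^ (M * t')) ψ = (p : A) ^ f := by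
    intro t t' ht htt
    have hne : χ ^ (M * t) ≠ 1 := by
      apply hχne
      intro h
      apply ht
      rw [mul_comm N] at h
      exact Nat.dvd_of_mul_dvd_mul_left hMpos h
    have hinv : χ ^ (M * t') = (χ ^ (M * t))⁻¹ := by
      rw [eq_inv_iff_mul_eq_one, ← pow_add]
      ext u
      rw [MulChar.pow_apply_coe, MulChar.one_apply_coe]
      obtain ⟨c, hc⟩ := htt
      have hu : u ^ (N * M) = 1 := by rw [← hcardU]; exact pow_card_eq_one
      rw [← map_pow, ← Units.val_pow_eq_pow_val,
        show M * t' + M * t = (N * M) * c by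
          calc M * t' + M * t = M * (t + t') := by ring
            _ = _ := by rw [hc]; ring]
      rw [pow_mul, hu, one_pow, Units.val_one, map_one]
    have hneg1 : (χ ^ (M * t)) (-1) = 1 := by
      have e1 : ((χ ^ (M * t)) (-1)) ^ 2 = 1 := by
        rw [← map_pow]; simp
      have e2 : ((χ ^ (M * t)) (-1)) ^ N = 1 := by
        have : (-1 : F) = ((-1 : Fˣ) : F) := by simp
        rw [this, MulChar.pow_apply_coe, ← map_pow, ← map_pow, ← Units.val_pow_eq_pow_val,
           ← Units.val_pow_eq_pow_val, ← pow_mul, show M * t * N = (N * M) * t by ring, pow_mul]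
        have hu : (-1 : Fˣ) ^ (N * M) = 1 := by rw [← hcardU]; exact pow_card_eq_one
        rw [hu, one_pow, Units.val_one, map_one]
      obtain ⟨c, hc⟩ := hNodd
      rw [hc, pow_succ, pow_mul, e1, one_pow, one_mul] at e2
      exact e2
    have h5 := gaussSum_mul_gaussSum_eq_card hne hψp
    have h6 := mul_gaussSum_inv_eq_gaussSum (χ ^ (M * t))⁻¹ ψ
    have h7 : (χ ^ (M * t))⁻¹ (-1) = 1 := by
      rw [MulChar.inv_apply_eq_inv, hneg1]; simp
    rw [h7, one_mul] at h6
    rw [hinv, ← h6, h5, hcard]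
    push_cast; rfl
  refine ⟨A, k, inferInstance, inferInstance, inferInstance, inferInstance, inferInstance,
    hkchar, red, ψ, χ (γ : F) ^ M, w, η, hψp, hξ, hw2, hη, ?_, ?_, ?_, ?_, ?_⟩
  · intro a
    have h1 : ((η (a + N) : ℤ) : A) = η a := by
      rw [← hη, ← hη]
      rw [← sum_root_mul M (fun y : Fˣ => ψ ((γ ^ a * y : Fˣ) : F)) (γ ^ (N : ℤ)) ?_]
      · refine Finset.sum_congr rfl fun y _ => ?_
        rw [zpow_add, mul_assoc]
      · rw [mem_root_iff γ hγ N M hMpos hcardU]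
    exact_mod_cast h1
  · intro a
    have h1 : ((η (p * a) : ℤ) : A) = η a := by
      rw [← hη, ← hη]
      rw [← sum_root_pow M p (fun y : Fˣ => ψ ((γ ^ (p * a) * y : Fˣ) : F)) ?_]
      · refine Finset.sum_congr rfl fun y _ => ?_
        rw [← hψfrob ((γ ^ a * y : Fˣ) : F)]
        congr 1
        rw [← Units.val_pow_eq_pow_val, mul_pow, ← zpow_natCast (γ ^ a) p, ← zpow_mul, mul_comm a]
      · intro y y' h
        simp only at h
        have h8 := congrArg (Units.val) h
        rw [Units.val_pow_eq_pow_val, Units.val_pow_eq_pow_val] at h8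
        exact Units.ext (frobenius_inj F p h8)
    exact_mod_cast h1
  · have h1 := hgs 0
    rw [mul_zero, pow_zero, gaussSum_one_left hψ1] at h1
    simp only [zero_mul, pow_zero, mul_one] at h1
    have h2 : ((∑ a ∈ Finset.range N, η (a : ℤ) : ℤ) : A) = ((-1 : ℤ) : A) := by
      push_cast; exact h1.symm
    exact_mod_cast h2
  · intro t t' ht htt
    rw [← hgs, ← hgs]
    exact hprod t t' ht htt
  · intro t S ht htN hS
    rw [← hgs]
    obtain ⟨J, hJ⟩ := stick_div p f χ ψ hψ1 hψfrob hQ N M t (by omega) hMpos hNM.symm htN S hS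
    refine ⟨J, ?_⟩
    rw [← hJ, pow_mul, hw1, mul_pow]


section reduction

theorem per_mul {B : Type*} (K : ℤ) (h : ℤ → B) (hh : ∀ x, h (x + K) = h x) (x k : ℤ) :
    h (x + K * k) = h x := by
  induction k using Int.induction_on with
  | zero => simp
  | succ i ih => rw [← ih, ← hh (x + K * i)]; congr 1; ring
  | pred i ih => rw [← ih, ← hh (x + K * (-i - 1))]; congr 1; ring

theorem per_congr {B : Type*} (K : ℤ) (h : ℤ → B) (hh : ∀ x, h (x + K) = h x) {x y : ℤ}
    (hxy : x ≡ y [ZMOD K]) : h x = h y := by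
  obtain ⟨k, hk⟩ := hxy.dvd
  rw [show y = x + K * k by linarith, per_mul K h hh]

theorem sum_reindex {B : Type*} [AddCommMonoid B] (K : ℕ) (hK : 0 < K) (h : ℤ → B)
    (hh : ∀ x, h (x + K) = h x) (u c : ℤ) (hu : IsCoprime u (K : ℤ)) :
    ∑ x ∈ Finset.range K, h (u * x + c) = ∑ x ∈ Finset.range K, h x := by
  have hK' : (0 : ℤ) < K := by exact_mod_cast hK
  have hinj : Set.InjOn (fun x : ℕ => ((u * x + c) % K).toNat) (Finset.range K) := by
    intro x hx y hy hxy
    simp only [Finset.coe_range, Set.mem_Iio] at hx hy hxy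
    have e1 := Int.emod_nonneg (u * x + c) hK'.ne'
    have e2 := Int.emod_nonneg (u * y + c) hK'.ne'
    have e3 : (u * x + c) % K = (u * y + c) % K := by omega
    have e4 : (K : ℤ) ∣ u * (x - y) := by
      have := Int.emod_emod_of_dvd
      have h5 := Int.ModEq.dvd (show u * y + c ≡ u * x + c [ZMOD K] from e3.symm)
      rwa [show u * x + c - (u * y + c) = u * (x - y) by ring] at h5
    have e5 : (K : ℤ) ∣ x - y := hu.symm.dvd_of_dvd_mul_left e4
    have := Int.eq_zero_of_abs_lt_dvd e5 (by rw [abs_lt]; omega)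
    omega
  have hmaps : ∀ x ∈ Finset.range K, ((u * x + c) % K).toNat ∈ Finset.range K := by
    intro x _
    have e1 := Int.emod_nonneg (u * x + c) hK'.ne'
    have e2 := Int.emod_lt_of_pos (u * x + c) hK'
    rw [Finset.mem_range]; omega
  refine Finset.sum_nbij (fun x : ℕ => ((u * x + c) % K).toNat) hmaps hinj ?_ ?_
  · exact Finset.surjOn_of_injOn_of_card_le _ hmaps hinj le_rfl
  · intro x _
    apply per_congr K h hh
    have e1 := Int.emod_nonneg (u * x + c) hK'.ne'
    rw [Int.toNat_of_nonneg e1]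
    exact (Int.mod_modEq _ _).symm

theorem sum_split {B : Type*} [AddCommMonoid B] (r K : ℕ) (g : ℤ → B) :
    ∑ a ∈ Finset.range (r * K), g a
      = ∑ i ∈ Finset.range r, ∑ x ∈ Finset.range K, g (r * x + i) := by
  rw [Finset.sum_comm]
  induction K with
  | zero => simp
  | succ K ih =>
    rw [Nat.mul_succ, Finset.sum_range_add, ih, Finset.sum_range_succ]
    congr 1

theorem red_step (l m M : ℕ) (hl : l.Prime) (η : ℤ → ℤ) 
    (hper : ∀ a, η (a + (l ^ (m-1) * (l * M) : ℕ)) = η a) 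
    (hmul : ∀ u a : ℤ, u ≡ 1 [ZMOD (l * M : ℕ)] → η (u * a) = η a)
    (a : ℤ) (ha : ¬ ((l ^ (m-1) : ℕ) : ℤ) ∣ a) :
    η (a + M * (l ^ (m-1) : ℕ)) = η a := by
  set r := l ^ (m-1) with hr
  have hgd : ((Int.gcd (l * a) (l * r : ℕ) : ℕ) : ℤ) ∣ r := by
    have h1 : Int.gcd (l * a) (l * r : ℕ) ∣ l ^ (m - 1 + 1) := by
      have := Int.gcd_dvd_right (l * a) (l * r : ℕ)
      rw [pow_succ', ← hr]
      exact_mod_cast this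
    obtain ⟨i, hi, hi2⟩ := (Nat.dvd_prime_pow hl).1 h1
    rw [hi2]
    have hi3 : i ≤ m - 1 := by
      by_contra hcon
      have : i = m - 1 + 1 := by omega
      apply ha
      have h3 := Int.gcd_dvd_left (l * a) (l * r : ℕ)
      rw [hi2, this, pow_succ', ← hr] at h3
      push_cast at h3
      have hl0 : (l : ℤ) ≠ 0 := by exact_mod_cast hl.ne_zero
      exact (mul_dvd_mul_iff_left hl0).1 h3
    rw [hr]
    exact_mod_cast pow_dvd_pow l hi3
  obtain ⟨c, hc⟩ := hgd
  have hbez := Int.gcd_eq_gcd_ab (l * a) (l * r : ℕ)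
  set X := Int.gcdA (l * a) (l * r : ℕ)
  set Y := Int.gcdB (l * a) (l * r : ℕ)
  have h2 := hmul (1 + (l * M : ℕ) * (X * c)) a (by
    rw [Int.modEq_iff_dvd]
    exact ⟨-(X * c), by ring⟩)
  rw [← h2, ← per_mul _ η hper (_ * a) (Y * c)]
  congr 1
  rw [hbez] at hc
  push_cast at hc ⊢
  linear_combination M * hc

/-- Partial sums. -/
def etaS (l m M : ℕ) (η : ℤ → ℤ) (c : ℤ) : ℤ :=
  ∑ i ∈ Finset.range (l ^ (m-1)), η (c + M * i)

/-- Reduced function. -/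
def eta1 (l m M : ℕ) (η : ℤ → ℤ) (x : ℤ) : ℤ := etaS l m M η ((l ^ (m-1) : ℕ) * x)

theorem etaS_step (l m M : ℕ) (hl : l.Prime) (η : ℤ → ℤ) 
    (hper : ∀ a, η (a + (l ^ (m-1) * (l * M) : ℕ)) = η a) 
    (hmul : ∀ u a : ℤ, u ≡ 1 [ZMOD (l * M : ℕ)] → η (u * a) = η a)
    (c : ℤ) (hc : ¬ ((l ^ (m-1) : ℕ) : ℤ) ∣ c) :
    etaS l m M η (c + M) = etaS l m M η c := by
  unfold etaS
  have h1 := Finset.sum_range_succ (fun i : ℕ => η (c + M * i)) (l ^ (m-1))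
  have h2 := Finset.sum_range_succ' (fun i : ℕ => η (c + M * i)) (l ^ (m-1))
  have h3 := red_step l m M hl η hper hmul c hc
  have h4 : ∑ i ∈ Finset.range (l ^ (m-1)), η (c + M + M * i)
      = ∑ i ∈ Finset.range (l ^ (m-1)), η (c + M * ((i + 1 : ℕ) : ℤ)) := by
    refine Finset.sum_congr rfl fun i _ => ?_
    congr 1; push_cast; ring
  rw [h4]
  simp only [Nat.cast_zero, mul_zero, add_zero] at h2
  linarith

theorem etaS_mem (l m M : ℕ) (hl : l.Prime) (hlM : ¬ l ∣ M) (η : ℤ → ℤ) 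
    (hper : ∀ a, η (a + (l ^ (m-1) * (l * M) : ℕ)) = η a) 
    (hmul : ∀ u a : ℤ, u ≡ 1 [ZMOD (l * M : ℕ)] → η (u * a) = η a)
    (c : ℤ) : ∃ x, ∀ y, etaS l m M η (c + (l ^ (m-1) : ℕ) * y) = eta1 l m M η (x + y) := by
  have hex : ∃ k : ℕ, ((l ^ (m-1) : ℕ) : ℤ) ∣ c + M * k := by
    have hcop : IsCoprime (M : ℤ) ((l ^ (m-1) : ℕ) : ℤ) := by
      rw [Nat.isCoprime_iff_coprime]
      exact Nat.Coprime.pow_right _ (((Nat.Prime.coprime_iff_not_dvd hl).2 hlM).symm)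
    obtain ⟨a, b, hab⟩ := hcop
    have hr0 : (0 : ℤ) < (l ^ (m-1) : ℕ) := by exact_mod_cast Nat.pow_pos hl.pos
    refine ⟨((-c * a) % (l ^ (m-1) : ℕ)).toNat, ?_⟩
    rw [Int.toNat_of_nonneg (Int.emod_nonneg _ hr0.ne')]
    have h5 := Int.emod_add_mul_ediv (-c * a) ((l ^ (m-1) : ℕ) : ℤ)
    set q := (-c * a) / ((l ^ (m-1) : ℕ) : ℤ)
    refine ⟨c * b - M * q, ?_⟩
    linear_combination M * h5 - c * hab
  obtain ⟨k, hk⟩ := hex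
  induction k generalizing c with
  | zero =>
    obtain ⟨x, hx⟩ := hk
    refine ⟨x, fun y => ?_⟩
    unfold eta1
    congr 1
    simp only [Nat.cast_zero, mul_zero, add_zero] at hx
    rw [hx]; ring
  | succ k ih =>
    by_cases hc : ((l ^ (m-1) : ℕ) : ℤ) ∣ c
    · obtain ⟨x, hx⟩ := hc
      refine ⟨x, fun y => ?_⟩
      unfold eta1
      congr 1
      rw [hx]; ring
    · obtain ⟨x, hx⟩ := ih (c + M) (by push_cast at hk ⊢; convert hk using 1; ring)
      refine ⟨x, fun y => ?_⟩
      rw [← hx y, ← etaS_step l m M hl η hper hmul (c + (l ^ (m-1) : ℕ) * y)]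
      · congr 1; ring
      · intro h
        apply hc
        exact (Int.dvd_add_left (dvd_mul_right _ _)).1 h

theorem eta1_per (l m M : ℕ) (η : ℤ → ℤ) 
    (hper : ∀ a, η (a + (l ^ (m-1) * (l * M) : ℕ)) = η a) (x : ℤ) : eta1 l m M η (x + (l * M : ℕ)) = eta1 l m M η x := by
  unfold eta1 etaS
  refine Finset.sum_congr rfl fun i _ => ?_
  rw [← hper ((l ^ (m-1) : ℕ) * x + M * i)]
  congr 1; push_cast; ring

theorem eta1_mul (l m M : ℕ) (hl : l.Prime) (hlM : ¬ l ∣ M) (η : ℤ → ℤ) 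
    (hper : ∀ a, η (a + (l ^ (m-1) * (l * M) : ℕ)) = η a) 
    (hmul : ∀ u a : ℤ, u ≡ 1 [ZMOD (l * M : ℕ)] → η (u * a) = η a)
    (u : ℤ) (hu : IsCoprime u (l : ℤ)) (huη : ∀ a, η (u * a) = η a) (x : ℤ) :
    eta1 l m M η (u * x) = eta1 l m M η x := by
  set r := l ^ (m-1) with hr
  have hur : IsCoprime u (r : ℤ) := by rw [hr]; push_cast; exact hu.pow_right
  have hMr : IsCoprime (r : ℤ) (M : ℤ) := by
    rw [Nat.isCoprime_iff_coprime, hr]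
    exact Nat.Coprime.pow_left _ (((Nat.Prime.coprime_iff_not_dvd hl).2 hlM))
  have hr0 : 0 < r := Nat.pow_pos hl.pos
  let g : ℤ → ℤ → ℤ := fun z i => if (r : ℤ) ∣ i then η (r * z) else η (r * z + M * i)
  have hgper : ∀ z i, g z (i + r) = g z i := by
    intro z i
    simp only [g]
    have hdd : (r : ℤ) ∣ i + r ↔ (r : ℤ) ∣ i := (Int.dvd_add_left (dvd_refl _))
    simp only [hdd]
    split_ifs with h
    · rfl
    · rw [show (r : ℤ) * z + M * (i + r) = (r * z + M * i) + M * (l ^ (m-1) : ℕ) by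
        rw [← hr]; ring]
      apply red_step l m M hl η hper hmul
      rw [← hr]
      intro h2
      rw [Int.dvd_add_right (dvd_mul_right _ _)] at h2
      exact h (hMr.dvd_of_dvd_mul_left h2)
  have hsum : ∀ z, eta1 l m M η z = ∑ i ∈ Finset.range r, g z i := by
    intro z
    unfold eta1 etaS
    rw [← hr]
    refine Finset.sum_congr rfl fun i hi => ?_
    simp only [g]
    split_ifs with h
    · have : i = 0 := by
        have h3 : r ∣ i := by exact_mod_cast h
        exact Nat.eq_zero_of_dvd_of_lt h3 (Finset.mem_range.1 hi)
      subst this; simp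
    · rfl
  rw [hsum, hsum, ← sum_reindex r hr0 (g (u * x)) (hgper _) u 0 hur]
  refine Finset.sum_congr rfl fun i _ => ?_
  simp only [g, add_zero]
  have hiff : (r : ℤ) ∣ u * i ↔ (r : ℤ) ∣ i := ⟨hur.symm.dvd_of_dvd_mul_left, fun h => h.mul_left u⟩
  simp only [hiff]
  split_ifs with h
  · rw [← huη (r * x)]; congr 1; ring
  · rw [← huη (r * x + M * i)]; congr 1; ring

theorem eta1_fourier (l m M : ℕ) (hl : l.Prime) (hM : 0 < M) (hlM : ¬ l ∣ M) (η : ℤ → ℤ) 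
    (hper : ∀ a, η (a + (l ^ (m-1) * (l * M) : ℕ)) = η a) 
    (hmul : ∀ u a : ℤ, u ≡ 1 [ZMOD (l * M : ℕ)] → η (u * a) = η a)
    {A : Type*} [CommRing A] [IsDomain A] (e : ℤ → A)
    (hadd : ∀ a b, e (a + b) = e a * e b) 
    (heN : e (l ^ (m-1) * (l * M) : ℕ) = 1) (hcase : e M = 1 ∨ e ((l ^ (m-1) * M : ℕ)) ≠ 1) :
    ∑ x ∈ Finset.range (l * M), (eta1 l m M η x : A) * e ((l ^ (m-1) : ℕ) * x)
      = ∑ a ∈ Finset.range (l ^ (m-1) * (l * M)), (η a : A) * e a := by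
  set r := l ^ (m-1) with hr
  have hr0 : 0 < r := Nat.pow_pos hl.pos
  have hlM0 : 0 < l * M := Nat.mul_pos hl.pos hM
  have hMr : IsCoprime (M : ℤ) (r : ℤ) := by
    rw [Nat.isCoprime_iff_coprime, hr]
    exact Nat.Coprime.pow_right _ (((Nat.Prime.coprime_iff_not_dvd hl).2 hlM)).symm
  -- RHS
  have hR : ∑ a ∈ Finset.range (r * (l * M)), (η a : A) * e a
      = ∑ i ∈ Finset.range r, ∑ x ∈ Finset.range (l * M), (η (r * x + M * i) : A) * e (r * x + M * i) := by
    rw [sum_split r (l * M) (fun a => (η a : A) * e a)]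
    have := sum_reindex r hr0 (fun i => ∑ x ∈ Finset.range (l * M), (η (r * x + i) : A) * e (r * x + i))
      ?_ M 0 hMr
    · rw [← this]
      simp only [add_zero]
    · intro i
      have h2 := sum_reindex (l * M) hlM0 (fun x => (η (r * x + i) : A) * e (r * x + i)) ?_ 1 1
        isCoprime_one_left
      · rw [← h2]
        refine Finset.sum_congr rfl fun x _ => ?_
        rw [show (r : ℤ) * x + (i + r) = r * (1 * x + 1) + i by ring]
      · intro x
        rw [show (r : ℤ) * (x + (l * M : ℕ)) + i = (r * x + i) + (r * (l * M) : ℕ) by push_cast; ring]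
        rw [hper, hadd _ ((r * (l * M) : ℕ) : ℤ), heN, mul_one]
  have hL : ∑ x ∈ Finset.range (l * M), (eta1 l m M η x : A) * e (r * x)
      = ∑ i ∈ Finset.range r, ∑ x ∈ Finset.range (l * M), (η (r * x + M * i) : A) * e (r * x) := by
    rw [Finset.sum_comm]
    refine Finset.sum_congr rfl fun x _ => ?_
    unfold eta1 etaS
    rw [← hr]
    push_cast
    rw [Finset.sum_mul]
  rw [hR, hL]
  refine Finset.sum_congr rfl fun i hi => ?_
  rcases hcase with h1 | h1
  · have h2 : ∀ i : ℕ, e (M * i) = 1 := by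
      intro i
      induction i with
      | zero =>
        have h0 := hadd 0 M
        rw [zero_add, h1, mul_one] at h0
        simp [← h0]
      | succ i ih => 
        rw [show (M : ℤ) * ((i + 1 : ℕ) : ℤ) = M * i + M by push_cast; ring, hadd, ih, h1, mul_one]
    refine Finset.sum_congr rfl fun x _ => ?_
    rw [hadd, h2, mul_one]
  · by_cases hi0 : i = 0
    · subst hi0; simp
    · have hnd : ∀ x : ℤ, ¬ (r : ℤ) ∣ r * x + M * i := by
        intro x h
        rw [Int.dvd_add_right (dvd_mul_right _ _)] at h
        have h3 : r ∣ i := by exact_mod_cast hMr.symm.dvd_of_dvd_mul_left h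
        exact hi0 (Nat.eq_zero_of_dvd_of_lt h3 (Finset.mem_range.1 hi))
      have hz : ∑ x ∈ Finset.range (l * M), (η (r * x + M * i) : A) * e (r * x) = 0 := by
        set S := ∑ x ∈ Finset.range (l * M), (η (r * x + M * i) : A) * e (r * x) with hS
        have h2 := sum_reindex (l * M) hlM0 (fun x => (η (r * x + M * i) : A) * e (r * x)) ?_ 1 M
          isCoprime_one_left
        · have h3 : S * e ((r * M : ℕ)) = S := by
            conv_rhs => rw [hS, ← h2]
            rw [hS, Finset.sum_mul]
            refine Finset.sum_congr rfl fun x _ => ?_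
            rw [show (r : ℤ) * (1 * x + M) + M * i = (r * x + M * i) + M * (l ^ (m-1) : ℕ) by
              rw [← hr]; ring, red_step l m M hl η hper hmul _ (by rw [← hr]; exact hnd x),
              show (r : ℤ) * (1 * x + M) = r * x + (r * M : ℕ) by push_cast; ring, hadd, mul_assoc]
          have h4 : S * (e ((r * M : ℕ)) - 1) = 0 := by rw [mul_sub, h3]; ring
          rcases mul_eq_zero.1 h4 with h | h
          · exact h
          · exact absurd (sub_eq_zero.1 h) h1
        · intro x
          rw [show (r : ℤ) * (x + (l * M : ℕ)) + M * i = (r * x + M * i) + (r * (l * M) : ℕ) by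
            push_cast; ring, hper,
            show (r : ℤ) * (x + (l * M : ℕ)) = (r * x) + (r * (l * M) : ℕ) by push_cast; ring,
            hadd, heN, mul_one]
      rw [hz]
      have : ∀ x : ℤ, (η (r * x + M * i) : A) * e (r * x + M * i)
          = ((η (r * x + M * i) : A) * e (r * x)) * e (M * i) := by
        intro x; rw [hadd]; ring
      rw [Finset.sum_congr rfl fun (x : ℕ) _ => this x, ← Finset.sum_mul, hz, zero_mul]

end reduction

theorem pow_set (p N f D0 r f0 : ℕ) (H0 : Finset ℕ) (hN : N = D0 * r) (hD0 : 0 < D0)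
    (hr : 0 < r) (hf : f = f0 * r) (hord : orderOf (p : ZMod N) = f)
    (hH0 : H0.card = f0)
    (hsub : ∀ u ∈ H0, u < D0) (hpow : ∀ j, p ^ j % D0 ∈ H0) :
    (∀ u : ℕ, u % D0 ∈ H0 → ∃ j, p ^ j % N = u % N) ∧
    2 * ∑ j ∈ Finset.range f, p ^ j % N + D0 * f0 * r = 2 * r * ∑ u ∈ H0, u + D0 * f0 * (r * r) := by
  have hN0 : 0 < N := by rw [hN]; exact Nat.mul_pos hD0 hr
  have hDN : D0 ∣ N := ⟨r, hN⟩
  let S2 : Finset ℕ := (H0 ×ˢ Finset.range r).image (fun z => z.1 + D0 * z.2)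
  have hinj2 : Set.InjOn (fun z : ℕ × ℕ => z.1 + D0 * z.2) (H0 ×ˢ Finset.range r : Finset _) := by
    rintro ⟨a, i⟩ h1 ⟨b, j⟩ h2 h
    simp only [Finset.coe_product, Set.mem_prod, Finset.mem_coe] at h1 h2
    simp only at h
    have ea : (a + D0 * i) % D0 = a := by rw [Nat.add_mul_mod_self_left, Nat.mod_eq_of_lt (hsub a h1.1)]
    have eb : (b + D0 * j) % D0 = b := by rw [Nat.add_mul_mod_self_left, Nat.mod_eq_of_lt (hsub b h2.1)]
    have : a = b := by rw [← ea, ← eb, h]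
    subst this
    have : D0 * i = D0 * j := by omega
    rw [Nat.eq_of_mul_eq_mul_left hD0 this]
  have hinj1 : Set.InjOn (fun j => p ^ j % N) (Finset.range f : Finset ℕ) := by
    intro i hi j hj hij
    simp only [Finset.coe_range, Set.mem_Iio] at hi hj hij
    have h1 : ((p : ZMod N)) ^ i = (p : ZMod N) ^ j := by
      have := (ZMod.natCast_eq_natCast_iff' (p ^ i) (p ^ j) N).2 hij
      push_cast at this; exact this
    rw [← hord] at hi hj
    exact pow_injOn_Iio_orderOf hi hj h1
  have hc2 : S2.card = f := by
    rw [Finset.card_image_of_injOn hinj2, Finset.card_product, Finset.card_range, hH0, hf]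
  have hc1 : ((Finset.range f).image (fun j => p ^ j % N)).card = f := by
    rw [Finset.card_image_of_injOn hinj1, Finset.card_range]
  have hmem2 : ∀ u, u % D0 ∈ H0 → u % N ∈ S2 := by
    intro u hu
    rw [Finset.mem_image]
    refine ⟨(u % D0, (u % N) / D0), ?_, ?_⟩
    · rw [Finset.mem_product, Finset.mem_range]
      refine ⟨hu, ?_⟩
      rw [Nat.div_lt_iff_lt_mul hD0, mul_comm r, ← hN]
      exact Nat.mod_lt _ hN0
    · have := Nat.mod_add_div (u % N) D0
      rw [Nat.mod_mod_of_dvd _ hDN] at this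
      exact this
  have hsubset : (Finset.range f).image (fun j => p ^ j % N) ⊆ S2 := by
    intro x hx
    obtain ⟨j, _, rfl⟩ := Finset.mem_image.1 hx
    exact hmem2 _ (hpow j)
  have heq := Finset.eq_of_subset_of_card_le hsubset (by rw [hc1, hc2])
  constructor
  · intro u hu
    have := hmem2 u hu
    rw [← heq] at this
    obtain ⟨j, _, hj⟩ := Finset.mem_image.1 this
    exact ⟨j, hj⟩
  · have h1 : ∑ j ∈ Finset.range f, p ^ j % N = ∑ x ∈ S2, x := by
      rw [← heq, Finset.sum_image hinj1]
    rw [h1, Finset.sum_image hinj2, Finset.sum_product]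
    have h2 : ∀ x ∈ H0, ∑ y ∈ Finset.range r, (x + D0 * y) = r * x + D0 * ∑ y ∈ Finset.range r, y := by
      intro x _
      rw [Finset.sum_add_distrib, Finset.sum_const, Finset.card_range, Finset.mul_sum, smul_eq_mul]
    rw [Finset.sum_congr rfl h2, Finset.sum_add_distrib, ← Finset.mul_sum, Finset.sum_const, hH0,
      smul_eq_mul]
    have h3 := Finset.sum_range_id_mul_two r
    obtain ⟨r', rfl⟩ : ∃ r', r = r' + 1 := ⟨r - 1, by omega⟩
    simp only [Nat.add_sub_cancel] at h3
    set s := ∑ y ∈ Finset.range (r' + 1), y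
    have h3' : s * 2 = (r' + 1) * r' := h3
    linear_combination (D0 * f0) * h3'

theorem eta_pow_mul (p N : ℕ) (η : ℤ → ℤ) (hper : ∀ a, η (a + N) = η a)
    (hp : ∀ a, η (p * a) = η a) (u : ℤ) (j : ℕ) (hu : u ≡ (p : ℤ) ^ j [ZMOD N]) (a : ℤ) :
    η (u * a) = η a := by
  have h1 : ∀ j : ℕ, ∀ a, η ((p : ℤ) ^ j * a) = η a := by
    intro j
    induction j with
    | zero => simp
    | succ j ih => intro a; rw [pow_succ', mul_assoc, hp, ih]
  rw [per_congr N η hper (hu.mul_right a), h1]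

/-- Combined reduction. -/
theorem reduce (p₁ p₂ m n p N : ℕ) (hp₁ : p₁.Prime) (hp₂ : p₂.Prime) (hne : p₁ ≠ p₂)
    (hm : 1 ≤ m) (hn : 1 ≤ n) (hN : N = p₁ ^ m * p₂ ^ n) (η : ℤ → ℤ)
    (hcop1 : IsCoprime (p : ℤ) p₁) (hcop2 : IsCoprime (p : ℤ) p₂)
    (hper : ∀ a, η (a + N) = η a) (hp : ∀ a, η (p * a) = η a)
    (hmul : ∀ u a : ℤ, u ≡ 1 [ZMOD (p₁ * p₂ : ℕ)] → η (u * a) = η a) :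
    ∃ T : ℤ → ℤ, (∀ x, T (x + (p₁ * p₂ : ℕ)) = T x) ∧ (∀ x, T (p * x) = T x) ∧
      (∀ c, ∃ x, ∑ i ∈ Finset.range (p₁ ^ (m-1)), ∑ j ∈ Finset.range (p₂ ^ (n-1)),
        η (c + (p₂ ^ n * i + p₁ ^ m * j : ℕ)) = T x) ∧
      ∀ {A : Type*} [CommRing A] [IsDomain A] (e : ℤ → A) (_ : ∀ a b, e (a + b) = e a * e b)
        (_ : e N = 1) (_ : e (p₂ ^ n : ℕ) = 1 ∨ e (p₁ ^ (m-1) * p₂ ^ n : ℕ) ≠ 1)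
        (_ : e (p₁ ^ m : ℕ) = 1 ∨ e (p₁ ^ m * p₂ ^ (n-1) : ℕ) ≠ 1),
        ∑ x ∈ Finset.range (p₁ * p₂), (T x : A) * e ((p₁ ^ (m-1) * p₂ ^ (n-1) : ℕ) * x)
          = ∑ a ∈ Finset.range N, (η a : A) * e a := by
  have em : p₁ ^ m = p₁ ^ (m-1) * p₁ := by rw [← pow_succ]; congr 1; omega
  have en : p₂ ^ n = p₂ ^ (n-1) * p₂ := by rw [← pow_succ]; congr 1; omega
  have hnd1 : ¬ p₁ ∣ p₂ ^ n := by
    intro h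
    exact hne ((Nat.prime_dvd_prime_iff_eq hp₁ hp₂).1 (hp₁.dvd_of_dvd_pow h))
  have hnd2 : ¬ p₂ ∣ p₁ := by
    intro h
    exact hne ((Nat.prime_dvd_prime_iff_eq hp₂ hp₁).1 h).symm
  have hN1 : N = p₁ ^ (m-1) * (p₁ * p₂ ^ n) := by rw [hN, em]; ring
  have hper1 : ∀ a, η (a + (p₁ ^ (m-1) * (p₁ * p₂ ^ n) : ℕ)) = η a := by rw [← hN1]; exact hper
  have hmul1 : ∀ u a : ℤ, u ≡ 1 [ZMOD (p₁ * p₂ ^ n : ℕ)] → η (u * a) = η a := by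
    intro u a hu
    apply hmul
    refine hu.of_dvd ?_
    exact_mod_cast Nat.mul_dvd_mul_left p₁ (dvd_pow_self p₂ (by omega))
  set η1 := eta1 p₁ m (p₂ ^ n) η with hη1
  have hper2 : ∀ a, η1 (a + (p₂ ^ (n-1) * (p₂ * p₁) : ℕ)) = η1 a := by
    intro a
    have := eta1_per p₁ m (p₂ ^ n) η hper1 a
    have e0 : p₂ ^ (n-1) * (p₂ * p₁) = p₁ * p₂ ^ n := by rw [en]; ring
    rw [e0]
    exact this
  have hmul2 : ∀ u a : ℤ, u ≡ 1 [ZMOD (p₂ * p₁ : ℕ)] → η1 (u * a) = η1 a := by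
    intro u a hu
    apply eta1_mul p₁ m (p₂ ^ n) hp₁ hnd1 η hper1 hmul1
    · have h1 : u ≡ 1 [ZMOD p₁] := hu.of_dvd (by push_cast; exact dvd_mul_left _ _)
      obtain ⟨k, hk⟩ := h1.symm.dvd
      exact ⟨1, -k, by linear_combination hk⟩
    · intro a
      apply hmul
      rwa [mul_comm p₁]
  refine ⟨eta1 p₂ n p₁ η1, ?_, ?_, ?_, ?_⟩
  · intro x
    rw [mul_comm p₁]
    exact eta1_per p₂ n p₁ η1 hper2 x
  · apply eta1_mul p₂ n p₁ hp₂ hnd2 η1 hper2 hmul2 _ hcop2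
    exact eta1_mul p₁ m (p₂ ^ n) hp₁ hnd1 η hper1 hmul1 _ hcop1 hp
  · intro c
    obtain ⟨x, hx⟩ := etaS_mem p₁ m (p₂ ^ n) hp₁ hnd1 η hper1 hmul1 c
    obtain ⟨x', hx'⟩ := etaS_mem p₂ n p₁ hp₂ hnd2 η1 hper2 hmul2 x
    refine ⟨x', ?_⟩
    have h1 := hx' 0
    rw [mul_zero, add_zero, add_zero] at h1
    rw [← h1, Finset.sum_comm]
    unfold etaS
    refine Finset.sum_congr rfl fun j _ => ?_
    rw [hη1, ← hx]
    unfold etaS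
    refine Finset.sum_congr rfl fun i _ => ?_
    congr 1
    rw [em]; push_cast; ring
  · intro A _ _ e hadd heN hc1 hc2
    have h1 := eta1_fourier p₁ m (p₂ ^ n) hp₁ (Nat.pow_pos hp₂.pos) hnd1 η hper1 hmul1 e hadd
      (by rw [← hN1]; exact heN) hc1
    rw [← hN1] at h1
    rw [← h1]
    have h2 := eta1_fourier p₂ n p₁ hp₂ hp₁.pos hnd2 η1 hper2 hmul2
      (fun x => e ((p₁ ^ (m-1) : ℕ) * x)) (fun a b => by rw [mul_add, hadd]) ?_ ?_
    · have e1 : p₂ ^ (n-1) * (p₂ * p₁) = p₁ * p₂ ^ n := by rw [en]; ring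
      rw [e1] at h2
      rw [← h2, mul_comm p₂]
      refine Finset.sum_congr rfl fun x _ => ?_
      congr 2; push_cast; ring
    · rw [← heN]; congr 1; rw [hN, em, en]; push_cast; ring
    · have e2 : ((p₁ ^ (m-1) : ℕ) : ℤ) * p₁ = (p₁ ^ m : ℕ) := by rw [em]; push_cast; ring
      have e3 : ((p₁ ^ (m-1) : ℕ) : ℤ) * (p₂ ^ (n-1) * p₁ : ℕ) = (p₁ ^ m * p₂ ^ (n-1) : ℕ) := by
        rw [em]; push_cast; ring
      simp only [e2, e3]
      exact hc2


section fivevalues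

theorem e_zero {A : Type*} [CommRing A] (e : ℤ → A) (hadd : ∀ a b, e (a + b) = e a * e b) (N : ℤ)
    (hN : e N = 1) : e 0 = 1 := by
  have := hadd 0 N
  rw [zero_add, hN, mul_one] at this
  exact this.symm

theorem e_geom {A : Type*} [CommRing A] [IsDomain A] (e : ℤ → A)
    (hadd : ∀ a b, e (a + b) = e a * e b) (l : ℤ) (K : ℕ) (hK : 0 < K)
    (hN : e (l * K) = 1) (hl : e l ≠ 1) : ∑ x ∈ Finset.range K, e (l * x) = 0 := by
  have h1 := sum_reindex K hK (fun x => e (l * x)) (by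
    intro x; rw [mul_add, hadd, hN, mul_one]) 1 1 isCoprime_one_left
  set S := ∑ x ∈ Finset.range K, e (l * x) with hS
  have h2 : S * e l = S := by
    conv_rhs => rw [← h1]
    rw [hS, Finset.sum_mul]
    refine Finset.sum_congr rfl fun x _ => ?_
    rw [show l * (1 * (x : ℤ) + 1) = l * x + l by ring, hadd]
  have h3 : S * (e l - 1) = 0 := by rw [mul_sub, h2]; ring
  rcases mul_eq_zero.1 h3 with h | h
  · exact h
  · exact absurd (sub_eq_zero.1 h) hl

theorem V_pow (p : ℕ) (V : ℤ → ℤ) (hV : ∀ x, V (p * x) = V x) (j : ℕ) (x : ℤ) :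
    V ((p : ℤ) ^ j * x) = V x := by
  induction j with
  | zero => simp
  | succ j ih => rw [pow_succ', mul_assoc, hV, ih]

theorem V_line (p l K : ℕ) (V : ℤ → ℤ)
    (hper : ∀ x, V (x + (l * K : ℕ)) = V x) (hV : ∀ x, V (p * x) = V x)
    (hprimK : ∀ i < K, i ≠ 0 → ∃ j, p ^ j % K = i) (x : ℕ) (hx : x < K) (hx0 : x ≠ 0) :
    V (l * x) = V l := by
  obtain ⟨j, hj⟩ := hprimK x hx hx0
  rw [← V_pow p V hV j l]
  apply per_congr _ V hper
  have h1 : (x : ℤ) ≡ (p : ℤ) ^ j [ZMOD K] := by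
    have : x ≡ p ^ j [MOD K] := by
      rw [← hj]; exact Nat.mod_modEq _ _
    exact_mod_cast (Int.natCast_modEq_iff.2 this)
  have h2 := h1.mul_left' (c := (l : ℤ))
  push_cast
  rw [mul_comm ((p : ℤ) ^ j)]
  exact h2

theorem proj (p l K : ℕ) (hl : 1 < l) (hK : 0 < K) (V : ℤ → ℤ)
    (hper : ∀ x, V (x + (l * K : ℕ)) = V x) (hV : ∀ x, V (p * x) = V x)
    (hcopK : IsCoprime (p : ℤ) K)
    (hprim : ∀ i < l, i ≠ 0 → ∃ j, p ^ j % l = i)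
    (hprimK : ∀ i < K, i ≠ 0 → ∃ j, p ^ j % K = i) :
    ∃ X : ℤ, l * (V 0 + (K - 1) * V l) = (l - 1) * X + ∑ x ∈ Finset.range (l * K), V x ∧
      ∀ {A : Type*} [CommRing A] [IsDomain A] (e : ℤ → A) (_ : ∀ a b, e (a + b) = e a * e b)
        (_ : e l = 1) (_ : e 1 ≠ 1), ∑ x ∈ Finset.range (l * K), (V x : A) * e x = X := by
  let U : ℤ → ℤ := fun i => ∑ x ∈ Finset.range K, V (l * x + i)
  have hVl : ∀ i x : ℤ, V (l * (x + K) + i) = V (l * x + i) := by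
    intro i x
    rw [← hper (l * x + i)]; congr 1; push_cast; ring
  have hUper : ∀ i, U (i + l) = U i := by
    intro i
    have := sum_reindex K hK (fun x => V (l * x + i)) (hVl i) 1 1 isCoprime_one_left
    simp only [U]
    rw [← this]
    refine Finset.sum_congr rfl fun x _ => ?_
    congr 1; ring
  have hUp : ∀ i, U (p * i) = U i := by
    intro i
    have := sum_reindex K hK (fun x => V (l * x + p * i)) (hVl _) p 0 hcopK
    simp only [U]
    rw [← this]
    refine Finset.sum_congr rfl fun x _ => ?_
    rw [← hV (l * x + i)]
    congr 1; ring
  have hU1 : ∀ i < l, i ≠ 0 → U i = U 1 := by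
    intro i hi hi0
    obtain ⟨j, hj⟩ := hprim i hi hi0
    rw [← V_pow p U hUp j 1, mul_one]
    apply per_congr _ U hUper
    have : i ≡ p ^ j [MOD l] := by
      rw [← hj]; exact Nat.mod_modEq _ _
    exact_mod_cast (Int.natCast_modEq_iff.2 this)
  obtain ⟨l', rfl⟩ : ∃ l', l = l' + 1 := ⟨l - 1, by omega⟩
  have hU0 : U 0 = V 0 + (K - 1) * V (l' + 1 : ℕ) := by
    obtain ⟨K', rfl⟩ : ∃ K', K = K' + 1 := ⟨K - 1, by omega⟩
    simp only [U]
    rw [Finset.sum_range_succ']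
    have : ∀ x ∈ Finset.range K', V (((l' + 1 : ℕ) : ℤ) * ((x + 1 : ℕ) : ℤ) + 0) = V (l' + 1 : ℕ) := by
      intro x hx
      rw [add_zero]
      exact V_line p (l' + 1) (K' + 1) V hper hV hprimK (x + 1)
        (by have := Finset.mem_range.1 hx; omega) (by omega)
    rw [Finset.sum_congr rfl this, Finset.sum_const, Finset.card_range]
    simp
    ring
  refine ⟨U 0 - U 1, ?_, ?_⟩
  · rw [sum_split, ← hU0]
    change _ = _ + ∑ i ∈ Finset.range (l' + 1), U i
    rw [Finset.sum_range_succ']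
    have : ∀ x ∈ Finset.range l', U ((x + 1 : ℕ) : ℤ) = U 1 := by
      intro x hx
      exact hU1 (x + 1) (by have := Finset.mem_range.1 hx; omega) (by omega)
    rw [Finset.sum_congr rfl this, Finset.sum_const, Finset.card_range]
    simp
    ring
  · intro A _ _ e hadd hel he1
    have h0 := e_zero e hadd _ hel
    rw [sum_split _ K (fun x => (V x : A) * e x)]
    have hell : ∀ x : ℕ, e ((l' + 1 : ℕ) * x) = 1 := by
      intro x
      induction x with
      | zero => simpa using h0
      | succ x ih =>
        rw [show ((l' + 1 : ℕ) : ℤ) * ((x + 1 : ℕ) : ℤ) = (l' + 1 : ℕ) * x + (l' + 1 : ℕ) by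
          push_cast; ring, hadd, ih, hel, one_mul]
    have hstep : ∀ i ∈ Finset.range (l' + 1), ∑ x ∈ Finset.range K, (V ((l' + 1 : ℕ) * x + i) : A)
        * e ((l' + 1 : ℕ) * x + i) = (U i : A) * e i := by
      intro i _
      simp only [U]
      push_cast
      rw [Finset.sum_mul]
      refine Finset.sum_congr rfl fun x _ => ?_
      have := hell x
      push_cast at this
      rw [hadd, this, one_mul]
    rw [Finset.sum_congr rfl hstep, Finset.sum_range_succ']
    have : ∀ x ∈ Finset.range l', (U ((x + 1 : ℕ) : ℤ) : A) * e ((x + 1 : ℕ) : ℤ)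
        = U 1 * e ((x + 1 : ℕ) : ℤ) := by
      intro x hx
      rw [hU1 (x + 1) (by have := Finset.mem_range.1 hx; omega) (by omega)]
    rw [Finset.sum_congr rfl this, ← Finset.mul_sum]
    have hg := e_geom e hadd 1 (l' + 1) (by omega) (by simpa using hel) he1
    simp only [one_mul] at hg
    rw [Finset.sum_range_succ'] at hg
    simp only [Nat.cast_zero, h0] at hg ⊢
    push_cast at hg ⊢
    linear_combination (U 1 : A) * hg

/-- Indicator of a set of residues. -/
def indH (D0 : ℕ) (H : Finset ℕ) (x : ℤ) : ℤ := if (x % D0).toNat ∈ H then 1 else 0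

theorem indH_per (D0 : ℕ) (H : Finset ℕ) (x : ℤ) : indH D0 H (x + D0) = indH D0 H x := by
  unfold indH; rw [Int.add_emod_right]

theorem five (p p₁ p₂ : ℕ) (hp₁ : 1 < p₁) (hp₂ : 1 < p₂) (H : Finset ℕ)
    (hcop : p₁.Coprime p₂)
    (hprim1 : ∀ i < p₁, i ≠ 0 → ∃ j, p ^ j % p₁ = i)
    (hprim2 : ∀ i < p₂, i ≠ 0 → ∃ j, p ^ j % p₂ = i)
    (hHp : ∀ x ∈ H, ∃ j, p ^ j % (p₁ * p₂) = x)
    (hH1 : ∀ x < p₁ * p₂, (p₁ ∣ x ∨ p₂ ∣ x) →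
      indH (p₁ * p₂) H x = 0 ∧ indH (p₁ * p₂) H (-(x : ℤ)) = 0)
    (hH2 : ∀ x < p₁ * p₂, ¬ p₁ ∣ x → ¬ p₂ ∣ x →
      (indH (p₁ * p₂) H x = 1 ∧ indH (p₁ * p₂) H (-(x : ℤ)) = 0) ∨
      (indH (p₁ * p₂) H x = 0 ∧ indH (p₁ * p₂) H (-(x : ℤ)) = 1))
    (V : ℤ → ℤ) (hper : ∀ x, V (x + (p₁ * p₂ : ℕ)) = V x) (hV : ∀ x, V (p * x) = V x)
    {A : Type*} [CommRing A] [IsDomain A] (e : ℤ → A) (hadd : ∀ a b, e (a + b) = e a * e b)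
    (heN : e (p₁ * p₂ : ℕ) = 1) (he1 : e p₁ ≠ 1) (he2 : e p₂ ≠ 1) :
    ∑ x ∈ Finset.range (p₁ * p₂), (V x : A) * e x = V 0 - V p₁ - V p₂ +
      V 1 * ∑ x ∈ Finset.range (p₁ * p₂), (indH (p₁ * p₂) H x : A) * e x +
      V (-1) * ∑ x ∈ Finset.range (p₁ * p₂), (indH (p₁ * p₂) H (-(x : ℤ)) : A) * e x := by
  have h0 := e_zero e hadd _ heN
  have hind1 : ∀ x : ℤ, indH (p₁ * p₂) H x = 1 → V x = V 1 ∧ V (-x) = V (-1) := by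
    intro x hx
    unfold indH at hx
    split_ifs at hx with h
    · obtain ⟨j, hj⟩ := hHp _ h
      have h1 : x ≡ (p : ℤ) ^ j [ZMOD (p₁ * p₂ : ℕ)] := by
        have hpos : ((p₁ * p₂ : ℕ) : ℤ) ≠ 0 := by
          have : 0 < p₁ * p₂ := by positivity
          exact_mod_cast this.ne'
        have e1 := Int.emod_nonneg x hpos
        have e2 : ((p ^ j % (p₁ * p₂) : ℕ) : ℤ) = x % (p₁ * p₂ : ℕ) := by
          rw [hj, Int.toNat_of_nonneg e1]
        unfold Int.ModEq
        rw [← e2]; push_cast; rfl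
      constructor
      · rw [per_congr _ V hper h1, ← V_pow p V hV j 1, mul_one]
      · rw [per_congr _ V hper h1.neg, ← V_pow p V hV j (-1)]; congr 1; ring
    · exact absurd hx (by norm_num)
  let a : ℕ → A := fun x => if x = 0 then 1 else 0
  let b : ℕ → A := fun x => if p₁ ∣ x then 1 else 0
  let c : ℕ → A := fun x => if p₂ ∣ x then 1 else 0
  have hdec : ∀ x ∈ Finset.range (p₁ * p₂), (V x : A) * e x =
      (V 0 - V p₁ - V p₂) * (a x * e x) + V p₁ * (b x * e x) + V p₂ * (c x * e x)
      + V 1 * ((indH (p₁ * p₂) H x : A) * e x)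
      + V (-1) * ((indH (p₁ * p₂) H (-(x : ℤ)) : A) * e x) := by
    intro x hx
    rw [Finset.mem_range] at hx
    have : (V x : A) = (V 0 - V p₁ - V p₂) * a x + V p₁ * b x + V p₂ * c x
        + V 1 * (indH (p₁ * p₂) H x : A) + V (-1) * (indH (p₁ * p₂) H (-(x : ℤ)) : A) := by
      simp only [a, b, c]
      by_cases hx1 : p₁ ∣ x
      · rw [(hH1 x hx (Or.inl hx1)).1, (hH1 x hx (Or.inl hx1)).2]
        by_cases hx0 : x = 0
        · subst hx0; simp; ring
        · have hx2 : ¬ p₂ ∣ x := by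
            intro h
            have := Nat.le_of_dvd (by omega) (hcop.mul_dvd_of_dvd_of_dvd hx1 h)
            omega
          obtain ⟨y, rfl⟩ := hx1
          rw [if_neg hx0, if_pos (dvd_mul_right _ _), if_neg hx2]
          push_cast
          rw [V_line p p₁ p₂ V hper hV hprim2 y (Nat.lt_of_mul_lt_mul_left hx)
            (by rintro rfl; simp at hx0)]
          ring
      · by_cases hx2 : p₂ ∣ x
        · rw [(hH1 x hx (Or.inr hx2)).1, (hH1 x hx (Or.inr hx2)).2]
          have hx0 : x ≠ 0 := by rintro rfl; simp at hx1
          obtain ⟨y, rfl⟩ := hx2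
          rw [if_neg hx0, if_neg hx1, if_pos (dvd_mul_right _ _)]
          push_cast
          rw [V_line p p₂ p₁ V (by rw [mul_comm p₂]; exact hper) hV hprim1 y
            (by rw [mul_comm p₁] at hx; exact Nat.lt_of_mul_lt_mul_left hx)
            (by rintro rfl; simp at hx0)]
          ring
        · have hx0 : x ≠ 0 := by rintro rfl; simp at hx1
          rw [if_neg hx0, if_neg hx1, if_neg hx2]
          rcases hH2 x hx hx1 hx2 with ⟨h1, h2⟩ | ⟨h1, h2⟩
          · rw [h1, h2, (hind1 x h1).1]; push_cast; ring
          · rw [h1, h2]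
            have := (hind1 _ h2).2
            rw [neg_neg] at this
            rw [this]; push_cast; ring
    rw [this]; ring
  have hline : ∀ l K : ℕ, 0 < l → 0 < K → e (l * K : ℕ) = 1 → e l ≠ 1 →
      ∑ x ∈ Finset.range (l * K), (if l ∣ x then 1 else 0 : A) * e x = 0 := by
    intro l K hl hK h1 h2
    have h3 := e_geom e hadd l K hK (by exact_mod_cast h1) h2
    refine Eq.trans ?_ h3
    simp only [ite_mul, one_mul, zero_mul]
    rw [← Finset.sum_filter]
    symm
    refine Finset.sum_nbij (fun x => l * x) ?_ ?_ ?_ ?_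
    · intro x hx
      rw [Finset.mem_range] at hx
      rw [Finset.mem_filter, Finset.mem_range]
      exact ⟨Nat.mul_lt_mul_of_pos_left hx hl, dvd_mul_right _ _⟩
    · intro x _ y _ h
      exact Nat.eq_of_mul_eq_mul_left hl h
    · intro x hx
      rw [Finset.mem_coe, Finset.mem_filter, Finset.mem_range] at hx
      obtain ⟨hx1, y, rfl⟩ := hx
      exact ⟨y, by simpa using Nat.lt_of_mul_lt_mul_left hx1, rfl⟩
    · intro x _; push_cast; rfl
  rw [Finset.sum_congr rfl hdec]
  simp only [Finset.sum_add_distrib, ← Finset.mul_sum]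
  have ha : ∑ x ∈ Finset.range (p₁ * p₂), a x * e x = 1 := by
    rw [Finset.sum_eq_single 0]
    · simp [a, h0]
    · intro x _ hx; simp [a, hx]
    · intro h; exfalso; apply h; rw [Finset.mem_range]; positivity
  have hb : ∑ x ∈ Finset.range (p₁ * p₂), b x * e x = 0 :=
    hline p₁ p₂ (by omega) (by omega) heN he1
  have hc : ∑ x ∈ Finset.range (p₁ * p₂), c x * e x = 0 := by
    have := hline p₂ p₁ (by omega) (by omega) (by rw [mul_comm]; exact heN) he2
    rwa [mul_comm p₂] at this
  rw [ha, hb, hc]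
  ring

end fivevalues


section corr

/-- Autocorrelation of the indicator function. -/
def corH (D0 : ℕ) (H : Finset ℕ) (d : ℤ) : ℤ :=
  ∑ y ∈ Finset.range D0, indH D0 H y * indH D0 H (y + d)

/-- The finite numerical facts used about the subgroup generated by `p`. -/
structure NumData (p p₁ p₂ h f0 : ℕ) (H : Finset ℕ) : Prop where
  one_lt1 : 1 < p₁
  one_lt2 : 1 < p₂
  cop : p₁.Coprime p₂
  copp : p.Coprime (p₁ * p₂)
  prim1 : ∀ i < p₁, i ≠ 0 → ∃ j, p ^ j % p₁ = i
  prim2 : ∀ i < p₂, i ≠ 0 → ∃ j, p ^ j % p₂ = i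
  Hp : ∀ x ∈ H, ∃ j, p ^ j % (p₁ * p₂) = x
  H1 : ∀ x < p₁ * p₂, (p₁ ∣ x ∨ p₂ ∣ x) →
      indH (p₁ * p₂) H x = 0 ∧ indH (p₁ * p₂) H (-(x : ℤ)) = 0
  H2 : ∀ x < p₁ * p₂, ¬ p₁ ∣ x → ¬ p₂ ∣ x →
      (indH (p₁ * p₂) H x = 1 ∧ indH (p₁ * p₂) H (-(x : ℤ)) = 0) ∨
      (indH (p₁ * p₂) H x = 0 ∧ indH (p₁ * p₂) H (-(x : ℤ)) = 1)
  hpow : ∀ j, p ^ j % (p₁ * p₂) ∈ H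
  card : H.card = f0
  sub : ∀ u ∈ H, u < p₁ * p₂
  indp : ∀ x < p₁ * p₂, indH (p₁ * p₂) H (p * (x : ℤ)) = indH (p₁ * p₂) H x
  c1 : corH (p₁ * p₂) H (-1) = corH (p₁ * p₂) H 1
  c0 : corH (p₁ * p₂) H 0 - corH (p₁ * p₂) H p₁ - corH (p₁ * p₂) H p₂ + corH (p₁ * p₂) H 1 = p ^ h
  D0 : p₁ * p₂ + 1 = 4 * p ^ h
  sumH : 2 * ∑ u ∈ H, u + p₁ * p₂ * h = p₁ * p₂ * f0 ∨ 2 * ∑ u ∈ H, u = p₁ * p₂ * (f0 + h)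
  f0eq : 2 * f0 = (p₁ - 1) * (p₂ - 1)
  cnt1 : ∑ x ∈ Finset.range (p₁ * p₂), (if p₁ ∣ x then 1 else 0 : ℤ) = p₂
  cnt2 : ∑ x ∈ Finset.range (p₁ * p₂), (if p₂ ∣ x then 1 else 0 : ℤ) = p₁
  cnt3 : ∑ x ∈ Finset.range (p₁ * p₂), indH (p₁ * p₂) H x = f0
  cnt4 : ∑ x ∈ Finset.range (p₁ * p₂), indH (p₁ * p₂) H (-(x : ℤ)) = f0

theorem NumData.ind_mul {p p₁ p₂ h f0 : ℕ} {H : Finset ℕ} (nd : NumData p p₁ p₂ h f0 H) (x : ℤ) :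
    indH (p₁ * p₂) H (p * x) = indH (p₁ * p₂) H x := by
  have hpos : (0 : ℤ) < ((p₁ * p₂ : ℕ) : ℤ) := by
    have := nd.one_lt1; have := nd.one_lt2
    have : 0 < p₁ * p₂ := by positivity
    exact_mod_cast this
  have e1 := Int.emod_nonneg x hpos.ne'
  have e2 := Int.emod_lt_of_pos x hpos
  obtain ⟨y, hy⟩ := Int.eq_ofNat_of_zero_le e1
  have hy' : x ≡ (y : ℤ) [ZMOD (p₁ * p₂ : ℕ)] := by rw [← hy]; exact (Int.mod_modEq _ _).symm
  have h3 := nd.indp y (by rw [hy] at e2; exact_mod_cast e2)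
  rw [per_congr _ _ (indH_per _ H) hy', ← h3]
  exact per_congr _ _ (indH_per _ H) (hy'.mul_left _)

theorem NumData.corr {p p₁ p₂ h f0 : ℕ} {H : Finset ℕ} (nd : NumData p p₁ p₂ h f0 H)
    {A : Type*} [CommRing A] [IsDomain A] (e : ℤ → A) (hadd : ∀ a b, e (a + b) = e a * e b)
    (heN : e (p₁ * p₂ : ℕ) = 1) (he1 : e p₁ ≠ 1) (he2 : e p₂ ≠ 1) :
    ∃ θ θ' : A, θ + θ' = 1 ∧ θ * θ' = (p : A) ^ h ∧
      (∑ x ∈ Finset.range (p₁ * p₂), (indH (p₁ * p₂) H x : A) * e (-(x : ℤ)) = θ') ∧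
      ∀ (V : ℤ → ℤ) (_ : ∀ x, V (x + (p₁ * p₂ : ℕ)) = V x) (_ : ∀ x, V (p * x) = V x),
        (∑ x ∈ Finset.range (p₁ * p₂), (V x : A) * e x
          = V 0 - V p₁ - V p₂ + V 1 * θ + V (-1) * θ') ∧
        (∑ x ∈ Finset.range (p₁ * p₂), (V x : A) * e (-(x : ℤ))
          = V 0 - V p₁ - V p₂ + V 1 * θ' + V (-1) * θ) := by
  have hD0 : 0 < p₁ * p₂ := by
    have := nd.one_lt1; have := nd.one_lt2; positivity
  have F := five p p₁ p₂ nd.one_lt1 nd.one_lt2 H nd.cop nd.prim1 nd.prim2 nd.Hp nd.H1 nd.H2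
  have h0 := e_zero e hadd _ heN
  have hneg : ∀ x, e (-x) * e x = 1 := by intro x; rw [← hadd]; simpa using h0
  have heper : ∀ x, e (x + (p₁ * p₂ : ℕ)) = e x := by intro x; rw [hadd, heN, mul_one]
  have hcopn : IsCoprime (-1 : ℤ) ((p₁ * p₂ : ℕ) : ℤ) := isCoprime_one_left.neg_left
  have hcopp : IsCoprime (p : ℤ) ((p₁ * p₂ : ℕ) : ℤ) := Nat.isCoprime_iff_coprime.2 nd.copp
  set θ := ∑ x ∈ Finset.range (p₁ * p₂), (indH (p₁ * p₂) H x : A) * e x with hθ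
  set θ' := ∑ x ∈ Finset.range (p₁ * p₂), (indH (p₁ * p₂) H (-(x : ℤ)) : A) * e x with hθ'
  have hθ'2 : ∑ x ∈ Finset.range (p₁ * p₂), (indH (p₁ * p₂) H x : A) * e (-(x : ℤ)) = θ' := by
    have := sum_reindex (p₁ * p₂) hD0 (fun x => (indH (p₁ * p₂) H (-x) : A) * e x) (by
      intro x
      rw [heper, ← indH_per _ H (-(x + (p₁ * p₂ : ℕ)))]
      congr 4; ring) (-1) 0 hcopn
    rw [hθ', ← this]
    refine Finset.sum_congr rfl fun x _ => ?_
    simp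
  have hneg1 : ∀ x, e (-x) = 1 → e x = 1 := by
    intro x hx; have := hneg x; rwa [hx, one_mul] at this
  have Fneg := fun V h1 h2 => F V h1 h2 (A := A) (fun x => e (-x))
    (by intro a b; rw [neg_add, hadd]) (by have := hneg (p₁ * p₂ : ℕ); rwa [heN, mul_one] at this)
    (fun h => he1 (hneg1 _ h)) (fun h => he2 (hneg1 _ h))
  have hθ2 : ∑ x ∈ Finset.range (p₁ * p₂), (indH (p₁ * p₂) H (-(x : ℤ)) : A) * e (-(x : ℤ)) = θ := by
    have := sum_reindex (p₁ * p₂) hD0 (fun x => (indH (p₁ * p₂) H x : A) * e x) (by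
      intro x
      rw [heper, indH_per]) (-1) 0 hcopn
    rw [hθ, ← this]
    refine Finset.sum_congr rfl fun x _ => ?_
    simp
  have hsum : θ + θ' = 1 := by
    have h1 := F (fun _ => 1) (fun _ => rfl) (fun _ => rfl) e hadd heN he1 he2
    have h2 := e_geom e hadd 1 (p₁ * p₂) hD0 (by simpa using heN) (by
      intro h
      apply he1
      have : ∀ k : ℕ, e k = 1 := by
        intro k
        induction k with
        | zero => simpa using h0
        | succ k ih => push_cast; rw [hadd, ih, h, one_mul]
      exact this _)
    simp only [one_mul] at h2
    simp only [Int.cast_one, one_mul] at h1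
    rw [h2] at h1
    linear_combination -h1
  refine ⟨θ, θ', hsum, ?_, hθ'2, ?_⟩
  · have h1 := F (corH (p₁ * p₂) H) (by
        intro d; unfold corH
        refine Finset.sum_congr rfl fun y _ => ?_
        rw [← add_assoc, indH_per]) (by
        intro d
        have := sum_reindex (p₁ * p₂) hD0
          (fun y => indH (p₁ * p₂) H y * indH (p₁ * p₂) H (y + p * d)) (by
          intro y
          rw [indH_per, add_right_comm, indH_per]) p 0 hcopp
        unfold corH
        rw [← this]
        refine Finset.sum_congr rfl fun y _ => ?_
        rw [add_zero, nd.ind_mul, ← mul_add, nd.ind_mul]) e hadd heN he1 he2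
    have h2 : θ' * θ = ∑ d ∈ Finset.range (p₁ * p₂), (corH (p₁ * p₂) H d : A) * e d := by
      rw [← hθ'2, Finset.sum_mul]
      have : ∀ y ∈ Finset.range (p₁ * p₂), (indH (p₁ * p₂) H y : A) * e (-(y : ℤ)) * θ =
          ∑ d ∈ Finset.range (p₁ * p₂), (indH (p₁ * p₂) H y : A) *
            (indH (p₁ * p₂) H (y + d) : A) * e d := by
        intro y _
        have := sum_reindex (p₁ * p₂) hD0 (fun x => (indH (p₁ * p₂) H x : A) * e x) (by
          intro x
          rw [heper, indH_per]) 1 y isCoprime_one_left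
        rw [hθ, ← this, Finset.mul_sum]
        refine Finset.sum_congr rfl fun d _ => ?_
        rw [one_mul, add_comm (d : ℤ), hadd]
        linear_combination (indH (p₁ * p₂) H y : A) * (indH (p₁ * p₂) H (y + d) : A) * e d * hneg y
      rw [Finset.sum_congr rfl this, Finset.sum_comm]
      refine Finset.sum_congr rfl fun d _ => ?_
      unfold corH
      push_cast
      rw [Finset.sum_mul]
    rw [mul_comm, h2, h1, ← hθ, ← hθ', nd.c1]
    have h3 := congrArg (Int.cast (R := A)) nd.c0
    push_cast at h3
    linear_combination h3 + (corH (p₁ * p₂) H 1 : A) * hsum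
  · intro V hV1 hV2
    refine ⟨F V hV1 hV2 e hadd heN he1 he2, ?_⟩
    have := Fneg V hV1 hV2
    rw [hθ'2, hθ2] at this
    exact this

/-- A set of residues below `D0` encoded by the binary digits of `B`. -/
def bitH (B D0 : ℕ) : Finset ℕ := (Finset.range D0).filter fun x => B.testBit x = true

/-- Computable form of the indicator function. -/
def bitI (B D0 : ℕ) (x : ℤ) : ℤ := bif B.testBit (x % D0).toNat then 1 else 0

/-- Computable form of the autocorrelation. -/
def bitC (B D0 : ℕ) (d : ℤ) : ℤ := ∑ y ∈ Finset.range D0, bitI B D0 y * bitI B D0 (y + d)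

theorem indH_bit (B D0 : ℕ) (hD : 0 < D0) (x : ℤ) : indH D0 (bitH B D0) x = bitI B D0 x := by
  have h1 := Int.emod_nonneg x (b := D0) (by omega)
  have h2 := Int.emod_lt_of_pos x (b := D0) (by omega)
  unfold indH bitI bitH
  have h3 : (x % D0).toNat < D0 := by omega
  cases h : B.testBit (x % D0).toNat <;> simp [h, h3]

theorem corH_bit (B D0 : ℕ) (hD : 0 < D0) (d : ℤ) : corH D0 (bitH B D0) d = bitC B D0 d := by
  unfold corH bitC
  simp only [indH_bit B D0 hD]

theorem bitH_pow (B p D0 f0 : ℕ) (hD : 0 < D0) (hf : 0 < f0) (h1 : p ^ f0 % D0 = 1 % D0)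
    (hb : ∀ j < f0, B.testBit (p ^ j % D0) = true) (j : ℕ) :
    p ^ j % D0 ∈ bitH B D0 := by
  unfold bitH
  rw [Finset.mem_filter]
  refine ⟨Finset.mem_range.2 (Nat.mod_lt _ hD), ?_⟩
  have h2 : p ^ f0 ≡ 1 [MOD D0] := h1
  have h3 := (h2.pow (j / f0)).mul_right (p ^ (j % f0))
  rw [← pow_mul, ← pow_add, Nat.div_add_mod, one_pow, one_mul] at h3
  have h4 := hb (j % f0) (Nat.mod_lt _ hf)
  rwa [← (h3 : _ % _ = _ % _)] at h4

theorem prim_of (p l : ℕ) (h : ∀ i < l, i ≠ 0 → ∃ j < l, p ^ j % l = i) :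
    ∀ i < l, i ≠ 0 → ∃ j, p ^ j % l = i := fun i hi h0 => by
  obtain ⟨j, _, hj⟩ := h i hi h0
  exact ⟨j, hj⟩

theorem bitH_sub (B p D0 f0 : ℕ)
    (h : ∀ x < D0, B.testBit x = true → ∃ j < f0, p ^ j % D0 = x) :
    ∀ x ∈ bitH B D0, ∃ j, p ^ j % D0 = x := by
  intro x hx
  unfold bitH at hx
  rw [Finset.mem_filter, Finset.mem_range] at hx
  obtain ⟨j, _, hj⟩ := h x hx.1 hx.2
  exact ⟨j, hj⟩

theorem bitH_lt (B D0 : ℕ) : ∀ x ∈ bitH B D0, x < D0 := by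
  intro x hx
  unfold bitH at hx
  rw [Finset.mem_filter, Finset.mem_range] at hx
  exact hx.1

theorem bitH_num (B p p₁ p₂ h f0 : ℕ) (one_lt1 : 1 < p₁) (one_lt2 : 1 < p₂)
    (hf : 0 < f0) (cop : p₁.Coprime p₂) (copp : p.Coprime (p₁ * p₂))
    (prim1 : ∀ i < p₁, i ≠ 0 → ∃ j < p₁, p ^ j % p₁ = i)
    (prim2 : ∀ i < p₂, i ≠ 0 → ∃ j < p₂, p ^ j % p₂ = i)
    (h1 : p ^ f0 % (p₁ * p₂) = 1 % (p₁ * p₂))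
    (Hp : ∀ x < p₁ * p₂, B.testBit x = true → ∃ j < f0, p ^ j % (p₁ * p₂) = x)
    (H1 : ∀ x < p₁ * p₂, (p₁ ∣ x ∨ p₂ ∣ x) →
      bitI B (p₁ * p₂) x = 0 ∧ bitI B (p₁ * p₂) (-(x : ℤ)) = 0)
    (H2 : ∀ x < p₁ * p₂, ¬ p₁ ∣ x → ¬ p₂ ∣ x →
      (bitI B (p₁ * p₂) x = 1 ∧ bitI B (p₁ * p₂) (-(x : ℤ)) = 0) ∨
      (bitI B (p₁ * p₂) x = 0 ∧ bitI B (p₁ * p₂) (-(x : ℤ)) = 1))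
    (hb : ∀ j < f0, B.testBit (p ^ j % (p₁ * p₂)) = true)
    (card : (bitH B (p₁ * p₂)).card = f0)
    (indp : ∀ x < p₁ * p₂, bitI B (p₁ * p₂) (p * (x : ℤ)) = bitI B (p₁ * p₂) x)
    (c1 : bitC B (p₁ * p₂) (-1) = bitC B (p₁ * p₂) 1)
    (c0 : bitC B (p₁ * p₂) 0 - bitC B (p₁ * p₂) p₁ - bitC B (p₁ * p₂) p₂
      + bitC B (p₁ * p₂) 1 = p ^ h)
    (D0 : p₁ * p₂ + 1 = 4 * p ^ h)
    (sumH : 2 * ∑ u ∈ bitH B (p₁ * p₂), u + p₁ * p₂ * h = p₁ * p₂ * f0 ∨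
      2 * ∑ u ∈ bitH B (p₁ * p₂), u = p₁ * p₂ * (f0 + h))
    (f0eq : 2 * f0 = (p₁ - 1) * (p₂ - 1))
    (cnt1 : ∑ x ∈ Finset.range (p₁ * p₂), (if p₁ ∣ x then 1 else 0 : ℤ) = p₂)
    (cnt2 : ∑ x ∈ Finset.range (p₁ * p₂), (if p₂ ∣ x then 1 else 0 : ℤ) = p₁)
    (cnt3 : ∑ x ∈ Finset.range (p₁ * p₂), bitI B (p₁ * p₂) x = f0)
    (cnt4 : ∑ x ∈ Finset.range (p₁ * p₂), bitI B (p₁ * p₂) (-(x : ℤ)) = f0) :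
    NumData p p₁ p₂ h f0 (bitH B (p₁ * p₂)) := by
  have hD : 0 < p₁ * p₂ := by positivity
  refine ⟨one_lt1, one_lt2, cop, copp, prim_of _ _ prim1, prim_of _ _ prim2,
    bitH_sub _ _ _ _ Hp, ?_, ?_, bitH_pow _ _ _ _ hD hf h1 hb, card, bitH_lt _ _, ?_, ?_, ?_, D0,
    sumH, f0eq, cnt1, cnt2, ?_, ?_⟩
  · simpa only [indH_bit _ _ hD] using H1
  · simpa only [indH_bit _ _ hD] using H2
  · simpa only [indH_bit _ _ hD] using indp
  · simpa only [corH_bit _ _ hD] using c1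
  · simpa only [corH_bit _ _ hD] using c0
  · simpa only [indH_bit _ _ hD] using cnt3
  · simpa only [indH_bit _ _ hD] using cnt4

theorem num1 : ∃ H, NumData 2 5 3 2 4 H :=
  ⟨_, bitH_num 278
    2 5 3 2 4 (by norm_num) (by norm_num) (by norm_num) (by norm_num) (by norm_num)
    (by decide +kernel) (by decide +kernel) (by decide +kernel) (by decide +kernel)
    (by decide +kernel) (by decide +kernel) (by decide +kernel) (by decide +kernel)
    (by decide +kernel) (by decide +kernel) (by decide +kernel) (by decide +kernel)
    (by decide +kernel) (by norm_num) (by decide +kernel) (by decide +kernel) (by decide +kernel)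
    (by decide +kernel)⟩

theorem num2 : ∃ H, NumData 3 5 7 2 12 H :=
  ⟨_, bitH_num 9261234714
    3 5 7 2 12 (by norm_num) (by norm_num) (by norm_num) (by norm_num) (by norm_num)
    (by decide +kernel) (by decide +kernel) (by decide +kernel) (by decide +kernel)
    (by decide +kernel) (by decide +kernel) (by decide +kernel) (by decide +kernel)
    (by decide +kernel) (by decide +kernel) (by decide +kernel) (by decide +kernel)
    (by decide +kernel) (by norm_num) (by decide +kernel) (by decide +kernel) (by decide +kernel)
    (by decide +kernel)⟩

theorem num3 : ∃ H, NumData 3 17 19 4 144 H :=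
  ⟨_, bitH_num 5284261855133258917510602076030587459484276261361349805674985879368048257195000062836970230994458
    3 17 19 4 144 (by norm_num) (by norm_num) (by norm_num) (by norm_num) (by norm_num)
    (by decide +kernel) (by decide +kernel) (by decide +kernel) (by decide +kernel)
    (by decide +kernel) (by decide +kernel) (by decide +kernel) (by decide +kernel)
    (by decide +kernel) (by decide +kernel) (by decide +kernel) (by decide +kernel)
    (by decide +kernel) (by norm_num) (by decide +kernel) (by decide +kernel) (by decide +kernel)
    (by decide +kernel)⟩

end corr


section core

theorem pdvd_of_unit {A k : Type*} [CommRing A] [IsDomain A] [CharZero A] [CommRing k] [IsDomain k]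
    (p : ℕ) (hp0 : p ≠ 0) [CharP k p] (red : A →+* k) (v : A) (hv : red v ≠ 0) (s : ℕ) (x : ℤ)
    (h : (p : A) ^ s ∣ v * x) : (p : ℤ) ^ s ∣ x := by
  induction s generalizing x with
  | zero => simp
  | succ s ih =>
    obtain ⟨y, hy⟩ := h
    have h1 := congrArg red hy
    have hx : (x : k) = 0 := by
      simp only [map_mul, map_pow, map_natCast, map_intCast, CharP.cast_eq_zero] at h1
      rw [pow_succ, mul_zero, zero_mul] at h1
      exact (mul_eq_zero.1 h1).resolve_left hv
    obtain ⟨x', rfl⟩ := (CharP.intCast_eq_zero_iff k p x).1 hx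
    rw [pow_succ']
    refine mul_dvd_mul_left _ (ih x' ⟨y, ?_⟩)
    have hpA : (p : A) ≠ 0 := by exact_mod_cast hp0
    apply mul_left_cancel₀ hpA
    push_cast at hy
    linear_combination hy

theorem nd_aux (a b s : ℕ) (ha : a.Prime) (hb : b.Prime) (hne : a ≠ b) (hs : 1 ≤ s) (M k : ℕ) :
    ¬ (M * b ^ s) ∣ a ^ k * b ^ (s - 1) := by
  intro h
  have h1 : b ^ s ∣ a ^ k * b ^ (s - 1) := (dvd_mul_left _ _).trans h
  have h2 : b ^ s = b * b ^ (s - 1) := by rw [← pow_succ']; congr 1; omega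
  rw [h2] at h1
  have h3 := Nat.dvd_of_mul_dvd_mul_right (pow_pos hb.pos _) h1
  exact hne ((Nat.prime_dvd_prime_iff_eq hb ha).1 (hb.dvd_of_dvd_pow h3)).symm

/-- The character `a ↦ ξ ^ (t a)` -/
noncomputable def chi {A : Type*} [CommRing A] (ξ : Aˣ) (t a : ℤ) : A := ((ξ ^ (t * a) : Aˣ) : A)

theorem chi_add {A : Type*} [CommRing A] (ξ : Aˣ) (t a b : ℤ) :
    chi ξ t (a + b) = chi ξ t a * chi ξ t b := by
  unfold chi; rw [mul_add, zpow_add]; push_cast; rfl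

theorem chi_eq_one {A : Type*} [CommRing A] (ξ : Aˣ) (N : ℕ) (h : IsPrimitiveRoot ξ N) (t a : ℤ) :
    chi ξ t a = 1 ↔ (N : ℤ) ∣ t * a := by
  unfold chi
  rw [← h.zpow_eq_one_iff_dvd]
  exact Units.val_eq_one

theorem chi_nat {A : Type*} [CommRing A] (ξ : Aˣ) (t a : ℕ) :
    chi ξ t a = (ξ : A) ^ (t * a) := by
  unfold chi
  have : ((t : ℤ) * (a : ℤ)) = ((t * a : ℕ) : ℤ) := by push_cast; rfl
  rw [this, zpow_natCast]; push_cast; rfl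

theorem chi_neg {A : Type*} [CommRing A] (ξ : Aˣ) (N : ℕ) (h : IsPrimitiveRoot ξ N) (t t' a : ℤ)
    (ht : (N : ℤ) ∣ t + t') : chi ξ t' a = chi ξ t (-a) := by
  unfold chi
  have : (ξ ^ (t' * a - t * (-a)) : Aˣ) = 1 := by
    rw [h.zpow_eq_one_iff_dvd]
    obtain ⟨k, hk⟩ := ht
    exact ⟨k * a, by linear_combination a * hk⟩
  rw [zpow_sub, mul_inv_eq_one] at this
  rw [this]

theorem core_fourier {p p₁ p₂ h f0 : ℕ} {H : Finset ℕ} (nd : NumData p p₁ p₂ h f0 H)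
    (hp : p.Prime) (hp₁ : p₁.Prime) (hp₂ : p₂.Prime) (m n N : ℕ)
    (hm : 1 ≤ m) (hn : 1 ≤ n) (hN : N = p₁ ^ m * p₂ ^ n)
    (f e' : ℕ) (S1 S2 : ℕ) (hS : S1 + S2 = f) (hS1 : e' ≤ S1) (hS2 : e' ≤ S2)
    {A k : Type*} [CommRing A] [IsDomain A] [CharZero A] [CommRing k] [IsDomain k] [CharP k p]
    (red : A →+* k) (ξ w : A) (η : ℤ → ℤ) (hξ : IsPrimitiveRoot ξ N) (hw : red w ≠ 0)
    (hsum : ∑ a ∈ Finset.range N, η (a : ℤ) = -1)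
    (hGG : ∀ t t' : ℕ, ¬ N ∣ t → N ∣ t + t' →
      (∑ a ∈ Finset.range N, (η a : A) * ξ ^ (t * a)) *
        ∑ a ∈ Finset.range N, (η a : A) * ξ ^ (t' * a) = (p : A) ^ f)
    (hJ1 : ∃ J, (p : A) ^ S1 * w ^ S1 = J * ∑ a ∈ Finset.range N, (η a : A) * ξ ^ (1 * a))
    (hJ2 : ∃ J, (p : A) ^ S2 * w ^ S2 = J * ∑ a ∈ Finset.range N, (η a : A) * ξ ^ ((N - 1) * a))
    (T : ℤ → ℤ) (hT1 : ∀ x, T (x + (p₁ * p₂ : ℕ)) = T x) (hT2 : ∀ x, T (p * x) = T x)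
    (hT : ∀ (e : ℤ → A) (_ : ∀ a b, e (a + b) = e a * e b)
        (_ : e N = 1) (_ : e (p₂ ^ n : ℕ) = 1 ∨ e (p₁ ^ (m-1) * p₂ ^ n : ℕ) ≠ 1)
        (_ : e (p₁ ^ m : ℕ) = 1 ∨ e (p₁ ^ m * p₂ ^ (n-1) : ℕ) ≠ 1),
        ∑ x ∈ Finset.range (p₁ * p₂), (T x : A) * e ((p₁ ^ (m-1) * p₂ ^ (n-1) : ℕ) * x)
          = ∑ a ∈ Finset.range N, (η a : A) * e a) :
    ∃ X1 X2 : ℤ, X1 ^ 2 = p ^ f ∧ X2 ^ 2 = p ^ f ∧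
      p₁ * (T 0 + (p₂ - 1) * T p₁) = (p₁ - 1) * X1 - 1 ∧
      p₂ * (T 0 + (p₁ - 1) * T p₂) = (p₂ - 1) * X2 - 1 ∧
      ∑ x ∈ Finset.range (p₁ * p₂), T x = -1 ∧
      (2 * (T 0 - T p₁ - T p₂) + T 1 + T (-1)) ^ 2 + p₁ * p₂ * (T 1 - T (-1)) ^ 2 = 4 * p ^ f ∧
      (p : ℤ) ^ e' ∣ 2 * (T 0 - T p₁ - T p₂) + T 1 + T (-1) ∧
      (p : ℤ) ^ e' ∣ T 1 - T (-1) := by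
  have hne : p₁ ≠ p₂ := by
    rintro rfl
    have := nd.cop
    rw [Nat.coprime_self] at this
    have := nd.one_lt1
    omega
  have hN0 : N ≠ 0 := by rw [hN]; exact (mul_pos (pow_pos hp₁.pos _) (pow_pos hp₂.pos _)).ne'
  have em : p₁ ^ m = p₁ ^ (m-1) * p₁ := by rw [← pow_succ]; congr 1; omega
  have en : p₂ ^ n = p₂ ^ (n-1) * p₂ := by rw [← pow_succ]; congr 1; omega
  set r := p₁ ^ (m-1) * p₂ ^ (n-1) with hr
  have hNr : N = r * (p₁ * p₂) := by rw [hN, em, en, hr]; ring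
  obtain ⟨ξ, rfl⟩ := hξ.isUnit hN0
  have hξ' : IsPrimitiveRoot ξ N := IsPrimitiveRoot.coe_units_iff.1 hξ
  have nd2 : ∀ k, ¬ N ∣ p₁ ^ k * p₂ ^ (n - 1) := fun k => by
    rw [hN]; exact nd_aux p₁ p₂ n hp₁ hp₂ hne hn _ k
  have nd1 : ∀ k, ¬ N ∣ p₂ ^ k * p₁ ^ (m - 1) := fun k => by
    rw [hN, mul_comm (p₁ ^ m)]; exact nd_aux p₂ p₁ m hp₂ hp₁ hne.symm hm _ k
  have chi1 := chi_eq_one ξ N hξ'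
  have cast1 : ∀ a b : ℕ, ((N : ℤ) ∣ (a : ℤ) * (b : ℤ)) ↔ N ∣ a * b := by
    intro a b; exact_mod_cast Iff.rfl
  have castn : ∀ a b : ℕ, ((N : ℤ) ∣ -(a : ℤ) * (b : ℤ)) ↔ N ∣ a * b := by
    intro a b; rw [neg_mul, dvd_neg]; exact cast1 a b
  -- sum of T
  have hTsum : ∑ x ∈ Finset.range (p₁ * p₂), T x = -1 := by
    have h1 := hT (fun _ => 1) (by simp) rfl (Or.inl rfl) (Or.inl rfl)
    have h2 := congrArg (Int.cast (R := A)) hsum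
    push_cast at h2
    simp only [mul_one] at h1
    rw [h2] at h1
    exact_mod_cast h1
  have hcop := Nat.isCoprime_iff_coprime.2 nd.copp
  push_cast at hcop
  have hcop1 : IsCoprime (p : ℤ) p₁ := hcop.of_mul_right_left
  have hcop2 : IsCoprime (p : ℤ) p₂ := hcop.of_mul_right_right
  -- X1
  obtain ⟨X1, hX1, hX1'⟩ := proj p p₁ p₂ nd.one_lt1 hp₂.pos T hT1 hT2 hcop2 nd.prim1 nd.prim2
  obtain ⟨X2, hX2, hX2'⟩ := proj p p₂ p₁ nd.one_lt2 hp₁.pos T (by rw [mul_comm p₂]; exact hT1) hT2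
    hcop1 nd.prim2 nd.prim1
  rw [mul_comm p₂ p₁] at hX2 hX2'
  rw [hTsum] at hX1 hX2
  have key1 : ∀ t : ℤ, (t = (p₂ ^ n : ℕ) ∨ t = -(p₂ ^ n : ℕ)) →
      ∑ a ∈ Finset.range N, (η a : A) * chi ξ t a = X1 := by
    intro t ht
    have hdv : ∀ b : ℕ, (N : ℤ) ∣ t * b ↔ N ∣ p₂ ^ n * b := by
      intro b
      rcases ht with rfl | rfl
      · exact cast1 _ _
      · exact castn _ _
    rw [← hT (chi ξ t) (chi_add ξ t)
      ((chi1 _ _).2 (dvd_mul_left _ _))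
      (Or.inr (by
        rw [Ne, chi1, hdv]
        have := nd1 (n + n)
        rwa [show p₂ ^ (n + n) * p₁ ^ (m - 1) = p₂ ^ n * (p₁ ^ (m - 1) * p₂ ^ n) by ring] at this))
      (Or.inl (by rw [chi1, hdv, hN, mul_comm]))]
    have := hX1' (fun x => chi ξ t (r * x)) (by intro a b; rw [mul_add, chi_add])
      (by
        have : ((r : ℤ) * (p₁ : ℤ)) = ((r * p₁ : ℕ) : ℤ) := by push_cast; rfl
        rw [chi1, this, hdv, hN, hr]
        exact ⟨p₂ ^ (n - 1), by rw [em]; ring⟩)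
      (by
        rw [Ne, mul_one, chi1, hdv, hr]
        have := nd1 (n + (n - 1))
        rwa [show p₂ ^ (n + (n - 1)) * p₁ ^ (m - 1) = p₂ ^ n * (p₁ ^ (m - 1) * p₂ ^ (n - 1)) by
          rw [pow_add]; ring] at this)
    exact this
  have key2 : ∀ t : ℤ, (t = (p₁ ^ m : ℕ) ∨ t = -(p₁ ^ m : ℕ)) →
      ∑ a ∈ Finset.range N, (η a : A) * chi ξ t a = X2 := by
    intro t ht
    have hdv : ∀ b : ℕ, (N : ℤ) ∣ t * b ↔ N ∣ p₁ ^ m * b := by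
      intro b
      rcases ht with rfl | rfl
      · exact cast1 _ _
      · exact castn _ _
    rw [← hT (chi ξ t) (chi_add ξ t)
      ((chi1 _ _).2 (dvd_mul_left _ _))
      (Or.inl (by rw [chi1, hdv, hN]))
      (Or.inr (by
        rw [Ne, chi1, hdv]
        have := nd2 (m + m)
        rwa [show p₁ ^ (m + m) * p₂ ^ (n - 1) = p₁ ^ m * (p₁ ^ m * p₂ ^ (n - 1)) by ring] at this))]
    have := hX2' (fun x => chi ξ t (r * x)) (by intro a b; rw [mul_add, chi_add])
      (by
        have : ((r : ℤ) * (p₂ : ℤ)) = ((r * p₂ : ℕ) : ℤ) := by push_cast; rfl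
        rw [chi1, this, hdv, hN, hr]
        exact ⟨p₁ ^ (m - 1), by rw [en]; ring⟩)
      (by
        rw [Ne, mul_one, chi1, hdv, hr]
        have := nd2 (m + (m - 1))
        rwa [show p₁ ^ (m + (m - 1)) * p₂ ^ (n - 1) = p₁ ^ m * (p₁ ^ (m - 1) * p₂ ^ (n - 1)) by
          rw [pow_add]; ring] at this)
    exact this
  have sq : ∀ (t : ℕ) (X : ℤ), ¬ N ∣ t → t ≤ N →
      (∀ s : ℤ, (s = (t : ℕ) ∨ s = -(t : ℕ)) →
        ∑ a ∈ Finset.range N, (η a : A) * chi ξ s a = X) → X ^ 2 = p ^ f := by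
    intro t X hnt htN hX
    have h1 := hGG t (N - t) hnt (by rw [Nat.add_sub_cancel' htN])
    have e1 : ∑ a ∈ Finset.range N, (η a : A) * (ξ : A) ^ (t * a) = X := by
      rw [← hX t (Or.inl rfl)]
      refine Finset.sum_congr rfl fun a _ => ?_
      rw [chi_nat]
    have e2 : ∑ a ∈ Finset.range N, (η a : A) * (ξ : A) ^ ((N - t) * a) = X := by
      rw [← hX (-t) (Or.inr rfl)]
      refine Finset.sum_congr rfl fun a _ => ?_
      rw [← chi_nat, chi_neg ξ N hξ' t ((N - t : ℕ) : ℤ) a (by push_cast [htN]; simp)]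
      unfold chi
      congr 3; ring
    rw [e1, e2] at h1
    have : ((X * X : ℤ) : A) = ((p ^ f : ℕ) : A) := by push_cast; exact h1
    have h2 : X * X = ((p ^ f : ℕ) : ℤ) := by exact_mod_cast this
    rw [sq, h2]; push_cast; rfl
  have hle1 : p₂ ^ n ≤ N := by rw [hN]; exact Nat.le_mul_of_pos_left _ (pow_pos hp₁.pos _)
  have hle2 : p₁ ^ m ≤ N := by rw [hN]; exact Nat.le_mul_of_pos_right _ (pow_pos hp₂.pos _)
  have hX1sq := sq (p₂ ^ n) X1 (by
    intro h; exact nd1 n (h.trans (dvd_mul_right _ _))) hle1 key1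
  have hX2sq := sq (p₁ ^ m) X2 (by
    intro h; exact nd2 m (h.trans (dvd_mul_right _ _))) hle2 key2
  -- the main characters
  have hrp1 : r * p₁ = p₁ ^ m * p₂ ^ (n - 1) := by rw [em, hr]; ring
  have hrp2 : r * p₂ = p₂ ^ n * p₁ ^ (m - 1) := by rw [en, hr]; ring
  obtain ⟨θ, θ', hθ1, hθ2, -, hθ⟩ := nd.corr (fun x => chi ξ 1 (r * x))
    (by intro a b; rw [mul_add, chi_add])
    (by rw [chi1, one_mul, hNr]; push_cast; exact dvd_rfl)
    (by
      have : ((r : ℤ) * (p₁ : ℤ)) = ((r * p₁ : ℕ) : ℤ) := by push_cast; rfl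
      rw [Ne, chi1, one_mul, this, hrp1]
      intro h; exact nd2 m (by exact_mod_cast h))
    (by
      have : ((r : ℤ) * (p₂ : ℤ)) = ((r * p₂ : ℕ) : ℤ) := by push_cast; rfl
      rw [Ne, chi1, one_mul, this, hrp2]
      intro h; exact nd1 n (by exact_mod_cast h))
  obtain ⟨hG, hG'⟩ := hθ T hT1 hT2
  set G : A := ∑ a ∈ Finset.range N, (η a : A) * (ξ : A) ^ (1 * a) with hGdef
  set G' : A := ∑ a ∈ Finset.range N, (η a : A) * (ξ : A) ^ ((N - 1) * a) with hG'def
  have hcond : ∀ t : ℤ, (t = 1 ∨ t = -1) →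
      ∑ x ∈ Finset.range (p₁ * p₂), (T x : A) * chi ξ t ((r : ℕ) * x)
          = ∑ a ∈ Finset.range N, (η a : A) * chi ξ t a := by
    intro t ht
    have hdv : ∀ b : ℕ, (N : ℤ) ∣ t * b ↔ N ∣ b := by
      intro b
      rcases ht with rfl | rfl
      · rw [one_mul]; exact_mod_cast Iff.rfl
      · rw [neg_one_mul, dvd_neg]; exact_mod_cast Iff.rfl
    refine hT (chi ξ t) (chi_add ξ t) ((chi1 _ _).2 (dvd_mul_left _ _)) (Or.inr ?_) (Or.inr ?_)
    · rw [Ne, chi1, hdv, mul_comm]; exact nd1 n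
    · rw [Ne, chi1, hdv]; exact nd2 m
  have hGe : G = T 0 - T p₁ - T p₂ + T 1 * θ + T (-1) * θ' := by
    rw [← hG, hcond 1 (Or.inl rfl), hGdef]
    refine Finset.sum_congr rfl fun a _ => ?_
    rw [← chi_nat]; rfl
  have hNpos : 1 ≤ N := Nat.one_le_iff_ne_zero.2 hN0
  have hGe' : G' = T 0 - T p₁ - T p₂ + T 1 * θ' + T (-1) * θ := by
    rw [← hG']
    have e1 : ∀ x ∈ Finset.range (p₁ * p₂), (T x : A) * chi ξ 1 (r * -(x : ℤ))
        = (T x : A) * chi ξ (-1) ((r : ℕ) * x) := by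
      intro x _; unfold chi; congr 3; ring
    rw [Finset.sum_congr rfl e1, hcond (-1) (Or.inr rfl), hG'def]
    refine Finset.sum_congr rfl fun a _ => ?_
    rw [← chi_nat, chi_neg ξ N hξ' 1 ((N - 1 : ℕ) : ℤ) a (by push_cast [hNpos]; simp)]
    unfold chi
    congr 3; ring
  have hNnot : ¬ N ∣ 1 := fun h => nd2 0 (h.trans (one_dvd _))
  have hGG' := hGG 1 (N - 1) hNnot (by rw [Nat.add_sub_cancel' hNpos])
  change G * G' = _ at hGG'
  have hpA : (p : A) ≠ 0 := by exact_mod_cast hp.ne_zero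
  obtain ⟨J1, hJ1⟩ := hJ1
  obtain ⟨J2, hJ2⟩ := hJ2
  have hd1 : (p : A) ^ e' ∣ w ^ f * G' := by
    have : w ^ S1 * G' = J1 * (p : A) ^ S2 := by
      apply mul_left_cancel₀ (pow_ne_zero S1 hpA)
      have e3 : (p : A) ^ f = (p : A) ^ S1 * (p : A) ^ S2 := by rw [← pow_add, hS]
      linear_combination G' * hJ1 + J1 * hGG' + J1 * e3
    refine ((pow_dvd_pow _ hS2).trans (Dvd.intro_left J1 this.symm)).trans ?_
    exact mul_dvd_mul_right (pow_dvd_pow _ (by omega)) _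
  have hd2 : (p : A) ^ e' ∣ w ^ f * G := by
    have : w ^ S2 * G = J2 * (p : A) ^ S1 := by
      apply mul_left_cancel₀ (pow_ne_zero S2 hpA)
      have e3 : (p : A) ^ f = (p : A) ^ S1 * (p : A) ^ S2 := by rw [← pow_add, hS]
      linear_combination G * hJ2 + J2 * hGG' + J2 * e3
    refine ((pow_dvd_pow _ hS1).trans (Dvd.intro_left J2 this.symm)).trans ?_
    exact mul_dvd_mul_right (pow_dvd_pow _ (by omega)) _
  have hwf : red (w ^ f) ≠ 0 := by rw [map_pow]; exact pow_ne_zero _ hw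
  have hD0 : (p₁ : A) * p₂ + 1 = 4 * (p : A) ^ h := by exact_mod_cast nd.D0
  have hdisc : (θ - θ') ^ 2 = -((p₁ : A) * p₂) := by
    linear_combination (θ + θ' + 1) * hθ1 - 4 * hθ2 + hD0
  refine ⟨X1, X2, hX1sq, hX2sq, by linear_combination hX1, by linear_combination hX2, hTsum,
    ?_, ?_, ?_⟩
  · have : (((2 * (T 0 - T p₁ - T p₂) + T 1 + T (-1)) ^ 2 + p₁ * p₂ * (T 1 - T (-1)) ^ 2 : ℤ) : A)
        = ((4 * p ^ f : ℤ) : A) := by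
      push_cast
      have e1 : G + G' = 2 * (T 0 - T p₁ - T p₂) + T 1 + T (-1) := by
        rw [hGe, hGe']; linear_combination ((T 1 : A) + T (-1)) * hθ1
      have e2 : G - G' = (T 1 - T (-1)) * (θ - θ') := by rw [hGe, hGe']; ring
      rw [← e1]
      linear_combination 4 * hGG' + ((T 1 : A) - T (-1)) ^ 2 * hdisc
        + (G - G' + (T 1 - T (-1)) * (θ - θ')) * e2
    exact_mod_cast this
  · apply pdvd_of_unit p hp.ne_zero red (w ^ f) hwf e'
    have e1 : w ^ f * ((2 * (T 0 - T p₁ - T p₂) + T 1 + T (-1) : ℤ) : A) = w ^ f * G + w ^ f * G' := by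
      push_cast
      rw [hGe, hGe']; linear_combination (-w ^ f * ((T 1 : A) + T (-1))) * hθ1
    rw [e1]
    exact dvd_add hd2 hd1
  · have e0 : (p : ℤ) ^ e' ∣ (p₁ * p₂ : ℤ) * (T 1 - T (-1)) := by
      apply pdvd_of_unit p hp.ne_zero red (w ^ f) hwf e'
      have e1 : w ^ f * (((p₁ * p₂ : ℤ) * (T 1 - T (-1)) : ℤ) : A) =
          (w ^ f * G' - w ^ f * G) * (θ - θ') := by
        push_cast
        rw [hGe, hGe']
        linear_combination (w ^ f * ((T 1 : A) - T (-1))) * hdisc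
      rw [e1]
      exact (dvd_sub hd1 hd2).mul_right _
    exact (IsCoprime.pow_left hcop).dvd_of_dvd_mul_left e0

end core


section core2

theorem NumData.dec {p p₁ p₂ h f0 : ℕ} {H : Finset ℕ} (nd : NumData p p₁ p₂ h f0 H)
    (V : ℤ → ℤ) (hper : ∀ x, V (x + (p₁ * p₂ : ℕ)) = V x) (hV : ∀ x, V (p * x) = V x)
    (x : ℕ) (hx : x < p₁ * p₂) :
    (V x = (V 0 - V p₁ - V p₂) * (if x = 0 then 1 else 0) + V p₁ * (if p₁ ∣ x then 1 else 0)
        + V p₂ * (if p₂ ∣ x then 1 else 0)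
        + V 1 * indH (p₁ * p₂) H x + V (-1) * indH (p₁ * p₂) H (-(x : ℤ))) ∧
      (V x = V 0 ∨ V x = V p₁ ∨ V x = V p₂ ∨ V x = V 1 ∨ V x = V (-1)) := by
  have hpos' : 0 < p₁ * p₂ := by omega
  have hind1 : ∀ x : ℤ, indH (p₁ * p₂) H x = 1 → V x = V 1 ∧ V (-x) = V (-1) := by
    intro x hx
    unfold indH at hx
    split_ifs at hx with h
    · obtain ⟨j, hj⟩ := nd.Hp _ h
      have h1 : x ≡ (p : ℤ) ^ j [ZMOD (p₁ * p₂ : ℕ)] := by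
        have hpos : ((p₁ * p₂ : ℕ) : ℤ) ≠ 0 := by exact_mod_cast hpos'.ne'
        have e1 := Int.emod_nonneg x hpos
        have e2 : ((p ^ j % (p₁ * p₂) : ℕ) : ℤ) = x % (p₁ * p₂ : ℕ) := by
          rw [hj, Int.toNat_of_nonneg e1]
        unfold Int.ModEq
        rw [← e2]; push_cast; rfl
      constructor
      · rw [per_congr _ V hper h1, ← V_pow p V hV j 1, mul_one]
      · rw [per_congr _ V hper h1.neg, ← V_pow p V hV j (-1)]; congr 1; ring
    · exact absurd hx (by norm_num)
  by_cases hx1 : p₁ ∣ x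
  · rw [(nd.H1 x hx (Or.inl hx1)).1, (nd.H1 x hx (Or.inl hx1)).2]
    by_cases hx0 : x = 0
    · subst hx0; simp; ring
    · have hx2 : ¬ p₂ ∣ x := by
        intro h
        have := Nat.le_of_dvd (by omega) (nd.cop.mul_dvd_of_dvd_of_dvd hx1 h)
        omega
      obtain ⟨y, rfl⟩ := hx1
      rw [if_neg hx0, if_pos (dvd_mul_right _ _), if_neg hx2]
      push_cast
      rw [V_line p p₁ p₂ V hper hV nd.prim2 y (Nat.lt_of_mul_lt_mul_left hx)
        (by rintro rfl; simp at hx0)]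
      constructor
      · ring
      · simp
  · by_cases hx2 : p₂ ∣ x
    · rw [(nd.H1 x hx (Or.inr hx2)).1, (nd.H1 x hx (Or.inr hx2)).2]
      have hx0 : x ≠ 0 := by rintro rfl; simp at hx1
      obtain ⟨y, rfl⟩ := hx2
      rw [if_neg hx0, if_neg hx1, if_pos (dvd_mul_right _ _)]
      push_cast
      rw [V_line p p₂ p₁ V (by rw [mul_comm p₂]; exact hper) hV nd.prim1 y
        (by rw [mul_comm p₁] at hx; exact Nat.lt_of_mul_lt_mul_left hx)
        (by rintro rfl; simp at hx0)]
      constructor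
      · ring
      · simp
    · have hx0 : x ≠ 0 := by rintro rfl; simp at hx1
      rw [if_neg hx0, if_neg hx1, if_neg hx2]
      rcases nd.H2 x hx hx1 hx2 with ⟨h1, h2⟩ | ⟨h1, h2⟩
      · rw [h1, h2, (hind1 x h1).1]
        constructor
        · ring
        · simp
      · rw [h1, h2]
        have := (hind1 _ h2).2
        rw [neg_neg] at this
        rw [this]
        constructor
        · ring
        · simp

theorem NumData.sum_five {p p₁ p₂ h f0 : ℕ} {H : Finset ℕ} (nd : NumData p p₁ p₂ h f0 H)
    (V : ℤ → ℤ) (hper : ∀ x, V (x + (p₁ * p₂ : ℕ)) = V x) (hV : ∀ x, V (p * x) = V x) :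
    ∑ x ∈ Finset.range (p₁ * p₂), V x =
      V 0 + (p₂ - 1) * V p₁ + (p₁ - 1) * V p₂ + f0 * (V 1 + V (-1)) := by
  have hpos : 0 < p₁ * p₂ := by
    have := nd.one_lt1; have := nd.one_lt2; positivity
  rw [Finset.sum_congr rfl fun x hx => (nd.dec V hper hV x (Finset.mem_range.1 hx)).1]
  simp only [Finset.sum_add_distrib, ← Finset.mul_sum]
  rw [nd.cnt1, nd.cnt2, nd.cnt3, nd.cnt4, Finset.sum_ite_eq' (Finset.range (p₁ * p₂)) 0,
    if_pos (Finset.mem_range.2 hpos)]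
  ring

theorem NumData.mem_five {p p₁ p₂ h f0 : ℕ} {H : Finset ℕ} (nd : NumData p p₁ p₂ h f0 H)
    (V : ℤ → ℤ) (hper : ∀ x, V (x + (p₁ * p₂ : ℕ)) = V x) (hV : ∀ x, V (p * x) = V x) (x : ℤ) :
    V x = V 0 ∨ V x = V p₁ ∨ V x = V p₂ ∨ V x = V 1 ∨ V x = V (-1) := by
  have hpos : (0 : ℤ) < ((p₁ * p₂ : ℕ) : ℤ) := by
    have := nd.one_lt1; have := nd.one_lt2
    have : 0 < p₁ * p₂ := by positivity
    exact_mod_cast this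
  have e1 := Int.emod_nonneg x hpos.ne'
  have e2 := Int.emod_lt_of_pos x hpos
  obtain ⟨y, hy⟩ := Int.eq_ofNat_of_zero_le e1
  have hy' : x ≡ (y : ℤ) [ZMOD (p₁ * p₂ : ℕ)] := by rw [← hy]; exact (Int.mod_modEq _ _).symm
  rw [per_congr _ V hper hy']
  exact (nd.dec V hper hV y (by rw [hy] at e2; exact_mod_cast e2)).2

theorem pow_sums {p p₁ p₂ h f0 : ℕ} {H : Finset ℕ} (nd : NumData p p₁ p₂ h f0 H)
    (N r f e' : ℕ) (hNr : N = p₁ * p₂ * r) (hr : 0 < r) (hf : f = f0 * r) (hfe : f = h + 2 * e')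
    (hN1 : 1 < N) (hcopN : p.Coprime N)
    (hord : orderOf (p : ZMod N) = f) :
    (∀ u : ℕ, u % (p₁ * p₂) = 1 → ∃ j, p ^ j % N = u % N) ∧
    ∃ S1 S2, S1 + S2 = f ∧ e' ≤ S1 ∧ e' ≤ S2 ∧ ∑ j ∈ Finset.range f, (p ^ j * 1 % N) = N * S1 ∧
      ∑ j ∈ Finset.range f, (p ^ j * (N - 1) % N) = N * S2 := by
  have hpos : 0 < p₁ * p₂ := by
    have := nd.one_lt1; have := nd.one_lt2; positivity
  have hbig : 1 < p₁ * p₂ := by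
    have := nd.one_lt1; have := nd.one_lt2; nlinarith
  obtain ⟨h1, h2⟩ := pow_set p N f (p₁ * p₂) r f0 H hNr hpos hr hf hord nd.card nd.sub nd.hpow
  constructor
  · intro u hu
    apply h1
    have := nd.hpow 0
    rwa [pow_zero, Nat.mod_eq_of_lt hbig, ← hu] at this
  set Sg := ∑ j ∈ Finset.range f, p ^ j % N with hsg
  have hmain : Sg = N * e' ∨ Sg = N * (e' + h) := by
    rcases nd.sumH with h3 | h3
    · left
      have h4 : (2 : ℤ) * Sg + (p₁ * p₂) * f0 * r = 2 * r * (∑ u ∈ H, u : ℕ) + p₁ * p₂ * f0 * (r * r) := by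
        exact_mod_cast h2
      have h5 : (2 : ℤ) * (∑ u ∈ H, u : ℕ) + p₁ * p₂ * h = p₁ * p₂ * f0 := by exact_mod_cast h3
      have h6 : (f0 : ℤ) * r = h + 2 * e' := by rw [hf] at hfe; exact_mod_cast hfe
      have h7 : (2 : ℤ) * Sg = 2 * ((p₁ * p₂ * r) * e') := by
        linear_combination h4 + r * h5 + p₁ * p₂ * r * h6
      rw [hNr]
      have h8 : (Sg : ℤ) = (p₁ * p₂ * r) * e' := by linarith
      exact_mod_cast h8
    · right
      have h4 : (2 : ℤ) * Sg + (p₁ * p₂) * f0 * r = 2 * r * (∑ u ∈ H, u : ℕ) + p₁ * p₂ * f0 * (r * r) := by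
        exact_mod_cast h2
      have h5 : (2 : ℤ) * (∑ u ∈ H, u : ℕ) = p₁ * p₂ * (f0 + h) := by exact_mod_cast h3
      have h6 : (f0 : ℤ) * r = h + 2 * e' := by rw [hf] at hfe; exact_mod_cast hfe
      have h7 : (2 : ℤ) * Sg = 2 * ((p₁ * p₂ * r) * (e' + h)) := by
        linear_combination h4 + r * h5 + p₁ * p₂ * r * h6
      rw [hNr]
      have h8 : (Sg : ℤ) = (p₁ * p₂ * r) * (e' + h) := by linarith
      exact_mod_cast h8
  have hneg : Sg + ∑ j ∈ Finset.range f, (p ^ j * (N - 1) % N) = N * f := by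
    rw [hsg, ← Finset.sum_add_distrib]
    have : ∀ j ∈ Finset.range f, p ^ j % N + p ^ j * (N - 1) % N = N := by
      intro j _
      have hd : N ∣ p ^ j % N + p ^ j * (N - 1) % N := by
        rw [Nat.dvd_iff_mod_eq_zero, ← Nat.add_mod]
        have : p ^ j + p ^ j * (N - 1) = N * p ^ j := by
          obtain ⟨N', rfl⟩ : ∃ N', N = N' + 1 := ⟨N - 1, by omega⟩
          simp; ring
        rw [this, Nat.mul_mod_right]
      have l1 := Nat.mod_lt (p ^ j) (show 0 < N by omega)
      have l2 := Nat.mod_lt (p ^ j * (N - 1)) (show 0 < N by omega)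
      have l3 : p ^ j % N ≠ 0 := by
        intro h0
        have hd1 : N ∣ p ^ j := Nat.dvd_of_mod_eq_zero h0
        have := (hcopN.pow_left j).symm.eq_one_of_dvd hd1
        omega
      obtain ⟨k, hk⟩ := hd
      have hk1 : k = 1 := by
        have : k < 2 := by
          by_contra hk2
          have := Nat.mul_le_mul_left N (not_lt.1 hk2)
          omega
        have : k ≠ 0 := by rintro rfl; simp at hk; omega
        omega
      rw [hk, hk1, mul_one]
    rw [Finset.sum_congr rfl this, Finset.sum_const, Finset.card_range, smul_eq_mul, mul_comm]
  simp only [mul_one]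
  rcases hmain with hm | hm
  · refine ⟨e', e' + h, by omega, le_rfl, by omega, hm, ?_⟩
    have e9 : N * f = N * e' + N * (e' + h) := by rw [hfe]; ring
    rw [hm, e9] at hneg
    exact Nat.add_left_cancel hneg
  · refine ⟨e' + h, e', by omega, by omega, le_rfl, hm, ?_⟩
    have e9 : N * f = N * (e' + h) + N * e' := by rw [hfe]; ring
    rw [hm, e9] at hneg
    exact Nat.add_left_cancel hneg

end core2


section solve

theorem solve_gen (P Q D0 X1 X2 a b a' b' : ℤ) (hD : D0 + 1 = 4 * P ^ 2) (hP : 1 < P) (hQ : 0 < Q)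
    (h1 : X1 ^ 2 = (P * Q) ^ 2) (h2 : X2 ^ 2 = (P * Q) ^ 2) (h3 : a ^ 2 + D0 * b ^ 2 = 4 * (P * Q) ^ 2)
    (ha : a = Q * a') (hb : b = Q * b') :
    (X1 = P * Q ∨ X1 = -(P * Q)) ∧ (X2 = P * Q ∨ X2 = -(P * Q)) ∧
    ((b = 0 ∧ (a = 2 * (P * Q) ∨ a = -(2 * (P * Q)))) ∨
      ((b = Q ∨ b = -Q) ∧ (a = Q ∨ a = -Q))) := by
  refine ⟨sq_eq_sq_iff_eq_or_eq_neg.1 h1, sq_eq_sq_iff_eq_or_eq_neg.1 h2, ?_⟩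
  have h4 : a' ^ 2 + D0 * b' ^ 2 = 4 * P ^ 2 := by
    have : Q ^ 2 * (a' ^ 2 + D0 * b' ^ 2) = Q ^ 2 * (4 * P ^ 2) := by
      rw [ha, hb] at h3; linear_combination h3
    exact mul_left_cancel₀ (by positivity) this
  have hD3 : 3 < D0 := by nlinarith
  have hb4 : b' ^ 2 < 4 := by
    by_contra hc
    have := mul_le_mul_of_nonneg_left (not_lt.1 hc) (show 0 ≤ D0 by omega)
    nlinarith [sq_nonneg a']
  have hb1 : b' < 2 := by nlinarith
  have hb2 : -2 < b' := by nlinarith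
  have : b' = 0 ∨ b' = 1 ∨ b' = -1 := by omega
  rcases this with rfl | rfl | rfl
  · left
    refine ⟨by rw [hb]; ring, ?_⟩
    have : a' ^ 2 = (2 * P) ^ 2 := by linear_combination h4
    rcases sq_eq_sq_iff_eq_or_eq_neg.1 this with rfl | rfl
    · left; rw [ha]; ring
    · right; rw [ha]; ring
  · right
    have : a' ^ 2 = 1 ^ 2 := by linear_combination h4 - hD
    rcases sq_eq_sq_iff_eq_or_eq_neg.1 this with rfl | rfl
    · exact ⟨Or.inl (by rw [hb]; ring), Or.inl (by rw [ha]; ring)⟩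
    · exact ⟨Or.inl (by rw [hb]; ring), Or.inr (by rw [ha]; ring)⟩
  · right
    have : a' ^ 2 = 1 ^ 2 := by linear_combination h4 - hD
    rcases sq_eq_sq_iff_eq_or_eq_neg.1 this with rfl | rfl
    · exact ⟨Or.inr (by rw [hb]; ring), Or.inl (by rw [ha]; ring)⟩
    · exact ⟨Or.inr (by rw [hb]; ring), Or.inr (by rw [ha]; ring)⟩

theorem solve1 (s00 s01 s10 sp sm X1 X2 Q k : ℤ)
    (I1 : 5 * (s00 + (3 - 1) * s01) = (5 - 1) * X1 - 1)
    (I2 : 3 * (s00 + (5 - 1) * s10) = (3 - 1) * X2 - 1)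
    (I3 : s00 + (3 - 1) * s01 + (5 - 1) * s10 + 4 * (sp + sm) = -1)
    (hQ : 1 * Q = 2 + 15 * k)
    (h : (X1 = 2 * Q ∨ X1 = -(2 * Q)) ∧ (X2 = 2 * Q ∨ X2 = -(2 * Q)) ∧
      ((sp - sm = 0 ∧ (2 * (s00 - s01 - s10) + sp + sm = 2 * (2 * Q) ∨
        2 * (s00 - s01 - s10) + sp + sm = -(2 * (2 * Q)))) ∨
      ((sp - sm = Q ∨ sp - sm = -Q) ∧ (2 * (s00 - s01 - s10) + sp + sm = Q ∨
        2 * (s00 - s01 - s10) + sp + sm = -Q)))) :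
    (s00 = sp ∨ s00 = sm) ∧ (s01 = sp ∨ s01 = sm) ∧ (s10 = sp ∨ s10 = sm) := by
  obtain ⟨rfl | rfl, rfl | rfl, ⟨h1, h2 | h2⟩ | ⟨h1 | h1, h2 | h2⟩⟩ := h <;> omega

theorem solve2 (s00 s01 s10 sp sm X1 X2 Q k : ℤ)
    (I1 : 5 * (s00 + (7 - 1) * s01) = (5 - 1) * X1 - 1)
    (I2 : 7 * (s00 + (5 - 1) * s10) = (7 - 1) * X2 - 1)
    (I3 : s00 + (7 - 1) * s01 + (5 - 1) * s10 + 12 * (sp + sm) = -1)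
    (hQ : -1 * Q = 2 + 35 * k)
    (h : (X1 = 3 * Q ∨ X1 = -(3 * Q)) ∧ (X2 = 3 * Q ∨ X2 = -(3 * Q)) ∧
      ((sp - sm = 0 ∧ (2 * (s00 - s01 - s10) + sp + sm = 2 * (3 * Q) ∨
        2 * (s00 - s01 - s10) + sp + sm = -(2 * (3 * Q)))) ∨
      ((sp - sm = Q ∨ sp - sm = -Q) ∧ (2 * (s00 - s01 - s10) + sp + sm = Q ∨
        2 * (s00 - s01 - s10) + sp + sm = -Q)))) :
    (s00 = sp ∨ s00 = sm) ∧ (s01 = sp ∨ s01 = sm) ∧ (s10 = sp ∨ s10 = sm) := by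
  obtain ⟨rfl | rfl, rfl | rfl, ⟨h1, h2 | h2⟩ | ⟨h1 | h1, h2 | h2⟩⟩ := h <;> omega

theorem solve3 (s00 s01 s10 sp sm X1 X2 Q k : ℤ)
    (I1 : 17 * (s00 + (19 - 1) * s01) = (17 - 1) * X1 - 1)
    (I2 : 19 * (s00 + (17 - 1) * s10) = (19 - 1) * X2 - 1)
    (I3 : s00 + (19 - 1) * s01 + (17 - 1) * s10 + 144 * (sp + sm) = -1)
    (hQ : -1 * Q = 2 + 323 * k)
    (h : (X1 = 9 * Q ∨ X1 = -(9 * Q)) ∧ (X2 = 9 * Q ∨ X2 = -(9 * Q)) ∧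
      ((sp - sm = 0 ∧ (2 * (s00 - s01 - s10) + sp + sm = 2 * (9 * Q) ∨
        2 * (s00 - s01 - s10) + sp + sm = -(2 * (9 * Q)))) ∨
      ((sp - sm = Q ∨ sp - sm = -Q) ∧ (2 * (s00 - s01 - s10) + sp + sm = Q ∨
        2 * (s00 - s01 - s10) + sp + sm = -Q)))) :
    (s00 = sp ∨ s00 = sm) ∧ (s01 = sp ∨ s01 = sm) ∧ (s10 = sp ∨ s10 = sm) := by
  obtain ⟨rfl | rfl, rfl | rfl, ⟨h1, h2 | h2⟩ | ⟨h1 | h1, h2 | h2⟩⟩ := h <;> omega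

end solve


section assemble

theorem idx_inj (a b i i' j j' A B : ℕ) (hcop : Nat.Coprime A B) (hi : i < a) (hi' : i' < a)
    (hj : j < b) (hj' : j' < b) (ha : a ≤ A) (hb : b ≤ B)
    (h : ((A * B : ℕ) : ℤ) ∣ ((B * i + A * j : ℕ) : ℤ) - ((B * i' + A * j' : ℕ) : ℤ)) :
    i = i' ∧ j = j' := by
  have hc : IsCoprime (A : ℤ) (B : ℤ) := Nat.isCoprime_iff_coprime.2 hcop
  push_cast at h
  have h1 : (A : ℤ) ∣ (i : ℤ) - i' := by
    have : (A : ℤ) ∣ (B : ℤ) * ((i : ℤ) - i') := by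
      have h2 := (dvd_mul_right (A : ℤ) B).trans h
      have h3 : (B : ℤ) * (i - i') = (B * i + A * j - (B * i' + A * j')) - A * (j - j') := by ring
      rw [h3]
      exact dvd_sub h2 (dvd_mul_right _ _)
    exact hc.dvd_of_dvd_mul_left this
  have h2 : (B : ℤ) ∣ (j : ℤ) - j' := by
    have : (B : ℤ) ∣ (A : ℤ) * ((j : ℤ) - j') := by
      have h2 := (dvd_mul_left (B : ℤ) A).trans h
      have h3 : (A : ℤ) * (j - j') = (B * i + A * j - (B * i' + A * j')) - B * (i - i') := by ring
      rw [h3]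
      exact dvd_sub h2 (dvd_mul_right _ _)
    exact hc.symm.dvd_of_dvd_mul_left this
  have h3 := Int.eq_zero_of_abs_lt_dvd h1 (by rw [abs_lt]; constructor <;> omega)
  have h4 := Int.eq_zero_of_abs_lt_dvd h2 (by rw [abs_lt]; constructor <;> omega)
  omega

theorem main_case {p p₁ p₂ h f0 : ℕ} {H : Finset ℕ} (nd : NumData p p₁ p₂ h f0 H)
    (hf0 : 2 ≤ f0) (hp23 : p = 2 ∨ p = 3) (hp : p.Prime) (hp₁ : p₁.Prime) (hp₂ : p₂.Prime)
    (hodd1 : Odd p₁) (hodd2 : Odd p₂) (m n N : ℕ)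
    (hm : 1 ≤ m) (hn : 1 ≤ n) (hN : N = p₁ ^ m * p₂ ^ n)
    (f : ℕ) (hf : f = orderOf ((p : ZMod N))) (hford : 2 * f = Nat.totient N)
    (F : Type*) [Field F] [Fintype F] (hcard : Fintype.card F = p ^ f)
    (γ : Fˣ) (hγ : ∀ x : Fˣ, x ∈ Subgroup.zpowers γ)
    (D : Set F)
    (hD : D = ⋃ i < p₁ ^ (m - 1), ⋃ j < p₂ ^ (n - 1),
      cycClass γ N (p₂ ^ n * i + p₁ ^ m * j))
    (e e' : ℕ) (he : 1 ≤ e) (heven : h = 2 * e) (hfe : f = h + 2 * e')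
    (hsolve : ∀ s00 s01 s10 sp sm X1 X2 : ℤ,
      p₁ * (s00 + (p₂ - 1) * s01) = (p₁ - 1) * X1 - 1 →
      p₂ * (s00 + (p₁ - 1) * s10) = (p₂ - 1) * X2 - 1 →
      s00 + (p₂ - 1) * s01 + (p₁ - 1) * s10 + f0 * (sp + sm) = -1 →
      ((X1 = (p : ℤ) ^ e * p ^ e' ∨ X1 = -((p : ℤ) ^ e * p ^ e')) ∧
        (X2 = (p : ℤ) ^ e * p ^ e' ∨ X2 = -((p : ℤ) ^ e * p ^ e')) ∧
      ((sp - sm = 0 ∧ (2 * (s00 - s01 - s10) + sp + sm = 2 * ((p : ℤ) ^ e * p ^ e') ∨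
        2 * (s00 - s01 - s10) + sp + sm = -(2 * ((p : ℤ) ^ e * p ^ e')))) ∨
      ((sp - sm = (p : ℤ) ^ e' ∨ sp - sm = -(p : ℤ) ^ e') ∧
        (2 * (s00 - s01 - s10) + sp + sm = (p : ℤ) ^ e' ∨
        2 * (s00 - s01 - s10) + sp + sm = -(p : ℤ) ^ e')))) →
      (s00 = sp ∨ s00 = sm) ∧ (s01 = sp ∨ s01 = sm) ∧ (s10 = sp ∨ s10 = sm)) :
    (0 : F) ∉ D ∧ -D = D ∧
      ∃ k lam mu : ℕ, (cayley D).IsSRGWith (Fintype.card F) k lam mu := by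
  have hpf : Fact p.Prime := ⟨hp⟩
  have hne : p₁ ≠ p₂ := by
    rintro rfl
    have := nd.cop
    rw [Nat.coprime_self] at this
    have := nd.one_lt1
    omega
  have em : p₁ ^ m = p₁ ^ (m-1) * p₁ := by rw [← pow_succ]; congr 1; omega
  have en : p₂ ^ n = p₂ ^ (n-1) * p₂ := by rw [← pow_succ]; congr 1; omega
  have hr : 0 < p₁ ^ (m-1) * p₂ ^ (n-1) := mul_pos (pow_pos hp₁.pos _) (pow_pos hp₂.pos _)
  have hNr : N = p₁ * p₂ * (p₁ ^ (m-1) * p₂ ^ (n-1)) := by rw [hN, em, en]; ring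
  have hcopAB : Nat.Coprime (p₁ ^ m) (p₂ ^ n) := Nat.Coprime.pow _ _ nd.cop
  have hcopp1 : p.Coprime p₁ := nd.copp.coprime_dvd_right (dvd_mul_right _ _)
  have hcopp2 : p.Coprime p₂ := nd.copp.coprime_dvd_right (dvd_mul_left _ _)
  have hcopN : p.Coprime N := by
    rw [hN]; exact Nat.Coprime.mul_right (hcopp1.pow_right _) (hcopp2.pow_right _)
  have hff : f = f0 * (p₁ ^ (m-1) * p₂ ^ (n-1)) := by
    have h1 : 2 * f = 2 * (f0 * (p₁ ^ (m-1) * p₂ ^ (n-1))) := by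
      rw [hford, hN, Nat.totient_mul hcopAB, Nat.totient_prime_pow hp₁ (by omega),
        Nat.totient_prime_pow hp₂ (by omega), ← mul_assoc 2 f0, nd.f0eq]
      ring
    omega
  have hf2 : 2 ≤ f := by
    rw [hff]; exact hf0.trans (Nat.le_mul_of_pos_right _ hr)
  have hNodd : Odd N := by rw [hN]; exact (hodd1.pow).mul (hodd2.pow)
  have hN1 : 1 < N := by
    have h1 : p₁ * 1 ≤ p₁ * p₂ := Nat.mul_le_mul_left _ hp₂.one_le
    have h2 : p₁ * p₂ * 1 ≤ N := by rw [hNr]; exact Nat.mul_le_mul_left _ hr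
    have := hp₁.one_lt
    omega
  have hpfpos : 1 < p ^ f := Nat.one_lt_pow (by omega) hp.one_lt
  obtain ⟨M, hNM⟩ : N ∣ p ^ f - 1 := by
    have h1 : ((p : ZMod N)) ^ f = 1 := by rw [hf]; exact pow_orderOf_eq_one _
    have h2 : ((p ^ f : ℕ) : ZMod N) = ((1 : ℕ) : ZMod N) := by push_cast; exact h1
    exact (Nat.modEq_iff_dvd' hpfpos.le).1 ((ZMod.natCast_eq_natCast_iff _ _ _).1 h2).symm
  have hM : 0 < M := by
    rcases Nat.eq_zero_or_pos M with rfl | h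
    · rw [mul_zero] at hNM; omega
    · exact h
  have hcardU : Fintype.card Fˣ = N * M := by
    rw [Fintype.card_units, hcard, hNM]
  have hroot := mem_root_iff γ hγ N M hM hcardU
  -- easy parts
  have memD : ∀ x : F, x ∈ D ↔ ∃ i < p₁ ^ (m - 1), ∃ j < p₂ ^ (n - 1), ∃ k : ℤ,
      x = ((γ ^ (((p₂ ^ n * i + p₁ ^ m * j : ℕ) : ℤ) + (N : ℤ) * k) : Fˣ) : F) := by
    intro x
    rw [hD]
    simp only [Set.mem_iUnion, cycClass, Set.mem_setOf_eq, exists_prop]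
  have h0 : (0 : F) ∉ D := by
    intro h
    obtain ⟨i, _, j, _, k, hk⟩ := (memD 0).1 h
    exact Units.ne_zero _ hk.symm
  obtain ⟨j0, hj0⟩ := Subgroup.mem_zpowers_iff.1 (hγ (-1))
  have hj0N : (N : ℤ) ∣ j0 := by
    have h1 : (γ ^ (2 * j0)) ^ M = 1 := by
      rw [mul_comm, zpow_mul, hj0]
      norm_num
    have h2 := (hroot _).1 h1
    have hc : IsCoprime (N : ℤ) 2 := by
      have : Nat.Coprime N 2 := Nat.coprime_two_right.2 hNodd
      exact_mod_cast Nat.isCoprime_iff_coprime.2 this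
    exact hc.dvd_of_dvd_mul_left h2
  have hneg1 : ∀ x ∈ D, -x ∈ D := by
    intro x hx
    obtain ⟨i, hi, j, hj, k, hk⟩ := (memD x).1 hx
    obtain ⟨k0, hk0⟩ := hj0N
    refine (memD _).2 ⟨i, hi, j, hj, k + k0, ?_⟩
    have : (((p₂ ^ n * i + p₁ ^ m * j : ℕ) : ℤ) + (N : ℤ) * (k + k0)) =
      (((p₂ ^ n * i + p₁ ^ m * j : ℕ) : ℤ) + (N : ℤ) * k) + j0 := by rw [hk0]; ring
    rw [this, zpow_add, hj0, hk]
    simp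
  have hneg : -D = D := by
    ext x
    rw [Set.mem_neg]
    constructor
    · intro h; simpa using hneg1 _ h
    · exact hneg1 x
  refine ⟨h0, hneg, ?_⟩
  obtain ⟨hu, S1, S2, hS, hS1, hS2, hs1, hs2⟩ :=
    pow_sums nd N (p₁ ^ (m-1) * p₂ ^ (n-1)) f e' hNr hr hff hfe hN1 hcopN hf.symm
  obtain ⟨A, k, _, _, _, _, _, _, red, ψ, ξ, w, η, hψ, hξ, hw, hηψ, hηN, hηp, hηsum, hGG, hJ⟩ :=
    gauss_data p f hp23 F hcard hf2 γ hγ N M hN1 hNodd hNM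
  have hmul : ∀ u a : ℤ, u ≡ 1 [ZMOD (p₁ * p₂ : ℕ)] → η (u * a) = η a := by
    intro u a hua
    have hNpos : (0 : ℤ) < N := by omega
    have e1 := Int.emod_nonneg u hNpos.ne'
    obtain ⟨y, hy⟩ := Int.eq_ofNat_of_zero_le e1
    have hyu : (y : ℤ) ≡ u [ZMOD N] := by rw [← hy]; exact Int.mod_modEq _ _
    have hdN : ((p₁ * p₂ : ℕ) : ℤ) ∣ N := by
      rw [hNr]; push_cast; exact dvd_mul_right _ _
    have hy1 : (y : ℤ) ≡ (1 : ℕ) [ZMOD (p₁ * p₂ : ℕ)] := by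
      exact_mod_cast (hyu.of_dvd hdN).trans hua
    have hy2 : y % (p₁ * p₂) = 1 % (p₁ * p₂) := Int.natCast_modEq_iff.1 hy1
    have hbig : 1 < p₁ * p₂ := by
      have := nd.one_lt1; have := nd.one_lt2; nlinarith
    rw [Nat.mod_eq_of_lt hbig] at hy2
    obtain ⟨j, hj⟩ := hu y hy2
    apply eta_pow_mul p N η hηN hηp u j
    have h3 : ((p ^ j : ℕ) : ℤ) ≡ (y : ℤ) [ZMOD N] := Int.natCast_modEq_iff.2 hj
    push_cast at h3
    exact (h3.trans hyu).symm
  obtain ⟨T, hT1, hT2, hTD, hTF⟩ := reduce p₁ p₂ m n p N hp₁ hp₂ hne hm hn hN η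
    (Nat.isCoprime_iff_coprime.2 hcopp1) (Nat.isCoprime_iff_coprime.2 hcopp2) hηN hηp hmul
  obtain ⟨X1, X2, hX1, hX2, I1, I2, I3, hAB, ⟨a', ha'⟩, ⟨b', hb'⟩⟩ :=
    core_fourier nd hp hp₁ hp₂ m n N hm hn hN f e' S1 S2 hS hS1 hS2
    red ξ w η hξ hw hηsum hGG (hJ 1 S1 one_pos hN1 hs1) (hJ (N - 1) S2 (by omega) (by omega) hs2)
    T hT1 hT2 (fun e => hTF e)
  rw [nd.sum_five T hT1 hT2] at I3
  have hpfsq : ((p : ℤ) ^ f) = ((p : ℤ) ^ e * p ^ e') ^ 2 := by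
    rw [hfe, heven]; ring
  have hfin := hsolve _ _ _ _ _ X1 X2 I1 I2 I3
    (solve_gen ((p : ℤ) ^ e) ((p : ℤ) ^ e') (p₁ * p₂) X1 X2 _ _ a' b'
      (by
        have : ((p₁ : ℤ) * p₂ + 1) = 4 * p ^ h := by exact_mod_cast nd.D0
        rw [this, heven]; ring)
      (by exact_mod_cast Nat.one_lt_pow (by omega) hp.one_lt)
      (by have := hp.pos; positivity)
      (by rw [hX1, hpfsq]) (by rw [hX2, hpfsq]) (by rw [hAB, hpfsq]) ha' hb')
  have hval : ∀ x, T x = T 1 ∨ T x = T (-1) := by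
    intro x
    rcases nd.mem_five T hT1 hT2 x with h | h | h | h | h
    · rw [h]; exact hfin.1
    · rw [h]; exact hfin.2.1
    · rw [h]; exact hfin.2.2
    · exact Or.inl h
    · exact Or.inr h
  apply srg_of_two_values ψ hψ D h0 hneg (T 1 : A) (T (-1) : A)
  intro a ha
  obtain ⟨c, hc⟩ := Subgroup.mem_zpowers_iff.1 (hγ (Units.mk0 a ha))
  have hac : a = ((γ ^ c : Fˣ) : F) := by rw [hc]; rfl
  have hsum : ∑ x ∈ D.toFinset, ψ (a * x) =
      ((∑ i ∈ Finset.range (p₁ ^ (m-1)), ∑ j ∈ Finset.range (p₂ ^ (n-1)),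
        η (c + (p₂ ^ n * i + p₁ ^ m * j : ℕ)) : ℤ) : A) := by
    push_cast
    have e1 : ∀ i j : ℕ, (η (c + (p₂ ^ n * i + p₁ ^ m * j : ℕ)) : A) =
        ∑ y ∈ rootSet Fˣ M, ψ (a * ((γ ^ ((p₂ ^ n * i + p₁ ^ m * j : ℕ) : ℤ) * y : Fˣ) : F)) := by
      intro i j
      rw [← hηψ]
      refine Finset.sum_congr rfl fun y _ => ?_
      rw [hac, zpow_add, mul_assoc, Units.val_mul]
    have e2 : ∀ i j : ℕ, (η (c + ((p₂ : ℤ) ^ n * (i : ℤ) + (p₁ : ℤ) ^ m * (j : ℤ))) : A) =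
        ∑ y ∈ rootSet Fˣ M, ψ (a * ((γ ^ ((p₂ ^ n * i + p₁ ^ m * j : ℕ) : ℤ) * y : Fˣ) : F)) := by
      intro i j
      rw [← e1]; push_cast; rfl
    simp only [e2]
    rw [← Finset.sum_product', ← Finset.sum_product']
    symm
    refine Finset.sum_nbij (fun z : (ℕ × ℕ) × Fˣ =>
      ((γ ^ ((p₂ ^ n * z.1.1 + p₁ ^ m * z.1.2 : ℕ) : ℤ) * z.2 : Fˣ) : F)) ?_ ?_ ?_ ?_
    · rintro ⟨⟨i, j⟩, y⟩ hz
      simp only [Finset.mem_product, Finset.mem_range, mem_rootSet] at hz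
      obtain ⟨⟨hi, hj⟩, hy⟩ := hz
      rw [Set.mem_toFinset, memD]
      obtain ⟨l, rfl⟩ := Subgroup.mem_zpowers_iff.1 (hγ y)
      obtain ⟨k, rfl⟩ := (hroot l).1 hy
      exact ⟨i, hi, j, hj, k, by rw [zpow_add]⟩
    · rintro ⟨⟨i, j⟩, y⟩ hz ⟨⟨i', j'⟩, y'⟩ hz' heq
      simp only [Finset.coe_product, Set.mem_prod, Finset.mem_coe, Finset.mem_product,
        Finset.mem_range, mem_rootSet] at hz hz'
      obtain ⟨⟨hi, hj⟩, hy⟩ := hz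
      obtain ⟨⟨hi', hj'⟩, hy'⟩ := hz'
      have heq' := Units.ext heq
      simp only at heq'
      have h5 : (γ ^ (((p₂ ^ n * i + p₁ ^ m * j : ℕ) : ℤ) - ((p₂ ^ n * i' + p₁ ^ m * j' : ℕ) : ℤ))) ^ M
          = 1 := by
        have : γ ^ (((p₂ ^ n * i + p₁ ^ m * j : ℕ) : ℤ) - ((p₂ ^ n * i' + p₁ ^ m * j' : ℕ) : ℤ))
            = y' * y⁻¹ := by
          rw [zpow_sub, mul_inv_eq_iff_eq_mul, mul_right_comm, eq_mul_inv_iff_mul_eq, heq', mul_comm]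
        rw [this, mul_pow, inv_pow, hy, hy', inv_one, mul_one]
      have h6 := (hroot _).1 h5
      rw [hN] at h6
      obtain ⟨rfl, rfl⟩ := idx_inj (p₁ ^ (m-1)) (p₂ ^ (n-1)) i i' j j' (p₁ ^ m) (p₂ ^ n) hcopAB hi hi'
        hj hj' (Nat.pow_le_pow_right hp₁.pos (by omega)) (Nat.pow_le_pow_right hp₂.pos (by omega)) h6
      rw [mul_left_cancel heq']
    · intro x hx
      rw [Finset.mem_coe, Set.mem_toFinset, memD] at hx
      obtain ⟨i, hi, j, hj, k, rfl⟩ := hx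
      refine ⟨((i, j), γ ^ ((N : ℤ) * k)), ?_, ?_⟩
      · simp only [Finset.mem_coe, Finset.mem_product, Finset.mem_range, mem_rootSet]
        exact ⟨⟨hi, hj⟩, (hroot _).2 (dvd_mul_right _ _)⟩
      · simp only [zpow_add]
    · rintro ⟨⟨i, j⟩, y⟩ _
      rfl
  obtain ⟨x, hx⟩ := hTD c
  rw [hsum, hx]
  rcases hval x with h | h
  · left; rw [h]
  · right; rw [h]

end assemble


theorem case_split (p p₁ p₂ e : ℕ) (b : ℤ) (hp : p.Prime) (hp₁ : p₁.Prime) (hp₂ : p₂.Prime)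
    (hp₁mod : p₁ % 4 = 1) (hp₂mod : p₂ % 4 = 3) (he : 1 ≤ e) (hb1 : b = 1 ∨ b = -1)
    (hp₁eq : (p₁ : ℤ) = 2 * (p : ℤ) ^ e + b) (hp₂eq : (p₂ : ℤ) = 2 * (p : ℤ) ^ e - b) :
    (p = 2 ∧ e = 1 ∧ b = 1) ∨ (p = 3 ∧ b = -1) := by
  have hP : ((p ^ e : ℕ) : ℤ) = (p : ℤ) ^ e := by push_cast; rfl
  rw [← hP] at hp₁eq hp₂eq
  by_cases h3 : p = 3
  · right
    refine ⟨h3, ?_⟩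
    subst h3
    have hodd : 3 ^ e % 2 = 1 := Nat.odd_iff.1 (Odd.pow (by decide))
    rcases hb1 with rfl | rfl
    · omega
    · rfl
  · left
    have hnd : ¬ 3 ∣ p ^ e := by
      intro h
      exact h3 ((Nat.prime_dvd_prime_iff_eq Nat.prime_three hp).1
        (Nat.prime_three.dvd_of_dvd_pow h)).symm
    have hle : p ≤ p ^ e := Nat.le_self_pow (by omega) p
    have h2 := hp.two_le
    have hor : 3 ∣ p₁ ∨ 3 ∣ p₂ := by
      have hnd' : p ^ e % 3 = 1 ∨ p ^ e % 3 = 2 := by omega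
      generalize p ^ e = P at *
      rcases hnd' with h | h <;> rcases hb1 with rfl | rfl <;>
        first | (left; omega) | (right; omega)
    have hp₂3 : p₂ = 3 := by
      rcases hor with h | h
      · have := (Nat.prime_dvd_prime_iff_eq Nat.prime_three hp₁).1 h
        omega
      · exact ((Nat.prime_dvd_prime_iff_eq Nat.prime_three hp₂).1 h).symm
    have hb : b = 1 := by
      rcases hb1 with rfl | rfl
      · rfl
      · omega
    have hpe : p ^ e = 2 := by omega
    have hp2 : p = 2 := by omega
    subst hp2
    refine ⟨rfl, ?_, hb⟩
    exact Nat.pow_right_injective le_rfl (by simpa using hpe)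

/-- Corollary 3.3 of the paper. -/
theorem statement_13 (p₁ p₂ m n : ℕ) (hp₁ : p₁.Prime) (hp₂ : p₂.Prime)
    (hp₁mod : p₁ % 4 = 1) (hp₂mod : p₂ % 4 = 3) (hm : 1 ≤ m) (hn : 1 ≤ n)
    (N : ℕ) (hN : N = p₁ ^ m * p₂ ^ n)
    (p : ℕ) (hp : p.Prime)
    (hord₁ : orderOf ((p : ZMod (p₁ ^ m))) = Nat.totient (p₁ ^ m))
    (hord₂ : orderOf ((p : ZMod (p₂ ^ n))) = Nat.totient (p₂ ^ n))
    (f : ℕ) (hf : f = orderOf ((p : ZMod N))) (hford : 2 * f = Nat.totient N)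
    (F : Type*) [Field F] [Fintype F] (hcard : Fintype.card F = p ^ f)
    (γ : Fˣ) (hγ : ∀ x : Fˣ, x ∈ Subgroup.zpowers γ)
    (D : Set F)
    (hD : D = ⋃ i < p₁ ^ (m - 1), ⋃ j < p₂ ^ (n - 1),
      cycClass γ N (p₂ ^ n * i + p₁ ^ m * j))
    -- `h` is the class number of `ℚ(√-p₁p₂)`
    (K : Type*) [Field K] [NumberField K] (α : K)
    (hα : α ^ 2 = -((p₁ : K) * p₂)) (hKα : Algebra.adjoin ℚ {α} = ⊤)
    (h : ℕ) (hh : h = NumberField.classNumber K)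
    -- `h` is even and `b, c ∈ {1, -1}` satisfy the stated conditions
    (b c : ℤ) (hb1 : b = 1 ∨ b = -1) (hc1 : c = 1 ∨ c = -1)
    (e : ℕ) (heven : h = 2 * e)
    (hbc : 4 * (p : ℤ) ^ h = b ^ 2 + (p₁ : ℤ) * p₂ * c ^ 2)
    (e' : ℕ) (hfe : f = h + 2 * e')
    (hmod : b * (p : ℤ) ^ e' ≡ 2 [ZMOD ((p₁ : ℤ) * p₂)])
    (hp₁eq : (p₁ : ℤ) = 2 * (p : ℤ) ^ e + b)
    (hp₂eq : (p₂ : ℤ) = 2 * (p : ℤ) ^ e - b) :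
    (0 : F) ∉ D ∧ -D = D ∧
      ∃ k lam mu : ℕ, (cayley D).IsSRGWith (Fintype.card F) k lam mu := by
  have he : 1 ≤ e := by
    have : 0 < NumberField.classNumber K := by
      unfold NumberField.classNumber; exact Fintype.card_pos
    omega
  have hmod' := hmod.symm.dvd
  obtain ⟨k, hk⟩ := hmod'
  rcases case_split p p₁ p₂ e b hp hp₁ hp₂ hp₁mod hp₂mod he hb1 hp₁eq hp₂eq with
    ⟨rfl, rfl, rfl⟩ | ⟨rfl, rfl⟩
  · obtain rfl : p₁ = 5 := by norm_num at hp₁eq; exact_mod_cast hp₁eq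
    obtain rfl : p₂ = 3 := by norm_num at hp₂eq; exact_mod_cast hp₂eq
    obtain rfl : h = 2 := heven
    obtain ⟨H, nd⟩ := num1
    refine main_case nd (by norm_num) (Or.inl rfl) hp hp₁ hp₂ (by decide) (by decide) m n N hm hn hN
      f hf hford F hcard γ hγ D hD 1 e' he (by norm_num) hfe ?_
    intro s00 s01 s10 sp sm X1 X2 I1 I2 I3 hh
    push_cast at I1 I2 I3 hk hh
    exact solve1 s00 s01 s10 sp sm X1 X2 _ k (by linarith) (by linarith) (by linarith)
        (by linarith) hh
  · have h1 : p₁ + 1 = 2 * 3 ^ e := by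
      have : (p₁ : ℤ) + 1 = 2 * 3 ^ e := by push_cast at hp₁eq; linarith
      exact_mod_cast this
    have h2 : p₂ = 2 * 3 ^ e + 1 := by
      have : (p₂ : ℤ) = 2 * 3 ^ e + 1 := by push_cast at hp₂eq; linarith
      exact_mod_cast this
    have hle : e ≤ 2 := e_le_two α p₁ p₂ hp₁ hp₂ hα hKα e he h1 h2 (by rw [← hh, heven])
    have : e = 1 ∨ e = 2 := by omega
    rcases this with rfl | rfl
    · obtain rfl : p₁ = 5 := by omega
      obtain rfl : p₂ = 7 := by omega
      obtain rfl : h = 2 := heven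
      obtain ⟨H, nd⟩ := num2
      refine main_case nd (by norm_num) (Or.inr rfl) hp hp₁ hp₂ (by decide) (by decide) m n N hm hn
        hN f hf hford F hcard γ hγ D hD 1 e' he (by norm_num) hfe ?_
      intro s00 s01 s10 sp sm X1 X2 I1 I2 I3 hh
      push_cast at I1 I2 I3 hk hh
      exact solve2 s00 s01 s10 sp sm X1 X2 _ k (by linarith) (by linarith) (by linarith)
        (by linarith) hh
    · obtain rfl : p₁ = 17 := by omega
      obtain rfl : p₂ = 19 := by omega
      obtain rfl : h = 4 := heven
      obtain ⟨H, nd⟩ := num3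
      refine main_case nd (by norm_num) (Or.inr rfl) hp hp₁ hp₂ (by decide) (by decide) m n N hm hn
        hN f hf hford F hcard γ hγ D hD 2 e' he (by norm_num) hfe ?_
      intro s00 s01 s10 sp sm X1 X2 I1 I2 I3 hh
      push_cast at I1 I2 I3 hk hh
      exact solve3 s00 s01 s10 sp sm X1 X2 _ k (by linarith) (by linarith) (by linarith)
        (by linarith) hh
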